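/- Let p ∈ [2,∞), T ∈ (0,∞). Assume ∫_0^T |a(t)| dt < ∞, that δ(t) > 0 for a.e. t ∈ (0,T) where δ(t) is the smallest eigenvalue of A(t), and that f is strongly measurable with both ∫_0^T ‖f(t,·)‖_{L_p}^p dt < ∞ and ∫_0^T ‖f(t,·)‖_{L_p}^p δ(t)^{1-p} dt < ∞. Then there exists a unique weak solution u of ∂_t u = a^{ij}(t) u_{x^i x^j} + f with u(0) = 0 which is continuous from [0,T] into L_p(ℝ^d); moreover sup_{t∈[0,T]} ‖u(t,·)‖_{L_p}^p ≤ N_1 ∫_0^T ‖f(t,·)‖_{L_p}^p dt with N_1 = N_1(p,T), and for a.e. t the distributional second derivatives of u(t,·) are represented by functions u_{x^i x^j}(t,·) ∈ L_p(ℝ^d) satisfying ∫_0^T Σ_{i,j} ‖u_{x^i x^j}(t,·)‖_{L_p}^p δ(t) dt ≤ N_2 ∫_0^T ‖f(t,·)‖_{L_p}^p δ(t)^{1-p} dt with N_2 = N_2(d,p). -/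

import Mathlib

open MeasureTheory Set ENNReal

noncomputable section

/-- The partial derivative `∂_{x^i} φ` of a function on `ℝ^d`. -/
def pd {d : ℕ} (i : Fin d) (φ : (Fin d → ℝ) → ℝ) : (Fin d → ℝ) → ℝ :=
  fun x => fderiv ℝ φ x (Pi.single i 1)

/-- `|a(t)| = max_{i,j} |a^{ij}(t)|`. -/
def aMax {d : ℕ} (a : ℝ → Fin d → Fin d → ℝ) (t : ℝ) : ℝ :=
  ⨆ i, ⨆ j, |a t i j|

/-- `u` is a weak solution of `∂_t u = a^{ij}(t) u_{x^i x^j} + f`, `u(0) = u₀`, on `[0,T]`. -/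
def IsWeakSolution {d : ℕ} (p : ℝ≥0∞) (T : ℝ) (a : ℝ → Fin d → Fin d → ℝ)
    (u0 : Lp ℝ p (volume : Measure (Fin d → ℝ)))
    (f u : ℝ → Lp ℝ p (volume : Measure (Fin d → ℝ))) : Prop :=
  ∀ φ : (Fin d → ℝ) → ℝ, ContDiff ℝ (⊤ : ℕ∞) φ → HasCompactSupport φ →
    ∀ t ∈ Icc (0:ℝ) T,
      (∫ x, u t x * φ x) =
        (∫ x, u0 x * φ x) +
        ∫ s in Ioc (0:ℝ) t,
          ((∑ i, ∑ j, a s i j * ∫ x, u s x * pd i (pd j φ) x)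
            + ∫ x, f s x * φ x)

section

namespace MR
open ProbabilityTheory Matrix

variable {d : ℕ}

/-- The centred Gaussian law on `ℝ^d` with covariance `C`. -/
def gam (C : Matrix (Fin d) (Fin d) ℝ) : Measure (Fin d → ℝ) :=
  (multivariateGaussian 0 C).map (WithLp.ofLp)

instance gam_prob (C : Matrix (Fin d) (Fin d) ℝ) : IsProbabilityMeasure (gam C) :=
  Measure.isProbabilityMeasure_map (by fun_prop)

theorem gam_add {C D : Matrix (Fin d) (Fin d) ℝ} (hC : C.PosSemidef) (hD : D.PosSemidef) :
    gam (C + D) = (gam C) ∗ (gam D) := by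
  have h : multivariateGaussian 0 (C + D) = (multivariateGaussian 0 C) ∗ (multivariateGaussian 0 D) := by
    apply Measure.ext_of_charFun
    ext t
    rw [charFun_conv, charFun_multivariateGaussian (hC.add hD), charFun_multivariateGaussian hC,
      charFun_multivariateGaussian hD, ← Complex.exp_add]
    congr 1
    simp [Matrix.add_mulVec, dotProduct_add]
    ring
  unfold gam
  rw [h]
  exact Measure.map_conv_continuousLinearMap (EuclideanSpace.equiv (Fin d) ℝ).toContinuousLinearMap

theorem gam_eval {C : Matrix (Fin d) (Fin d) ℝ} (hC : C.PosSemidef) (i : Fin d) :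
    (gam C).map (fun y => y i) = gaussianReal 0 (C i i).toNNReal := by
  unfold gam
  rw [Measure.map_map (by fun_prop) (by fun_prop)]
  exact (measurePreserving_eval_multivariateGaussian (μ := 0) hC (i := i)).map_eq

theorem gam_memLp {C : Matrix (Fin d) (Fin d) ℝ} (hC : C.PosSemidef) (i : Fin d) (p : ℝ≥0∞) (hp : p ≠ ∞) :
    MemLp (fun y => y i) p (gam C) := by
  have := memLp_id_gaussianReal' (μ := 0) (v := (C i i).toNNReal) p hp
  have hm : Measurable (fun y : Fin d → ℝ => y i) := measurable_pi_apply i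
  rw [← gam_eval hC i] at this
  exact (memLp_map_measure_iff (by fun_prop) hm.aemeasurable).1 this

theorem gam_mean {C : Matrix (Fin d) (Fin d) ℝ} (hC : C.PosSemidef) (i : Fin d) :
    ∫ y, y i ∂(gam C) = 0 := by
  have h := integral_map (μ := gam C) (φ := fun y => y i) (measurable_pi_apply i).aemeasurable (f := fun x : ℝ => x) (by fun_prop)
  rw [← h, gam_eval hC]
  simp

theorem gam_cov {C : Matrix (Fin d) (Fin d) ℝ} (hC : C.PosSemidef) (i j : Fin d) :
    ∫ y, y i * y j ∂(gam C) = C i j := by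
  have h := covariance_eval_multivariateGaussian (μ := 0) hC i j
  unfold gam
  rw [integral_map (by fun_prop) (by fun_prop), ← h]
  have h2 : ∀ i, ∫ x, x.ofLp i ∂(multivariateGaussian 0 C) = 0 := by
    intro i
    have hm : Measurable (fun y : Fin d → ℝ => y i) := measurable_pi_apply i
    rw [← gam_mean hC i, gam, integral_map (by fun_prop) hm.aestronglyMeasurable]
  simp [covariance, h2]

/-- third absolute moment of the standard normal law -/
def M3 : ℝ := ∫ x, |x| ^ 3 ∂(gaussianReal 0 1)

theorem M3_nonneg : 0 ≤ M3 := integral_nonneg fun _ => by positivity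

theorem gam_third {C : Matrix (Fin d) (Fin d) ℝ} (hC : C.PosSemidef) (i : Fin d) :
    ∫ y, |y i| ^ 3 ∂(gam C) = M3 * (C i i) ^ (3/2 : ℝ) := by
  have h := integral_map (μ := gam C) (φ := fun y => y i) (measurable_pi_apply i).aemeasurable (f := fun x : ℝ => |x| ^ 3) (by fun_prop)
  have hnn : 0 ≤ C i i := hC.diag_nonneg
  rw [← h, gam_eval hC]
  have h3 : gaussianReal 0 (C i i).toNNReal = (gaussianReal 0 1).map (√(C i i) * ·) := by
    rw [gaussianReal_map_const_mul]
    congr 1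
    · simp
    · ext; simp [Real.sq_sqrt hnn, hnn]
  rw [h3, integral_map (by fun_prop) (by fun_prop)]
  simp_rw [abs_mul, mul_pow]
  rw [integral_const_mul, mul_comm, M3]
  congr 1
  rw [abs_of_nonneg (Real.sqrt_nonneg _), Real.sqrt_eq_rpow, ← Real.rpow_natCast, ← Real.rpow_mul hnn]
  norm_num

theorem diag_le_trace {C : Matrix (Fin d) (Fin d) ℝ} (hC : C.PosSemidef) (i : Fin d) : C i i ≤ C.trace :=
  Finset.single_le_sum (f := fun i => C i i) (fun i _ => hC.diag_nonneg) (Finset.mem_univ i)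

theorem trace_nn {C : Matrix (Fin d) (Fin d) ℝ} (hC : C.PosSemidef) : 0 ≤ C.trace :=
  Finset.sum_nonneg fun i _ => hC.diag_nonneg

theorem norm_pow_le_sum (y : Fin d → ℝ) (n : ℕ) (hn : n ≠ 0) : ‖y‖ ^ n ≤ ∑ i, |y i| ^ n := by
  have hS : 0 ≤ ∑ i, |y i| ^ n := Finset.sum_nonneg fun i _ => by positivity
  have key : ‖y‖ ≤ (∑ i, |y i| ^ n) ^ (1 / n : ℝ) := by
    refine (pi_norm_le_iff_of_nonneg (by positivity)).2 fun i => ?_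
    rw [Real.norm_eq_abs]
    calc |y i| = (|y i| ^ n) ^ (1 / n : ℝ) := by
          rw [one_div, Real.pow_rpow_inv_natCast (abs_nonneg _) hn]
      _ ≤ _ := by
          apply Real.rpow_le_rpow (by positivity) _ (by positivity)
          exact Finset.single_le_sum (f := fun i => |y i| ^ n) (fun i _ => by positivity) (Finset.mem_univ i)
  calc ‖y‖ ^ n ≤ ((∑ i, |y i| ^ n) ^ (1 / n : ℝ)) ^ n := by gcongr
    _ = _ := by rw [one_div, Real.rpow_inv_natCast_pow hS hn]

theorem gam_int_pow {C : Matrix (Fin d) (Fin d) ℝ} (hC : C.PosSemidef) (i : Fin d) (n : ℕ) (hn : n ≠ 0) :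
    Integrable (fun y => |y i| ^ n) (gam C) := by
  have := (gam_memLp hC i n (by simp)).integrable_norm_pow hn
  simpa using this

theorem gam_int_norm_pow {C : Matrix (Fin d) (Fin d) ℝ} (hC : C.PosSemidef) (n : ℕ) (hn : n ≠ 0) :
    Integrable (fun y => ‖y‖ ^ n) (gam C) := by
  refine Integrable.mono' (integrable_finsetSum Finset.univ fun i _ => gam_int_pow hC i n hn) (by fun_prop) ?_
  filter_upwards with y
  rw [norm_pow, norm_norm]
  exact norm_pow_le_sum y n hn

theorem gam_norm_third {C : Matrix (Fin d) (Fin d) ℝ} (hC : C.PosSemidef) :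
    ∫ y, ‖y‖ ^ 3 ∂(gam C) ≤ d * M3 * C.trace ^ (3/2 : ℝ) := by
  calc ∫ y, ‖y‖ ^ 3 ∂(gam C) ≤ ∫ y, ∑ i, |y i| ^ 3 ∂(gam C) := by
        apply integral_mono (gam_int_norm_pow hC 3 (by norm_num))
          (integrable_finsetSum Finset.univ fun i _ => gam_int_pow hC i 3 (by norm_num))
        exact fun y => norm_pow_le_sum y 3 (by norm_num)
    _ = ∑ i, M3 * (C i i) ^ (3/2 : ℝ) := by
        rw [integral_finsetSum _ fun i _ => gam_int_pow hC i 3 (by norm_num)]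
        exact Finset.sum_congr rfl fun i _ => gam_third hC i
    _ ≤ ∑ i : Fin d, M3 * C.trace ^ (3/2 : ℝ) := by
        refine Finset.sum_le_sum fun i _ => mul_le_mul_of_nonneg_left ?_ M3_nonneg
        exact Real.rpow_le_rpow hC.diag_nonneg (diag_le_trace hC i) (by norm_num)
    _ = _ := by simp; ring

theorem gam_norm_sq {C : Matrix (Fin d) (Fin d) ℝ} (hC : C.PosSemidef) :
    ∫ y, ‖y‖ ^ 2 ∂(gam C) ≤ C.trace := by
  calc ∫ y, ‖y‖ ^ 2 ∂(gam C) ≤ ∫ y, ∑ i, |y i| ^ 2 ∂(gam C) := by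
        apply integral_mono (gam_int_norm_pow hC 2 (by norm_num))
          (integrable_finsetSum Finset.univ fun i _ => gam_int_pow hC i 2 (by norm_num))
        exact fun y => norm_pow_le_sum y 2 (by norm_num)
    _ = ∑ i, C i i := by
        rw [integral_finsetSum _ fun i _ => gam_int_pow hC i 2 (by norm_num)]
        refine Finset.sum_congr rfl fun i _ => ?_
        rw [← gam_cov hC i i]
        simp [sq]
    _ = _ := rfl

/-- Gaussian density with variance `v`. -/
def hk (v : ℝ) (x : Fin d → ℝ) : ℝ := (√(2 * Real.pi * v))⁻¹ ^ d * Real.exp (-(∑ k, x k ^ 2) / (2 * v))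

theorem hk_nonneg (v : ℝ) (x : Fin d → ℝ) : 0 ≤ hk v x := by unfold hk; positivity

theorem hk_cont (v : ℝ) : Continuous (hk (d := d) v) := by unfold hk; fun_prop

theorem hk_eq_prod {v : ℝ} (hv : 0 < v) (x : Fin d → ℝ) :
    hk v x = ∏ i, gaussianPDFReal 0 v.toNNReal (x i) := by
  simp only [gaussianPDFReal, Finset.prod_mul_distrib, ← Real.exp_sum, hk]
  simp [hv.le, Finset.sum_div, Finset.sum_neg_distrib, neg_div]

theorem pi_gauss {v : ℝ} (hv : 0 < v) :
    Measure.pi (fun _ : Fin d => gaussianReal 0 v.toNNReal) = volume.withDensity (fun x => ENNReal.ofReal (hk v x)) := by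
  refine Measure.pi_eq fun s hs => ?_
  rw [withDensity_apply _ (MeasurableSet.univ_pi hs)]
  have hIntg : ∀ i, Integrable (gaussianPDFReal 0 v.toNNReal) ((volume : Measure ℝ).restrict (s i)) :=
    fun i => (integrable_gaussianPDFReal 0 _).restrict
  simp_rw [hk_eq_prod hv]
  rw [volume_pi, Measure.restrict_pi_pi, ← ofReal_integral_eq_lintegral_ofReal,
    integral_fintype_prod_eq_prod (f := fun _ y => gaussianPDFReal 0 v.toNNReal y),
    ENNReal.ofReal_prod_of_nonneg]
  · refine Finset.prod_congr rfl fun i _ => ?_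
    rw [gaussianReal_of_var_ne_zero _ (by simpa using hv), withDensity_apply _ (hs i),
      ofReal_integral_eq_lintegral_ofReal (hIntg i)]
    · rfl
    · exact Filter.Eventually.of_forall fun x => gaussianPDFReal_nonneg 0 _ _
  · exact fun i _ => integral_nonneg fun x => gaussianPDFReal_nonneg 0 _ _
  · exact Integrable.fintype_prod hIntg
  · exact Filter.Eventually.of_forall fun x => Finset.prod_nonneg fun i _ => gaussianPDFReal_nonneg 0 _ _

theorem smul_one_psd {v : ℝ} (hv : 0 ≤ v) : (v • (1 : Matrix (Fin d) (Fin d) ℝ)).PosSemidef :=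
  Matrix.PosSemidef.one.smul hv

theorem gam_smul_one {v : ℝ} (hv : 0 < v) :
    gam (v • (1 : Matrix (Fin d) (Fin d) ℝ)) = volume.withDensity (fun x => ENNReal.ofReal (hk v x)) := by
  rw [← pi_gauss hv]
  have h : (Measure.pi (fun _ : Fin d => gaussianReal 0 v.toNNReal)).map (WithLp.toLp 2)
      = multivariateGaussian 0 (v • (1 : Matrix (Fin d) (Fin d) ℝ)) := by
    apply Measure.ext_of_charFun (E := EuclideanSpace ℝ (Fin d))
    ext t
    simp_rw [charFun_multivariateGaussian (smul_one_psd hv.le), charFun_pi, charFun_gaussianReal, ← Complex.exp_sum]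
    simp [hv.le, Finset.sum_div, neg_div, Matrix.smul_mulVec, dotProduct, Finset.mul_sum]
    congr 1; congr 1
    refine Finset.sum_congr rfl fun i _ => by ring
  unfold gam
  rw [← h, Measure.map_map (by fun_prop) (by fun_prop)]
  exact Measure.map_id

theorem gam_zero : gam (0 : Matrix (Fin d) (Fin d) ℝ) = Measure.dirac 0 := by
  unfold gam
  have : multivariateGaussian 0 (0 : Matrix (Fin d) (Fin d) ℝ) = Measure.dirac 0 := by
    simp [multivariateGaussian, CFC.sqrt_zero]
  rw [this, Measure.map_dirac' (by fun_prop)]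
  rfl

theorem integral_gam_smul_one {v : ℝ} (hv : 0 < v) (F : (Fin d → ℝ) → ℝ) :
    ∫ y, F y ∂(gam (v • (1 : Matrix (Fin d) (Fin d) ℝ))) = ∫ y, hk v y * F y := by
  rw [gam_smul_one hv, integral_withDensity_eq_integral_toReal_smul]
  · simp [ENNReal.toReal_ofReal (hk_nonneg v _)]
  · exact ENNReal.measurable_ofReal.comp (hk_cont v).measurable
  · simp

end MR

end

section

namespace MR
open ProbabilityTheory Matrix Filter Topology

variable {d : ℕ} {P : ℝ≥0∞} [Fact (1 ≤ P)] [Fact (P ≠ ∞)]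

/-- `L_P(ℝ^d)` -/
abbrev LP (P : ℝ≥0∞) (d : ℕ) := Lp ℝ P (volume : Measure (Fin d → ℝ))

/-- translation isometry -/
def tr (y : Fin d → ℝ) : LP P d →ₗᵢ[ℝ] LP P d :=
  Lp.compMeasurePreservingₗᵢ ℝ (fun x => x + y) (measurePreserving_add_right volume y)

theorem tr_coe (y : Fin d → ℝ) (g : LP P d) : (tr y g : (Fin d → ℝ) → ℝ) =ᵐ[volume] fun x => g (x + y) :=
  Lp.coeFn_compMeasurePreserving g (measurePreserving_add_right volume y)

theorem tr_tr (y z : Fin d → ℝ) (g : LP P d) : tr y (tr z g) = tr (y + z) g := by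
  apply Lp.ext
  have h1 := (measurePreserving_add_right (volume : Measure (Fin d → ℝ)) y).quasiMeasurePreserving.ae_eq_comp (tr_coe z g)
  filter_upwards [tr_coe y (tr z g), tr_coe (y+z) g, h1] with x hx1 hx2 hx3
  rw [hx1, hx2]
  simpa [add_assoc] using hx3

theorem tr_zero (g : LP P d) : tr 0 g = g := by
  apply Lp.ext
  filter_upwards [tr_coe 0 g] with x hx1
  simpa using hx1

theorem tr_norm (y : Fin d → ℝ) (g : LP P d) : ‖tr y g‖ = ‖g‖ := (tr y).norm_map g

theorem tr_cont2 : Continuous fun z : (Fin d → ℝ) × LP P d => tr z.1 z.2 := by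
  have hP : P ≠ ∞ := Fact.out
  let G : (Fin d → ℝ) × LP P d → C(Fin d → ℝ, Fin d → ℝ) := fun z => ⟨fun x => x + z.1, by fun_prop⟩
  have hG : Continuous G := ContinuousMap.continuous_of_continuous_uncurry _ (by
    simp only [Function.uncurry_def]; show Continuous fun q : ((Fin d → ℝ) × LP P d) × (Fin d → ℝ) => q.2 + q.1.1
    fun_prop)
  exact Continuous.compMeasurePreservingLp (p := P) (E := ℝ) (μ := (volume : Measure (Fin d → ℝ))) (ν := volume)
    (f := fun z : (Fin d → ℝ) × LP P d => z.2) continuous_snd hG (fun z => measurePreserving_add_right volume z.1) hP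

theorem tr_cont (g : LP P d) : Continuous fun y => tr y g :=
  tr_cont2.comp (by fun_prop : Continuous fun y => (y, g))

instance conj_fact : Fact (1 ≤ ENNReal.conjExponent P) := ⟨by simp [ENNReal.conjExponent]⟩

/-- pairing functional -/
def prL (φ : (Fin d → ℝ) → ℝ) : LP P d →L[ℝ] ℝ :=
  open Classical in
  if h : MemLp φ (ENNReal.conjExponent P) volume then
    ((ContinuousLinearMap.mul ℝ ℝ).lpPairing volume P (ENNReal.conjExponent P)).flip h.toLp else 0

theorem prL_apply {φ : (Fin d → ℝ) → ℝ} (h : MemLp φ (ENNReal.conjExponent P) volume) (g : LP P d) :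
    prL φ g = ∫ x, g x * φ x := by
  rw [prL, dif_pos h, ContinuousLinearMap.flip_apply, ContinuousLinearMap.lpPairing_eq_integral]
  apply integral_congr_ae
  filter_upwards [h.coeFn_toLp] with x hx
  simp [hx]

/-- smooth compactly supported functions -/
def Test (φ : (Fin d → ℝ) → ℝ) : Prop := ContDiff ℝ (⊤ : ℕ∞) φ ∧ HasCompactSupport φ

theorem Test.memLp {φ : (Fin d → ℝ) → ℝ} (h : Test φ) (q : ℝ≥0∞) : MemLp φ q volume :=
  h.1.continuous.memLp_of_hasCompactSupport h.2

theorem Test.pd {φ : (Fin d → ℝ) → ℝ} (h : Test φ) (i : Fin d) : Test (pd i φ) := by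
  refine ⟨?_, ?_⟩
  · unfold _root_.pd
    exact (h.1.fderiv_right (m := (⊤ : ℕ∞)) (by simp)).clm_apply contDiff_const
  · exact h.2.fderiv_apply (𝕜 := ℝ) _

theorem prT {φ : (Fin d → ℝ) → ℝ} (h : Test φ) (g : LP P d) : prL φ g = ∫ x, g x * φ x := prL_apply (h.memLp _) g

theorem Test.shift {φ : (Fin d → ℝ) → ℝ} (h : Test φ) (y : Fin d → ℝ) : Test (fun x => φ (x - y)) := by
  refine ⟨h.1.comp (by fun_prop), ?_⟩
  exact h.2.comp_homeomorph (Homeomorph.subRight y)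

theorem pd_shift (φ : (Fin d → ℝ) → ℝ) (y : Fin d → ℝ) (i : Fin d) :
    pd i (fun x => φ (x - y)) = fun x => pd i φ (x - y) := by
  ext x
  unfold pd
  rw [fderiv_comp_sub]

theorem pr_tr {φ : (Fin d → ℝ) → ℝ} (h : Test φ) (y : Fin d → ℝ) (g : LP P d) :
    prL φ (tr y g) = prL (fun x => φ (x - y)) g := by
  rw [prT h, prT (h.shift y)]
  rw [← integral_add_right_eq_self (fun x => g x * φ (x - y)) y]
  apply integral_congr_ae
  filter_upwards [tr_coe y g] with x hx
  simp [hx]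

theorem LP_locInt (g : LP P d) : LocallyIntegrable g volume :=
  (Lp.memLp g).locallyIntegrable Fact.out

theorem LP_ext {g h : LP P d} (H : ∀ φ, Test φ → prL φ g = prL φ h) : g = h := by
  apply Lp.ext
  apply ae_eq_of_integral_contDiff_smul_eq (LP_locInt g) (LP_locInt h)
  intro φ h1 h2
  have := H φ ⟨h1, h2⟩
  rw [prT ⟨h1, h2⟩, prT ⟨h1, h2⟩] at this
  simpa [mul_comm] using this



theorem tr_int (m : Measure (Fin d → ℝ)) [IsFiniteMeasure m] (g : LP P d) : Integrable (fun y => tr y g) m :=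
  Integrable.of_bound (tr_cont g).aestronglyMeasurable ‖g‖ (Eventually.of_forall fun y => (tr_norm y g).le)

/-- Gaussian averaging operator -/
def Gam (C : Matrix (Fin d) (Fin d) ℝ) : LP P d →L[ℝ] LP P d :=
  LinearMap.mkContinuous
    { toFun := fun g => ∫ y, tr y g ∂(gam C)
      map_add' := fun g h => by simp [integral_add (tr_int _ g) (tr_int _ h)]
      map_smul' := fun c g => by simp [integral_smul] } 1 (fun g => by
        simp only [LinearMap.coe_mk, AddHom.coe_mk, one_mul]
        refine (norm_integral_le_of_norm_le_const (C := ‖g‖) (Eventually.of_forall fun y => (tr_norm y g).le)).trans ?_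
        simp)

theorem Gam_apply (C : Matrix (Fin d) (Fin d) ℝ) (g : LP P d) : Gam C g = ∫ y, tr y g ∂(gam C) := rfl

theorem Gam_norm_le (C : Matrix (Fin d) (Fin d) ℝ) (g : LP P d) : ‖Gam C g‖ ≤ ‖g‖ := by
  refine (norm_integral_le_of_norm_le_const (C := ‖g‖) (Eventually.of_forall fun y => (tr_norm y g).le)).trans ?_
  simp

theorem Gam_zero (g : LP P d) : Gam 0 g = g := by
  rw [Gam_apply, gam_zero, integral_dirac, tr_zero]

theorem tr_Gam (C : Matrix (Fin d) (Fin d) ℝ) (y : Fin d → ℝ) (g : LP P d) : tr y (Gam C g) = Gam C (tr y g) := by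
  rw [Gam_apply, Gam_apply]
  rw [← LinearIsometry.coe_toContinuousLinearMap, ← ContinuousLinearMap.integral_comp_comm _ (tr_int _ g)]
  simp [tr_tr, add_comm]

theorem Gam_add {C D : Matrix (Fin d) (Fin d) ℝ} (hC : C.PosSemidef) (hD : D.PosSemidef) (g : LP P d) :
    Gam (C + D) g = Gam C (Gam D g) := by
  rw [Gam_apply, gam_add hC hD, integral_conv, Gam_apply]
  · congr 1
    ext1 x
    rw [Gam_apply, ← LinearIsometry.coe_toContinuousLinearMap, ← ContinuousLinearMap.integral_comp_comm _ (tr_int _ g)]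
    simp [tr_tr]
  · exact tr_int _ g

theorem clm_Gam (L : LP P d →L[ℝ] LP P d) (hL : ∀ y g, L (tr y g) = tr y (L g)) (C : Matrix (Fin d) (Fin d) ℝ) (g : LP P d) :
    L (Gam C g) = Gam C (L g) := by
  rw [Gam_apply, Gam_apply, ← ContinuousLinearMap.integral_comp_comm _ (tr_int _ g)]
  simp [hL]

theorem Gam_comm (C D : Matrix (Fin d) (Fin d) ℝ) (g : LP P d) : Gam C (Gam D g) = Gam D (Gam C g) :=
  clm_Gam _ (fun y g => (tr_Gam C y g).symm) D g

theorem pr_Gam (φ : (Fin d → ℝ) → ℝ) (C : Matrix (Fin d) (Fin d) ℝ) (g : LP P d) :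
    prL φ (Gam C g) = ∫ y, prL φ (tr y g) ∂(gam C) := by
  rw [Gam_apply, ← ContinuousLinearMap.integral_comp_comm _ (tr_int _ g)]

theorem cv_int {k : (Fin d → ℝ) → ℝ} (hk : Integrable k) (g : LP P d) : Integrable (fun y => k y • tr y g) := by
  refine Integrable.mono' (hk.norm.mul_const ‖g‖) (hk.aestronglyMeasurable.smul (tr_cont g).aestronglyMeasurable) ?_
  exact Eventually.of_forall fun y => by rw [norm_smul, tr_norm]

/-- convolution operator with an integrable kernel -/
def cv (k : (Fin d → ℝ) → ℝ) : LP P d →L[ℝ] LP P d :=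
  open Classical in
  if hk : Integrable k then
  LinearMap.mkContinuous
    { toFun := fun g => ∫ y, k y • tr y g
      map_add' := fun g h => by simp [integral_add (cv_int hk g) (cv_int hk h)]
      map_smul' := fun c g => by
        simp only [map_smul, RingHom.id_apply]
        rw [← integral_smul]; congr 1; ext1 y; rw [smul_comm] } (∫ y, ‖k y‖) (fun g => by
        simp only [LinearMap.coe_mk, AddHom.coe_mk]
        refine (norm_integral_le_integral_norm _).trans ?_
        simp_rw [norm_smul, tr_norm, integral_mul_const]; rfl) else 0

theorem cv_apply {k : (Fin d → ℝ) → ℝ} (hk : Integrable k) (g : LP P d) : cv k g = ∫ y, k y • tr y g := by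
  rw [cv, dif_pos hk]; rfl

theorem cv_norm_le {k : (Fin d → ℝ) → ℝ} (hk : Integrable k) (g : LP P d) : ‖cv k g‖ ≤ (∫ y, ‖k y‖) * ‖g‖ := by
  rw [cv_apply hk]
  refine (norm_integral_le_integral_norm _).trans ?_
  simp_rw [norm_smul, tr_norm, integral_mul_const]; rfl

theorem cv_tr (k : (Fin d → ℝ) → ℝ) (y : Fin d → ℝ) (g : LP P d) : cv k (tr y g) = tr y (cv k g) := by
  by_cases hk : Integrable k
  · rw [cv_apply hk, cv_apply hk, ← LinearIsometry.coe_toContinuousLinearMap,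
      ← ContinuousLinearMap.integral_comp_comm _ (cv_int hk g)]
    simp [tr_tr, add_comm]
  · simp [cv, dif_neg hk]

theorem cv_Gam (k : (Fin d → ℝ) → ℝ) (C : Matrix (Fin d) (Fin d) ℝ) (g : LP P d) : cv k (Gam C g) = Gam C (cv k g) :=
  clm_Gam _ (cv_tr k) C g

theorem pr_cv (φ : (Fin d → ℝ) → ℝ) {k : (Fin d → ℝ) → ℝ} (hk : Integrable k) (g : LP P d) :
    prL φ (cv k g) = ∫ y, k y * prL φ (tr y g) := by
  rw [cv_apply hk, ← ContinuousLinearMap.integral_comp_comm _ (cv_int hk g)]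
  simp

theorem cv_sub_norm {k l : (Fin d → ℝ) → ℝ} (hk : Integrable k) (hl : Integrable l) (g : LP P d) :
    ‖cv k g - cv l g‖ ≤ (∫ y, ‖k y - l y‖) * ‖g‖ := by
  have : cv k g - cv l g = cv (fun y => k y - l y) g := by
    rw [cv_apply hk, cv_apply hl, cv_apply (k := fun y => k y - l y) (hk.sub hl), ← integral_sub (cv_int hk g) (cv_int hl g)]
    simp [sub_smul]
  rw [this]
  exact cv_norm_le (hk.sub hl) g

end MR

end

section

namespace MR
open ProbabilityTheory Matrix Filter Topology

variable {d : ℕ} {P : ℝ≥0∞} [Fact (1 ≤ P)] [Fact (P ≠ ∞)]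

theorem ff_hasFDerivAt {φ : (Fin d → ℝ) → ℝ} (h : Test φ) (g : LP P d) (y : Fin d → ℝ) :
    HasFDerivAt (fun y => prL φ (tr y g))
      (- ∑ i, prL (pd i φ) (tr y g) • (ContinuousLinearMap.proj (R := ℝ) i : (Fin d → ℝ) →L[ℝ] ℝ)) y := by
  have key : ∀ χ : (Fin d → ℝ) → ℝ, Test χ → ∀ y,
      prL χ (tr y g) = convolution g (fun z => χ (-z)) (ContinuousLinearMap.mul ℝ ℝ) volume y := by
    intro χ hχ y
    rw [pr_tr hχ, prT (hχ.shift y)]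
    simp [convolution]
  have hψ : ContDiff ℝ (⊤ : ℕ∞) (fun z => φ (-z)) := h.1.comp (by fun_prop)
  have hψ1 : ContDiff ℝ 1 (fun z => φ (-z)) := hψ.of_le (by exact_mod_cast le_top)
  have hψc : HasCompactSupport (fun z => φ (-z)) := h.2.comp_homeomorph (Homeomorph.neg _)
  have hd := hψc.hasFDerivAt_convolution_right (ContinuousLinearMap.mul ℝ ℝ) (μ := volume) (LP_locInt g) hψ1 y
  have e : (fun y => prL φ (tr y g)) = convolution g (fun z => φ (-z)) (ContinuousLinearMap.mul ℝ ℝ) volume :=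
    funext (key φ h)
  rw [e]
  refine hd.congr_fderiv ?_
  symm
  refine ContinuousLinearMap.coe_injective ((Pi.basisFun ℝ (Fin d)).ext fun i => ?_)
  simp only [Pi.basisFun_apply, ContinuousLinearMap.coe_coe]
  rw [convolution_precompR_apply _ (LP_locInt g) (hψc.fderiv ℝ) (hψ.continuous_fderiv (by simp))]
  have e2 : (fun a => (fderiv ℝ (fun z => φ (-z)) a) (Pi.single i 1)) = fun a => - pd i φ (-a) := by
    ext a
    have h0 : DifferentiableAt ℝ φ (-a) := h.1.differentiable (by simp) _
    have h1 := h0.hasFDerivAt.comp a (hasFDerivAt_id a).neg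
    have h2 : fderiv ℝ (fun z => φ (-z)) a = _ := h1.fderiv
    rw [h2]
    simp [pd]
  rw [e2]
  have e3 := key _ (h.pd i) y
  simp only [convolution, ContinuousLinearMap.mul_apply', mul_neg, integral_neg] at e3 ⊢
  rw [← e3]
  simp [Finset.sum_apply, ContinuousLinearMap.sum_apply, Pi.single_apply]

theorem ff_pd {φ : (Fin d → ℝ) → ℝ} (h : Test φ) (g : LP P d) (i : Fin d) :
    pd i (fun y => prL φ (tr y g)) = fun y => - prL (pd i φ) (tr y g) := by
  ext y
  rw [pd, (ff_hasFDerivAt h g y).fderiv]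
  simp [ContinuousLinearMap.sum_apply, Pi.single_apply]

theorem ff_bound (φ : (Fin d → ℝ) → ℝ) (g : LP P d) (y : Fin d → ℝ) :
    |prL φ (tr y g)| ≤ ‖(prL φ : LP P d →L[ℝ] ℝ)‖ * ‖g‖ := by
  have := (prL φ : LP P d →L[ℝ] ℝ).le_opNorm (tr y g)
  rwa [tr_norm] at this

theorem ff_cont (φ : (Fin d → ℝ) → ℝ) (g : LP P d) : Continuous fun y => prL φ (tr y g) :=
  (prL φ).continuous.comp (tr_cont g)

theorem ff_line {φ : (Fin d → ℝ) → ℝ} (h : Test φ) (g : LP P d) (y : Fin d → ℝ) (t : ℝ) :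
    HasDerivAt (fun t : ℝ => prL φ (tr (t • y) g)) (- ∑ i, y i * prL (pd i φ) (tr (t • y) g)) t := by
  have h1 := (ff_hasFDerivAt h g (t • y)).comp_hasDerivAt t ((hasDerivAt_id t).smul_const y)
  refine h1.congr_deriv ?_
  simp [ContinuousLinearMap.sum_apply, mul_comm]

/-- constant in the Gaussian expansion -/
def KG (P : ℝ≥0∞) [Fact (1 ≤ P)] (φ : (Fin d → ℝ) → ℝ) : ℝ :=
  ∑ i, ∑ j, ∑ k, ‖(prL (pd i (pd j (pd k φ))) : LP P d →L[ℝ] ℝ)‖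

theorem KG_nonneg (φ : (Fin d → ℝ) → ℝ) : 0 ≤ KG P φ := by unfold KG; positivity

theorem taylor3 {h h1 h2 h3 : ℝ → ℝ} (d0 : ∀ t, HasDerivAt h (h1 t) t) (d1 : ∀ t, HasDerivAt h1 (h2 t) t)
    (d2 : ∀ t, HasDerivAt h2 (h3 t) t) {M : ℝ} (hM : ∀ t, |h3 t| ≤ M) :
    |h 1 - h 0 - h1 0 - h2 0 / 2| ≤ M := by
  have b2 : ∀ t ∈ Icc (0:ℝ) 1, |h2 t - h2 0| ≤ M := by
    intro t ht
    have := Convex.norm_image_sub_le_of_norm_hasDerivWithin_le (f := h2) (f' := h3) (s := univ) (C := M)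
      (fun x _ => (d2 x).hasDerivWithinAt) (fun x _ => hM x) convex_univ (mem_univ 0) (mem_univ t)
    simp only [Real.norm_eq_abs, sub_zero] at this
    have hM0 : 0 ≤ M := (abs_nonneg _).trans (hM 0)
    calc _ ≤ M * |t| := this
      _ ≤ M * 1 := by gcongr; rw [abs_le]; constructor <;> linarith [ht.1, ht.2]
      _ = M := mul_one _
  have b1 : ∀ t ∈ Icc (0:ℝ) 1, |h1 t - h1 0 - t * h2 0| ≤ M := by
    intro t ht
    have := Convex.norm_image_sub_le_of_norm_hasDerivWithin_le (f := fun t => h1 t - t * h2 0) (f' := fun t => h2 t - h2 0)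
      (s := Icc 0 1) (C := M)
      (fun x _ => by simpa using ((d1 x).fun_sub ((hasDerivAt_id x).mul_const (h2 0))).hasDerivWithinAt) (fun x hx => b2 x hx) (convex_Icc 0 1)
        (⟨le_rfl, zero_le_one⟩ : (0:ℝ) ∈ Icc (0:ℝ) 1) ht
    simp only [Real.norm_eq_abs, sub_zero, zero_mul] at this
    have hM0 : 0 ≤ M := (abs_nonneg _).trans (hM 0)
    calc _ = |h1 t - t * h2 0 - h1 0| := by congr 1; ring
      _ ≤ M * |t| := this
      _ ≤ M * 1 := by gcongr; rw [abs_le]; constructor <;> linarith [ht.1, ht.2]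
      _ = M := mul_one _
  have := Convex.norm_image_sub_le_of_norm_hasDerivWithin_le (f := fun t => h t - t * h1 0 - t ^ 2 / 2 * h2 0)
      (f' := fun t => h1 t - h1 0 - t * h2 0)
      (s := Icc 0 1) (C := M)
      (fun x _ => by
        have := (((d0 x).fun_sub ((hasDerivAt_id' x).mul_const (h1 0))).fun_sub (((hasDerivAt_pow 2 x).div_const 2).mul_const (h2 0))).hasDerivWithinAt (s := Icc 0 1)
        refine this.congr_deriv ?_
        simp) (fun x hx => b1 x hx) (convex_Icc 0 1)
        (⟨le_rfl, zero_le_one⟩ : (0:ℝ) ∈ Icc (0:ℝ) 1) (⟨zero_le_one, le_rfl⟩ : (1:ℝ) ∈ Icc (0:ℝ) 1)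
  simp only [Real.norm_eq_abs] at this
  calc _ = _ := by congr 1; ring
    _ ≤ _ := this
    _ = M := by simp

theorem coord_le (y : Fin d → ℝ) (i : Fin d) : |y i| ≤ ‖y‖ := norm_le_pi_norm y i

theorem ff_taylor {φ : (Fin d → ℝ) → ℝ} (h : Test φ) (g : LP P d) (y : Fin d → ℝ) :
    |prL φ (tr y g) - prL φ g + (∑ i, y i * prL (pd i φ) g)
      - (∑ i, ∑ j, y i * y j * prL (pd i (pd j φ)) g) / 2| ≤ KG P φ * ‖g‖ * ‖y‖ ^ 3 := by
  have d0 := ff_line h g y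
  have d1 : ∀ t, HasDerivAt (fun t : ℝ => - ∑ i, y i * prL (pd i φ) (tr (t • y) g))
      (∑ j, ∑ i, y i * y j * prL (pd i (pd j φ)) (tr (t • y) g)) t := by
    intro t
    have := (HasDerivAt.fun_sum fun i (_ : i ∈ Finset.univ) => (ff_line (h.pd i) g y t).const_mul (y i)).fun_neg
    refine this.congr_deriv ?_
    rw [← Finset.sum_neg_distrib]
    refine Finset.sum_congr rfl fun i _ => ?_
    rw [mul_neg, neg_neg, Finset.mul_sum]
    exact Finset.sum_congr rfl fun j _ => by ring
  have d2 : ∀ t, HasDerivAt (fun t : ℝ => ∑ j, ∑ i, y i * y j * prL (pd i (pd j φ)) (tr (t • y) g))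
      (∑ j, ∑ i, y i * y j * - ∑ k, y k * prL (pd k (pd i (pd j φ))) (tr (t • y) g)) t := by
    intro t
    exact HasDerivAt.fun_sum fun j _ => HasDerivAt.fun_sum fun i _ => (ff_line ((h.pd j).pd i) g y t).const_mul (y i * y j)
  have hM : ∀ t : ℝ, |(∑ j, ∑ i, y i * y j * - ∑ k, y k * prL (pd k (pd i (pd j φ))) (tr (t • y) g))| ≤ KG P φ * ‖g‖ * ‖y‖ ^ 3 := by
    intro t
    have e : KG P φ * ‖g‖ * ‖y‖ ^ 3 = ∑ j, ∑ i, ∑ k, ‖(prL (pd k (pd i (pd j φ))) : LP P d →L[ℝ] ℝ)‖ * ‖g‖ * ‖y‖ ^ 3 := by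
      unfold KG
      simp_rw [Finset.sum_mul]
      rw [Finset.sum_comm_cycle]
      refine Finset.sum_congr rfl fun i _ => ?_
      rw [Finset.sum_comm]
    rw [e]
    refine (Finset.abs_sum_le_sum_abs _ _).trans (Finset.sum_le_sum fun j _ => ?_)
    refine (Finset.abs_sum_le_sum_abs _ _).trans (Finset.sum_le_sum fun i _ => ?_)
    rw [mul_neg, abs_neg, Finset.mul_sum]
    refine (Finset.abs_sum_le_sum_abs _ _).trans (Finset.sum_le_sum fun k _ => ?_)
    rw [abs_mul, abs_mul, abs_mul]
    have := ff_bound (pd k (pd i (pd j φ))) g (t • y)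
    calc |y i| * |y j| * (|y k| * |prL (pd k (pd i (pd j φ))) (tr (t • y) g)|)
        ≤ ‖y‖ * ‖y‖ * (‖y‖ * (‖(prL (pd k (pd i (pd j φ))) : LP P d →L[ℝ] ℝ)‖ * ‖g‖)) := by
          gcongr <;> exact coord_le y _
      _ = _ := by ring
  have := taylor3 d0 d1 d2 hM
  simp only [one_smul, zero_smul, tr_zero] at this
  rw [Finset.sum_comm] at this
  simpa [sub_neg_eq_add] using this

/-- Gaussian expansion. -/
theorem gauss_expand {φ : (Fin d → ℝ) → ℝ} (h : Test φ) {C : Matrix (Fin d) (Fin d) ℝ} (hC : C.PosSemidef) (g : LP P d) :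
    |prL φ (Gam C g) - prL φ g - (∑ i, ∑ j, C i j * prL (pd i (pd j φ)) g) / 2|
      ≤ KG P φ * ‖g‖ * (d * M3 * C.trace ^ (3/2 : ℝ)) := by
  have i1 : Integrable (fun y => prL φ (tr y g)) (gam C) := (prL φ).integrable_comp (tr_int _ g)
  have i2 : ∀ i, Integrable (fun y : Fin d → ℝ => y i) (gam C) := fun i => memLp_one_iff_integrable.1 (gam_memLp hC i 1 (by simp))
  have i3 : ∀ i j, Integrable (fun y : Fin d → ℝ => y i * y j) (gam C) := fun i j =>
    (gam_memLp hC i 2 (by simp)).integrable_mul (gam_memLp hC j 2 (by simp))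
  have I2 : Integrable (fun y : Fin d → ℝ => ∑ i, y i * prL (pd i φ) g) (gam C) :=
    integrable_finsetSum _ fun i _ => (i2 i).mul_const _
  have I3 : Integrable (fun y : Fin d → ℝ => (∑ i, ∑ j, y i * y j * prL (pd i (pd j φ)) g) / 2) (gam C) :=
    (integrable_finsetSum _ fun i _ => integrable_finsetSum _ fun j _ => (i3 i j).mul_const _).div_const _
  have I4 : Integrable (fun y : Fin d → ℝ => prL φ (tr y g) - prL φ g) (gam C) := i1.sub (integrable_const _)
  have I5 : Integrable (fun y : Fin d → ℝ => prL φ (tr y g) - prL φ g + (∑ i, y i * prL (pd i φ) g)) (gam C) := I4.add I2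
  have e : prL φ (Gam C g) - prL φ g - (∑ i, ∑ j, C i j * prL (pd i (pd j φ)) g) / 2
     = ∫ y, (prL φ (tr y g) - prL φ g + (∑ i, y i * prL (pd i φ) g)
      - (∑ i, ∑ j, y i * y j * prL (pd i (pd j φ)) g) / 2) ∂(gam C) := by
    rw [integral_sub I5 I3, integral_add I4 I2,
      integral_sub i1 (integrable_const _), pr_Gam, integral_div,
      integral_finsetSum _ fun i _ => (i2 i).mul_const _,
      integral_finsetSum _ fun i _ => integrable_finsetSum _ fun j _ => (i3 i j).mul_const _]
    simp_rw [integral_mul_const, gam_mean hC]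
    have : ∀ i, ∫ y, ∑ j, y i * y j * prL (pd i (pd j φ)) g ∂(gam C) = ∑ j, C i j * prL (pd i (pd j φ)) g := by
      intro i
      rw [integral_finsetSum _ fun j _ => (i3 i j).mul_const _]
      simp_rw [integral_mul_const, gam_cov hC]
    simp_rw [this]
    simp
  rw [e]
  rw [← Real.norm_eq_abs]
  calc _ ≤ ∫ y, KG P φ * ‖g‖ * ‖y‖ ^ 3 ∂(gam C) :=
        norm_integral_le_of_norm_le ((gam_int_norm_pow hC 3 (by norm_num)).const_mul _) (Eventually.of_forall fun y => ff_taylor h g y)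
    _ ≤ _ := by
        rw [integral_const_mul]
        have := KG_nonneg (P := P) φ
        gcongr
        exact gam_norm_third hC

/-- strong continuity -/
theorem Gam_tendsto {ι : Type*} {l : Filter ι} {C : ι → Matrix (Fin d) (Fin d) ℝ} (hC : ∀ i, (C i).PosSemidef)
    (ht : Tendsto (fun i => (C i).trace) l (𝓝 0)) (g : LP P d) : Tendsto (fun i => Gam (C i) g) l (𝓝 g) := by
  rw [Metric.tendsto_nhds]
  intro ε hε
  have h0 := (tr_cont g).tendsto 0
  rw [tr_zero, Metric.tendsto_nhds_nhds] at h0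
  obtain ⟨r, hr, h0⟩ := h0 (ε/2) (by positivity)
  -- ‖tr y g - g‖ ≤ ε/2 + 2‖g‖ ‖y‖²/r²
  have hb : ∀ y, ‖tr y g - g‖ ≤ ε / 2 + 2 * ‖g‖ / r ^ 2 * ‖y‖ ^ 2 := by
    intro y
    by_cases hy : ‖y‖ < r
    · have := h0 (x := y) (by simpa using hy)
      rw [dist_eq_norm] at this
      have h2 : 0 ≤ 2 * ‖g‖ / r ^ 2 * ‖y‖ ^ 2 := by positivity
      linarith
    · push Not at hy
      have h1 : ‖tr y g - g‖ ≤ 2 * ‖g‖ := by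
        refine (norm_sub_le _ _).trans ?_
        rw [tr_norm]; linarith
      have h2 : 2 * ‖g‖ ≤ 2 * ‖g‖ / r ^ 2 * ‖y‖ ^ 2 := by
        rw [div_mul_eq_mul_div, le_div_iff₀ (by positivity)]
        gcongr
      linarith
  have hb2 : ∀ i, dist (Gam (C i) g) g ≤ ε / 2 + 2 * ‖g‖ / r ^ 2 * (C i).trace := by
    intro i
    have e : Gam (C i) g - g = ∫ y, (tr y g - g) ∂(gam (C i)) := by
      rw [integral_sub (tr_int _ g) (integrable_const _), Gam_apply]; simp
    rw [dist_eq_norm, e]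
    have ii : Integrable (fun y => ε / 2 + 2 * ‖g‖ / r ^ 2 * ‖y‖ ^ 2) (gam (C i)) :=
      (integrable_const _).add ((gam_int_norm_pow (hC i) 2 (by norm_num)).const_mul _)
    refine (norm_integral_le_of_norm_le ii (Eventually.of_forall hb)).trans ?_
    rw [integral_add (integrable_const _) ((gam_int_norm_pow (hC i) 2 (by norm_num)).const_mul _), integral_const_mul]
    simp only [integral_const, probReal_univ, one_smul]
    gcongr
    exact gam_norm_sq (hC i)
  have h3 : Tendsto (fun i => ε / 2 + 2 * ‖g‖ / r ^ 2 * (C i).trace) l (𝓝 (ε / 2 + 2 * ‖g‖ / r ^ 2 * 0)) :=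
    (ht.const_mul _).const_add _
  filter_upwards [h3.eventually_lt_const (u := ε) (by simp; linarith)] with i hi
  exact (hb2 i).trans_lt hi

end MR

end

section

namespace MR
open ProbabilityTheory Matrix Filter Topology

variable {d : ℕ} {P : ℝ≥0∞} [Fact (1 ≤ P)] [Fact (P ≠ ∞)]

/-- first derivative of the Gaussian density -/
def hk1 (v : ℝ) (i : Fin d) (x : Fin d → ℝ) : ℝ := -(x i / v) * hk v x

/-- second derivative of the Gaussian density -/
def kk (v : ℝ) (i j : Fin d) (x : Fin d → ℝ) : ℝ :=
  (x i * x j / v ^ 2 - (if i = j then 1 / v else 0)) * hk v x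

/-- squared Euclidean norm -/
def sq (x : Fin d → ℝ) : ℝ := ∑ k, x k ^ 2

theorem sq_nn (x : Fin d → ℝ) : 0 ≤ sq x := Finset.sum_nonneg fun _ _ => by positivity

theorem coord_sq (x : Fin d → ℝ) (i : Fin d) : x i ^ 2 ≤ sq x :=
  Finset.single_le_sum (f := fun k => x k ^ 2) (fun _ _ => by positivity) (Finset.mem_univ i)

theorem coord_mul (x : Fin d → ℝ) (i j : Fin d) : |x i * x j| ≤ sq x := by
  have h1 := coord_sq x i
  have h2 := coord_sq x j
  rw [abs_le]
  constructor <;> nlinarith [sq_nonneg (x i + x j), sq_nonneg (x i - x j)]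

theorem norm_sq_le (x : Fin d → ℝ) : ‖x‖ ^ 2 ≤ sq x := by
  have := norm_pow_le_sum x 2 (by norm_num)
  simpa [sq] using this

theorem sq_le_norm (x : Fin d → ℝ) : sq x ≤ d * ‖x‖ ^ 2 := by
  calc sq x ≤ ∑ _k : Fin d, ‖x‖ ^ 2 := Finset.sum_le_sum fun k _ => by
        rw [← sq_abs]; have := coord_le x k; gcongr
    _ = _ := by simp

theorem hk_cont1 (v : ℝ) (i : Fin d) : Continuous (hk1 (d := d) v i) := by
  unfold hk1; have := hk_cont (d := d) v; fun_prop

theorem kk_cont (v : ℝ) (i j : Fin d) : Continuous (kk (d := d) v i j) := by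
  unfold kk; have := hk_cont (d := d) v; fun_prop

/-- constant -/
def cB (d : ℕ) : ℝ := 37 * √2 ^ d

theorem cB_pos (d : ℕ) : 0 < cB d := by unfold cB; positivity

theorem hk_double {v : ℝ} (hv : 0 < v) (x : Fin d → ℝ) :
    hk v x = √2 ^ d * hk (2 * v) x * Real.exp (-(sq x) / (4 * v)) := by
  unfold hk sq
  have e : √(2 * Real.pi * (2 * v)) = √2 * √(2 * Real.pi * v) := by
    rw [← Real.sqrt_mul (by norm_num)]; congr 1; ring
  have h2 : √2 ≠ 0 := by positivity
  rw [e, mul_inv, mul_pow, show -(∑ k, x k ^ 2) / (2 * v) = -(∑ k, x k ^ 2) / (2 * (2 * v)) + -(∑ k, x k ^ 2) / (4 * v) by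
    field_simp; ring, Real.exp_add]
  have : √2 ^ d * (√2)⁻¹ ^ d = 1 := by rw [← mul_pow]; simp
  linear_combination -( (√(2 * Real.pi * v))⁻¹ ^ d * Real.exp (-(∑ k, x k ^ 2) / (2 * (2 * v))) * Real.exp (-(∑ k, x k ^ 2) / (4 * v))) * this

theorem poly_exp {q : ℝ} (hq : 0 ≤ q) : (1 + q + q ^ 2) * Real.exp (- q / 4) ≤ 37 := by
  have h1 : Real.exp (-q / 4) = (Real.exp (q / 4))⁻¹ := by rw [← Real.exp_neg]; congr 1; ring
  rw [h1, ← div_eq_mul_inv, div_le_iff₀ (Real.exp_pos _)]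
  have := Real.quadratic_le_exp_of_nonneg (x := q / 4) (by positivity)
  nlinarith

theorem hk_poly {v : ℝ} (hv : 0 < v) (x : Fin d → ℝ) :
    (1 + sq x / v + (sq x / v) ^ 2) * hk v x ≤ cB d * hk (2 * v) x := by
  rw [hk_double hv, cB]
  have h := poly_exp (q := sq x / v) (by have := sq_nn x; positivity)
  have e : -(sq x) / (4 * v) = - (sq x / v) / 4 := by field_simp
  rw [e]
  have h2 : 0 ≤ √2 ^ d * hk (2 * v) x := mul_nonneg (by positivity) (hk_nonneg _ _)
  nlinarith [mul_le_mul_of_nonneg_left h h2]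

theorem hk_int {v : ℝ} (hv : 0 < v) : Integrable (hk (d := d) v) ∧ ∫ x, hk (d := d) v x = 1 := by
  have h1 : ∫⁻ x, ENNReal.ofReal (hk (d := d) v x) = 1 := by
    have := gam_smul_one (d := d) hv
    have h2 : gam (v • (1 : Matrix (Fin d) (Fin d) ℝ)) univ = 1 := measure_univ
    rw [this, withDensity_apply _ MeasurableSet.univ] at h2
    simpa using h2
  have h3 : Integrable (hk (d := d) v) := by
    refine ⟨(hk_cont v).aestronglyMeasurable, ?_⟩
    rw [hasFiniteIntegral_iff_ofReal (Eventually.of_forall fun x => hk_nonneg v x), h1]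
    simp
  refine ⟨h3, ?_⟩
  rw [integral_eq_lintegral_of_nonneg_ae (Eventually.of_forall fun x => hk_nonneg v x) h3.aestronglyMeasurable, h1]
  simp

theorem kk_bound {v : ℝ} (hv : 0 < v) (i j : Fin d) (x : Fin d → ℝ) :
    |kk v i j x| ≤ v⁻¹ * ((1 + sq x / v) * hk v x) := by
  unfold kk
  rw [abs_mul, abs_of_nonneg (hk_nonneg v x), ← mul_assoc]
  refine mul_le_mul_of_nonneg_right ?_ (hk_nonneg v x)
  calc _ ≤ |x i * x j / v ^ 2| + |(if i = j then 1 / v else 0)| := abs_sub _ _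
    _ ≤ sq x / v ^ 2 + 1 / v := by
        rw [abs_div, abs_of_pos (by positivity : 0 < v ^ 2)]
        gcongr
        · exact coord_mul x i j
        · split_ifs
          · rw [abs_of_pos (by positivity)]
          · simp; positivity
    _ = _ := by field_simp; ring

theorem kk_bound' {v : ℝ} (hv : 0 < v) (i j : Fin d) (x : Fin d → ℝ) :
    |kk v i j x| ≤ v⁻¹ * (cB d * hk (2 * v) x) := by
  refine (kk_bound hv i j x).trans ?_
  refine mul_le_mul_of_nonneg_left ?_ (by positivity)
  refine le_trans ?_ (hk_poly hv x)
  refine mul_le_mul_of_nonneg_right ?_ (hk_nonneg v x)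
  have := sq_nn x
  have : 0 ≤ (sq x / v) ^ 2 := by positivity
  linarith

theorem kk_int {v : ℝ} (hv : 0 < v) (i j : Fin d) : Integrable (kk v i j) :=
  Integrable.mono' (((hk_int (by linarith : 0 < 2 * v)).1.const_mul (cB d)).const_mul v⁻¹)
    (kk_cont v i j).aestronglyMeasurable (Eventually.of_forall fun x => kk_bound' hv i j x)

theorem kk_L1 {v : ℝ} (hv : 0 < v) (i j : Fin d) : ∫ x, ‖kk v i j x‖ ≤ cB d / v := by
  have h := hk_int (d := d) (by linarith : 0 < 2 * v)
  calc _ ≤ ∫ x, v⁻¹ * (cB d * hk (2 * v) x) :=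
        integral_mono (kk_int hv i j).norm ((h.1.const_mul (cB d)).const_mul v⁻¹) (kk_bound' hv i j)
    _ = _ := by rw [integral_const_mul, integral_const_mul, h.2]; ring

theorem abs_le_one_add_sq (s : ℝ) : |s| ≤ 1 + s ^ 2 := by
  rw [abs_le]; constructor <;> nlinarith [sq_nonneg (s - 1), sq_nonneg (s + 1)]

theorem hk1_bound {v : ℝ} (hv : 0 < v) (i : Fin d) (x : Fin d → ℝ) :
    |hk1 v i x| ≤ (√v)⁻¹ * ((1 + sq x / v) * hk v x) := by
  unfold hk1
  rw [abs_mul, abs_of_nonneg (hk_nonneg v x), ← mul_assoc]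
  refine mul_le_mul_of_nonneg_right ?_ (hk_nonneg v x)
  have h1 : -(x i / v) = (√v)⁻¹ * (-(x i / √v)) := by
    have := Real.mul_self_sqrt hv.le
    have h2 : √v ≠ 0 := by positivity
    field_simp
    rw [Real.sq_sqrt hv.le]
  rw [h1, abs_mul, abs_of_pos (by positivity : 0 < (√v)⁻¹)]
  gcongr
  refine (abs_le_one_add_sq _).trans ?_
  rw [neg_sq, div_pow, Real.sq_sqrt hv.le]
  gcongr
  exact coord_sq x i

theorem hk1_bound' {v : ℝ} (hv : 0 < v) (i : Fin d) (x : Fin d → ℝ) :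
    |hk1 v i x| ≤ (√v)⁻¹ * (cB d * hk (2 * v) x) := by
  refine (hk1_bound hv i x).trans ?_
  refine mul_le_mul_of_nonneg_left ?_ (by positivity)
  refine le_trans ?_ (hk_poly hv x)
  refine mul_le_mul_of_nonneg_right ?_ (hk_nonneg v x)
  have := sq_nn x
  have : 0 ≤ (sq x / v) ^ 2 := by positivity
  linarith

theorem hk1_int {v : ℝ} (hv : 0 < v) (i : Fin d) : Integrable (hk1 v i) :=
  Integrable.mono' (((hk_int (by linarith : 0 < 2 * v)).1.const_mul (cB d)).const_mul (√v)⁻¹)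
    (hk_cont1 v i).aestronglyMeasurable (Eventually.of_forall fun x => hk1_bound' hv i x)

theorem hk_fd (v : ℝ) (x : Fin d → ℝ) :
    HasFDerivAt (hk v) (∑ k, hk1 v k x • (ContinuousLinearMap.proj (R := ℝ) k : (Fin d → ℝ) →L[ℝ] ℝ)) x := by
  have h1 : ∀ k : Fin d, HasFDerivAt (fun x : Fin d → ℝ => x k ^ 2) ((2 * x k) • (ContinuousLinearMap.proj (R := ℝ) k : (Fin d → ℝ) →L[ℝ] ℝ)) x := by
    intro k
    have := (ContinuousLinearMap.proj (R := ℝ) k : (Fin d → ℝ) →L[ℝ] ℝ).hasFDerivAt (x := x)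
    have h2 := this.pow 2
    refine h2.congr_fderiv ?_
    ext; simp
  have h2 := (((HasFDerivAt.fun_sum fun k (_ : k ∈ Finset.univ) => h1 k).neg.mul_const (2 * v)⁻¹).exp).const_mul ((√(2 * Real.pi * v))⁻¹ ^ d)
  have e : hk (d := d) v = fun x => (√(2 * Real.pi * v))⁻¹ ^ d * Real.exp ((-(fun x : Fin d → ℝ => ∑ k, x k ^ 2)) x * (2 * v)⁻¹) := by
    ext x; simp [hk, div_eq_mul_inv]
  rw [e]
  refine h2.congr_fderiv ?_
  refine ContinuousLinearMap.ext fun y => ?_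
  simp only [hk1, hk]
  simp only [ContinuousLinearMap.smul_apply, ContinuousLinearMap.sum_apply, smul_eq_mul, ContinuousLinearMap.proj_apply,
    ContinuousLinearMap.neg_apply, Pi.neg_apply]
  rw [← neg_one_mul (∑ i, 2 * x i * y i), Finset.mul_sum, Finset.mul_sum, Finset.mul_sum, Finset.mul_sum]
  refine Finset.sum_congr rfl fun k _ => ?_
  rw [div_eq_mul_inv (-∑ k, x k ^ 2)]
  have e4 : (2 * v)⁻¹ = 2⁻¹ * v⁻¹ := mul_inv _ _
  rw [div_eq_mul_inv (x k) v]
  linear_combination ((√(2 * Real.pi * v))⁻¹ ^ d * Real.exp (-(∑ k, x k ^ 2) * (2 * v)⁻¹) * (- 2 * x k * y k)) * e4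

theorem pd_hk (v : ℝ) (i : Fin d) : pd i (hk v) = hk1 v i := by
  ext x
  rw [pd, (hk_fd v x).fderiv]
  simp [ContinuousLinearMap.sum_apply, Pi.single_apply]

theorem hk1_fd (v : ℝ) (i : Fin d) (x : Fin d → ℝ) :
    HasFDerivAt (hk1 v i) (∑ k, kk v k i x • (ContinuousLinearMap.proj (R := ℝ) k : (Fin d → ℝ) →L[ℝ] ℝ)) x := by
  have h1 := (((ContinuousLinearMap.proj (R := ℝ) i : (Fin d → ℝ) →L[ℝ] ℝ).hasFDerivAt (x := x)).mul_const (-v⁻¹)).mul (hk_fd v x)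
  have e : hk1 v i = (fun x : Fin d → ℝ => (ContinuousLinearMap.proj (R := ℝ) i : (Fin d → ℝ) →L[ℝ] ℝ) x * (-v⁻¹)) * hk v := by
    ext x; simp [hk1, div_eq_mul_inv]
  rw [e]
  refine h1.congr_fderiv ?_
  refine ContinuousLinearMap.ext fun y => ?_
  simp only [ContinuousLinearMap.smul_apply, ContinuousLinearMap.sum_apply, smul_eq_mul, ContinuousLinearMap.proj_apply,
    ContinuousLinearMap.add_apply]
  have e2 : hk v x * (-v⁻¹ * y i) = ∑ k, hk v x * (-v⁻¹ * (if k = i then y k else 0)) := by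
    rw [← Finset.mul_sum, ← Finset.mul_sum]; simp
  rw [e2, Finset.mul_sum, ← Finset.sum_add_distrib]
  refine Finset.sum_congr rfl fun k _ => ?_
  unfold kk hk1
  by_cases hv : v = 0
  · simp [hv]
  · split_ifs <;> field_simp <;> ring

theorem pd_hk1 (v : ℝ) (i j : Fin d) : pd j (hk1 v i) = kk v j i := by
  ext x
  rw [pd, (hk1_fd v i x).fderiv]
  simp [ContinuousLinearMap.sum_apply, Pi.single_apply]

theorem kk_symm (v : ℝ) (i j : Fin d) : kk v i j = kk v j i := by
  ext x; unfold kk; simp [eq_comm, mul_comm]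

/-- regularized second derivative -/
def Kop (v : ℝ) (i j : Fin d) : LP P d →L[ℝ] LP P d := cv (kk v i j)

theorem Gam_eq_cv {v : ℝ} (hv : 0 < v) (φ : (Fin d → ℝ) → ℝ) (g : LP P d) :
    prL φ (Gam (v • (1 : Matrix (Fin d) (Fin d) ℝ)) g) = ∫ y, hk v y * prL φ (tr y g) := by
  rw [pr_Gam, integral_gam_smul_one hv]

theorem int_mul_ff {k : (Fin d → ℝ) → ℝ} (hk : Integrable k) (φ : (Fin d → ℝ) → ℝ) (g : LP P d) :
    Integrable (fun y => k y * prL φ (tr y g)) :=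
  hk.mul_bdd (c := ‖(prL φ : LP P d →L[ℝ] ℝ)‖ * ‖g‖) (ff_cont φ g).aestronglyMeasurable (Eventually.of_forall fun y => ff_bound φ g y)

theorem ibp {φ : (Fin d → ℝ) → ℝ} (h : Test φ) (g : LP P d) (i : Fin d) {k : (Fin d → ℝ) → ℝ} (hk : Integrable k)
    (hk1 : Integrable (pd i k)) (hd : Differentiable ℝ k) :
    ∫ y, pd i k y * prL φ (tr y g) = ∫ y, k y * prL (pd i φ) (tr y g) := by
  have hF : ∀ y, fderiv ℝ (fun y => prL φ (tr y g)) y (Pi.single i 1) = - prL (pd i φ) (tr y g) :=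
    fun y => congrFun (ff_pd h g i) y
  have := integral_mul_fderiv_eq_neg_fderiv_mul_of_integrable (μ := (volume : Measure (Fin d → ℝ))) (f := k) (g := fun y => prL φ (tr y g))
    (v := Pi.single i 1) (int_mul_ff hk1 φ g)
    (by simp_rw [hF, mul_neg]; exact (int_mul_ff hk _ g).neg) (int_mul_ff hk _ g)
    (fun x _ => hd x) (fun x _ => (ff_hasFDerivAt h g x).differentiableAt)
  simp_rw [hF, mul_neg] at this
  rw [integral_neg, neg_inj] at this
  exact this.symm

theorem pr_Kop {φ : (Fin d → ℝ) → ℝ} (h : Test φ) {v : ℝ} (hv : 0 < v) (i j : Fin d) (g : LP P d) :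
    prL φ (Kop v i j g) = prL (pd i (pd j φ)) (Gam (v • (1 : Matrix (Fin d) (Fin d) ℝ)) g) := by
  rw [Gam_eq_cv hv, Kop, pr_cv _ (kk_int hv i j)]
  have e1 := ibp h g j (k := hk1 v i) (hk1_int hv i) (by rw [pd_hk1]; exact kk_int hv j i)
    (fun x => (hk1_fd v i x).differentiableAt)
  have e2 := ibp (h.pd j) g i (k := hk v) (hk_int hv).1 (by rw [pd_hk]; exact hk1_int hv i)
    (fun x => (hk_fd v x).differentiableAt)
  rw [pd_hk1] at e1
  rw [pd_hk] at e2
  rw [kk_symm, e1, e2]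

theorem Kop_norm {v : ℝ} (hv : 0 < v) (i j : Fin d) (g : LP P d) : ‖Kop v i j g‖ ≤ cB d / v * ‖g‖ :=
  (cv_norm_le (kk_int hv i j) g).trans (by gcongr; exact kk_L1 hv i j)

theorem Kop_Gam_comm (v : ℝ) (i j : Fin d) (C : Matrix (Fin d) (Fin d) ℝ) (g : LP P d) :
    Kop v i j (Gam C g) = Gam C (Kop v i j g) := cv_Gam _ _ _

theorem Kop_tr (v : ℝ) (i j : Fin d) (y : Fin d → ℝ) (g : LP P d) :
    Kop v i j (tr y g) = tr y (Kop v i j g) := cv_tr _ _ _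

theorem Kop_add {v r : ℝ} (hv : 0 < v) (hr : 0 ≤ r) (i j : Fin d) (g : LP P d) :
    Kop v i j (Gam (r • (1 : Matrix (Fin d) (Fin d) ℝ)) g) = Kop (v + r) i j g := by
  refine LP_ext fun φ h => ?_
  rw [pr_Kop h hv, pr_Kop h (by linarith), add_smul, Gam_add (smul_one_psd hv.le) (smul_one_psd hr)]

end MR

end

section

namespace MR
open ProbabilityTheory Matrix Filter Topology

variable {d : ℕ} {P : ℝ≥0∞} [Fact (1 ≤ P)] [Fact (P ≠ ∞)]

/-- integrable symmetric psd coefficients on the whole line -/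
structure Coef (b : ℝ → Fin d → Fin d → ℝ) : Prop where
  int : ∀ i j, Integrable (fun t => b t i j)
  sym : ∀ t i j, b t i j = b t j i
  psd : ∀ t (ξ : Fin d → ℝ), 0 ≤ ∑ i, ∑ j, b t i j * ξ i * ξ j

/-- covariance accumulated between two times -/
def CC (b : ℝ → Fin d → Fin d → ℝ) (s t : ℝ) : Matrix (Fin d) (Fin d) ℝ :=
  Matrix.of fun i j => ∫ r in s..t, 2 * b r i j

/-- total size of the coefficients -/
def bs (b : ℝ → Fin d → Fin d → ℝ) (t : ℝ) : ℝ := ∑ i, ∑ j, |b t i j|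

variable {b : ℝ → Fin d → Fin d → ℝ}

theorem bs_nn (b : ℝ → Fin d → Fin d → ℝ) (t : ℝ) : 0 ≤ bs b t :=
  Finset.sum_nonneg fun _ _ => Finset.sum_nonneg fun _ _ => abs_nonneg _

theorem le_bs (b : ℝ → Fin d → Fin d → ℝ) (t : ℝ) (i j : Fin d) : |b t i j| ≤ bs b t :=
  (Finset.single_le_sum (f := fun j => |b t i j|) (fun _ _ => abs_nonneg _) (Finset.mem_univ j)).trans
    (Finset.single_le_sum (f := fun i => ∑ j, |b t i j|) (fun _ _ => Finset.sum_nonneg fun _ _ => abs_nonneg _) (Finset.mem_univ i))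

theorem Coef.bs_int (hb : Coef b) : Integrable (bs b) :=
  integrable_finsetSum _ fun i _ => integrable_finsetSum _ fun j _ => (hb.int i j).abs

/-- the primitive of the size -/
def MM (b : ℝ → Fin d → Fin d → ℝ) (t : ℝ) : ℝ := ∫ r in (0:ℝ)..t, bs b r

theorem Coef.MM_cont (hb : Coef b) : Continuous (MM b) :=
  intervalIntegral.continuous_primitive (fun _ _ => hb.bs_int.intervalIntegrable) 0

theorem Coef.MM_sub (hb : Coef b) (s t : ℝ) : ∫ r in s..t, bs b r = MM b t - MM b s := by
  unfold MM
  rw [intervalIntegral.integral_interval_sub_left] <;> exact hb.bs_int.intervalIntegrable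

theorem Coef.ii (hb : Coef b) (i j : Fin d) (s t : ℝ) : IntervalIntegrable (fun r => 2 * b r i j) volume s t :=
  ((hb.int i j).const_mul 2).intervalIntegrable

theorem Coef.CC_psd (hb : Coef b) {s t : ℝ} (h : s ≤ t) : (CC b s t).PosSemidef := by
  refine .of_dotProduct_mulVec_nonneg ?_ fun ξ => ?_
  · ext i j
    simp only [CC, conjTranspose_apply, of_apply, star_trivial]
    refine intervalIntegral.integral_congr fun r _ => ?_
    simp only [hb.sym r i j]
  · have e : star ξ ⬝ᵥ (CC b s t *ᵥ ξ) = ∫ r in s..t, 2 * ∑ i, ∑ j, b r i j * ξ i * ξ j := by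
      simp only [dotProduct, mulVec, star_trivial, CC, of_apply, Finset.mul_sum]
      rw [intervalIntegral.integral_finsetSum]
      · refine Finset.sum_congr rfl fun i _ => ?_
        rw [intervalIntegral.integral_finsetSum]
        · refine Finset.sum_congr rfl fun j _ => ?_
          rw [← intervalIntegral.integral_mul_const, ← intervalIntegral.integral_const_mul]
          refine intervalIntegral.integral_congr fun r _ => ?_
          ring
        · intro j _
          exact ((((hb.int i j).mul_const _).mul_const _).const_mul _).intervalIntegrable
      · intro i _
        exact (integrable_finsetSum _ fun j _ => ((((hb.int i j).mul_const _).mul_const _).const_mul _)).intervalIntegrable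
    rw [e]
    exact intervalIntegral.integral_nonneg h fun r _ => mul_nonneg (by norm_num) (hb.psd r ξ)

theorem Coef.CC_add (hb : Coef b) (r s t : ℝ) : CC b r s + CC b s t = CC b r t := by
  ext i j
  simp only [CC, Matrix.add_apply, of_apply]
  exact intervalIntegral.integral_add_adjacent_intervals (hb.ii i j _ _) (hb.ii i j _ _)

theorem CC_self (b : ℝ → Fin d → Fin d → ℝ) (s : ℝ) : CC b s s = 0 := by
  ext i j
  simp [CC]

theorem Coef.CC_abs (hb : Coef b) {s t : ℝ} (h : s ≤ t) (i j : Fin d) : |CC b s t i j| ≤ 2 * (MM b t - MM b s) := by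
  rw [← hb.MM_sub, ← intervalIntegral.integral_const_mul]
  simp only [CC, of_apply]
  refine (intervalIntegral.abs_integral_le_integral_abs h).trans ?_
  refine intervalIntegral.integral_mono_on h (hb.ii i j _ _).abs (hb.bs_int.const_mul 2).intervalIntegrable fun r _ => ?_
  rw [abs_mul, abs_two]
  have := le_bs b r i j
  linarith

theorem Coef.CC_trace (hb : Coef b) {s t : ℝ} (h : s ≤ t) : (CC b s t).trace ≤ 2 * d * (MM b t - MM b s) := by
  unfold trace
  have : ∑ i, (CC b s t).diag i ≤ ∑ _i : Fin d, 2 * (MM b t - MM b s) :=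
    Finset.sum_le_sum fun i _ => (le_abs_self _).trans (hb.CC_abs h i i)
  refine this.trans (le_of_eq ?_)
  simp; ring

theorem Coef.MM_mono (hb : Coef b) : Monotone (MM b) := fun s t h => by
  have := hb.MM_sub s t
  have h2 : 0 ≤ ∫ r in s..t, bs b r := intervalIntegral.integral_nonneg h fun r _ => bs_nn b r
  linarith

/-- the evolution operator, frozen when `t ≤ s` -/
def UU (b : ℝ → Fin d → Fin d → ℝ) (s t : ℝ) : LP P d →L[ℝ] LP P d := Gam (CC b (min s t) t)

theorem UU_norm_le (b : ℝ → Fin d → Fin d → ℝ) (s t : ℝ) (g : LP P d) : ‖UU b s t g‖ ≤ ‖g‖ := Gam_norm_le _ g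

theorem UU_self (b : ℝ → Fin d → Fin d → ℝ) (s : ℝ) (g : LP P d) : UU b s s g = g := by
  simp [UU, CC_self, Gam_zero]

theorem Coef.UU_comp (hb : Coef b) {r s t : ℝ} (h : r ≤ s) (h' : s ≤ t) (g : LP P d) :
    UU b s t (UU b r s g) = UU b r t g := by
  simp only [UU, min_eq_left h, min_eq_left h', min_eq_left (h.trans h')]
  rw [Gam_comm, ← Gam_add (hb.CC_psd h) (hb.CC_psd h'), hb.CC_add]

theorem Gam_diff {A B E F : Matrix (Fin d) (Fin d) ℝ} (hA : A.PosSemidef) (hB : B.PosSemidef) (hE : E.PosSemidef)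
    (hF : F.PosSemidef) (h : A + E = B + F) (g : LP P d) :
    ‖Gam A g - Gam B g‖ ≤ ‖Gam E g - g‖ + ‖Gam F g - g‖ := by
  have h1 : Gam A (Gam E g) = Gam B (Gam F g) := by rw [← Gam_add hA hE, ← Gam_add hB hF, h]
  have h2 : Gam A g - Gam B g = Gam B (Gam F g - g) - Gam A (Gam E g - g) := by
    rw [map_sub, map_sub, h1]; abel
  rw [h2]
  have := norm_sub_le (Gam B (Gam F g - g)) (Gam A (Gam E g - g))
  have a1 := Gam_norm_le B (Gam F g - g)
  have a2 := Gam_norm_le A (Gam E g - g)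
  linarith

theorem Coef.CC_trace_tendsto (hb : Coef b) {ι : Type*} {l : Filter ι} {σ τ : ι → ℝ} (h : ∀ i, σ i ≤ τ i) {c : ℝ}
    (h1 : Tendsto σ l (𝓝 c)) (h2 : Tendsto τ l (𝓝 c)) : Tendsto (fun i => (CC b (σ i) (τ i)).trace) l (𝓝 0) := by
  have h3 : Tendsto (fun i => 2 * d * (MM b (τ i) - MM b (σ i))) l (𝓝 (2 * d * (MM b c - MM b c))) :=
    (((hb.MM_cont.tendsto c).comp h2).sub ((hb.MM_cont.tendsto c).comp h1)).const_mul _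
  rw [sub_self, mul_zero] at h3
  exact squeeze_zero (fun i => trace_nn (hb.CC_psd (h i))) (fun i => hb.CC_trace (h i)) h3

theorem Coef.UU_cont (hb : Coef b) (g : LP P d) : Continuous fun z : ℝ × ℝ => UU b z.1 z.2 g := by
  rw [continuous_iff_continuousAt]
  rintro ⟨s, t⟩
  set s0 := min s t with hs0
  have hst : s0 ≤ t := min_le_right _ _
  rw [ContinuousAt, tendsto_iff_norm_sub_tendsto_zero]
  -- common enlargement
  have T1 : Tendsto (fun z : ℝ × ℝ => min z.1 z.2) (𝓝 (s, t)) (𝓝 s0) :=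
    (Continuous.tendsto (by fun_prop) (s, t) : Tendsto (fun z : ℝ × ℝ => min z.1 z.2) (𝓝 (s, t)) (𝓝 (min s t)))
  have T2 : Tendsto (fun z : ℝ × ℝ => z.2) (𝓝 (s, t)) (𝓝 t) := continuous_snd.tendsto (s, t)
  have T3 : Tendsto (fun z : ℝ × ℝ => min (min z.1 z.2) s0) (𝓝 (s, t)) (𝓝 s0) := by
    simpa using T1.min (tendsto_const_nhds (x := s0))
  have T4 : Tendsto (fun z : ℝ × ℝ => max z.2 t) (𝓝 (s, t)) (𝓝 t) := by
    simpa using T2.max (tendsto_const_nhds (x := t))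
  let E : ℝ × ℝ → Matrix (Fin d) (Fin d) ℝ := fun z =>
    CC b (min (min z.1 z.2) s0) (min z.1 z.2) + CC b z.2 (max z.2 t)
  let F : ℝ × ℝ → Matrix (Fin d) (Fin d) ℝ := fun z =>
    CC b (min (min z.1 z.2) s0) s0 + CC b t (max z.2 t)
  have hE : ∀ z, (E z).PosSemidef := fun z => (hb.CC_psd (min_le_left _ _)).add (hb.CC_psd (le_max_left _ _))
  have hF : ∀ z, (F z).PosSemidef := fun z => (hb.CC_psd (min_le_right _ _)).add (hb.CC_psd (le_max_right _ _))
  have tE : Tendsto (fun z => (E z).trace) (𝓝 (s, t)) (𝓝 0) := by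
    simp only [E, trace_add]
    have := (hb.CC_trace_tendsto (fun z : ℝ × ℝ => min_le_left (min z.1 z.2) s0) T3 T1).add
      (hb.CC_trace_tendsto (fun z : ℝ × ℝ => le_max_left z.2 t) T2 T4)
    simpa using this
  have tF : Tendsto (fun z => (F z).trace) (𝓝 (s, t)) (𝓝 0) := by
    simp only [F, trace_add]
    have := (hb.CC_trace_tendsto (fun z : ℝ × ℝ => min_le_right (min z.1 z.2) s0) T3 tendsto_const_nhds).add
      (hb.CC_trace_tendsto (fun z : ℝ × ℝ => le_max_right z.2 t) tendsto_const_nhds T4)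
    simpa using this
  have gE := tendsto_iff_norm_sub_tendsto_zero.1 (Gam_tendsto hE tE g)
  have gF := tendsto_iff_norm_sub_tendsto_zero.1 (Gam_tendsto hF tF g)
  refine squeeze_zero (fun _ => norm_nonneg _) (fun z => ?_) (by simpa using gE.add gF)
  refine Gam_diff (hb.CC_psd (min_le_right _ _)) (hb.CC_psd hst) (hE z) (hF z) ?_ g
  simp only [E, F]
  have e1 : CC b (min z.1 z.2) z.2 + (CC b (min (min z.1 z.2) s0) (min z.1 z.2) + CC b z.2 (max z.2 t))
      = (CC b (min (min z.1 z.2) s0) (min z.1 z.2) + CC b (min z.1 z.2) z.2) + CC b z.2 (max z.2 t) := by abel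
  have e2 : CC b s0 t + (CC b (min (min z.1 z.2) s0) s0 + CC b t (max z.2 t))
      = (CC b (min (min z.1 z.2) s0) s0 + CC b s0 t) + CC b t (max z.2 t) := by abel
  rw [e1, e2, hb.CC_add, hb.CC_add, hb.CC_add, hb.CC_add]

theorem Coef.UU_cont3 (hb : Coef b) : Continuous fun z : (ℝ × ℝ) × LP P d => UU b z.1.1 z.1.2 z.2 := by
  refine continuous_prod_of_continuous_lipschitzWith' _ 1 (fun z => ?_) (fun g => hb.UU_cont g)
  refine LipschitzWith.of_dist_le_mul fun g h => ?_
  simp only [dist_eq_norm, ← map_sub, NNReal.coe_one, one_mul]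
  exact UU_norm_le b _ _ _

/-- partition lemma -/
theorem partition {Φ m : ℝ → ℝ} {S T : ℝ} (hT : S ≤ T)
    (H : ∀ ε > 0, ∃ η > 0, ∀ s t, S ≤ s → s ≤ t → t ≤ T → t - s < η → |Φ t - Φ s| ≤ ε * (m t - m s)) : Φ T = Φ S := by
  have key : ∀ ε > 0, |Φ T - Φ S| ≤ ε * (m T - m S) := by
    intro ε hε
    obtain ⟨η, hη, H⟩ := H ε hε
    obtain ⟨N, hN⟩ := exists_nat_gt ((T - S) / η)
    have hN0 : (0:ℝ) < N := lt_of_le_of_lt (div_nonneg (by linarith) hη.le) hN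
    let q : ℕ → ℝ := fun k => S + (T - S) * k / N
    have hq : ∀ k, q (k+1) - q k = (T - S) / N := fun k => by simp only [q]; push_cast; field_simp; ring
    have hq0 : q 0 = S := by simp [q]
    have hqN : q N = T := by simp only [q]; field_simp; ring
    have step : (T - S) / N < η := by
      rw [div_lt_iff₀ hN0]; rw [div_lt_iff₀ hη] at hN; linarith
    have ind : ∀ k ≤ N, |Φ (q k) - Φ S| ≤ ε * (m (q k) - m S) := by
      intro k
      induction k with
      | zero => intro _; simp [hq0]
      | succ k ih =>
        intro hk
        have h1 := ih (by omega)
        have h0 : 0 ≤ (T - S) / N := div_nonneg (by linarith) hN0.le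
        have hle : q (k+1) ≤ T := by
          have : ((k+1:ℕ):ℝ) ≤ N := by exact_mod_cast hk
          simp only [q]
          have h3 : (T - S) * ((k+1:ℕ):ℝ) / N ≤ (T - S) := by
            rw [div_le_iff₀ hN0]; exact mul_le_mul_of_nonneg_left this (by linarith)
          linarith
        have hge : S ≤ q k := by
          simp only [q]
          have : 0 ≤ (T - S) * (k:ℝ) / N := div_nonneg (mul_nonneg (by linarith) (by positivity)) hN0.le
          linarith
        have h2 := H (q k) (q (k+1)) hge (by linarith [hq k]) hle (by rw [hq]; exact step)
        have : Φ (q (k+1)) - Φ S = (Φ (q (k+1)) - Φ (q k)) + (Φ (q k) - Φ S) := by ring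
        rw [this]
        refine (abs_add_le _ _).trans ?_
        linarith
    simpa [hqN] using ind N le_rfl
  have : |Φ T - Φ S| ≤ 0 := by
    have h3 : Tendsto (fun ε : ℝ => ε * (m T - m S)) (𝓝[>] 0) (𝓝 (0 * (m T - m S))) :=
      ((continuous_id.mul continuous_const).tendsto 0).mono_left nhdsWithin_le_nhds
    rw [zero_mul] at h3
    exact ge_of_tendsto h3 (eventually_nhdsWithin_of_forall fun ε hε => key ε hε)
  have := abs_nonpos_iff.1 this
  linarith

end MR

end

section

namespace MR
open ProbabilityTheory Matrix Filter Topology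

variable {d : ℕ} {P : ℝ≥0∞} [Fact (1 ≤ P)] [Fact (P ≠ ∞)] {b : ℝ → Fin d → Fin d → ℝ}

theorem near_diag {q : ℝ × ℝ → ℝ} {S T : ℝ} (hq : ContinuousOn q (Icc S T ×ˢ Icc S T)) (h0 : ∀ s ∈ Icc S T, q (s, s) = 0)
    {ε : ℝ} (hε : 0 < ε) : ∃ η > 0, ∀ s t, S ≤ s → s ≤ t → t ≤ T → t - s < η → q (s, t) ≤ ε := by
  have h := (isCompact_Icc.prod isCompact_Icc).uniformContinuousOn_of_continuous hq
  rw [Metric.uniformContinuousOn_iff] at h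
  obtain ⟨η, hη, h⟩ := h ε hε
  refine ⟨η, hη, fun s t h1 h2 h3 h4 => ?_⟩
  have hs : s ∈ Icc S T := ⟨h1, h2.trans h3⟩
  have ht : t ∈ Icc S T := ⟨h1.trans h2, h3⟩
  have := h (s, t) ⟨hs, ht⟩ (s, s) ⟨hs, hs⟩ (by
    rw [Prod.dist_eq]; simp only [dist_self]
    rw [max_eq_right dist_nonneg, Real.dist_eq, abs_of_nonneg (by linarith)]; exact h4)
  rw [h0 s hs, Real.dist_eq, sub_zero] at this
  exact (le_abs_self _).trans this.le

/-- size of second derivatives of a test function as functionals -/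
def NN (P : ℝ≥0∞) [Fact (1 ≤ P)] (φ : (Fin d → ℝ) → ℝ) : ℝ := ∑ i, ∑ j, ‖(prL (pd i (pd j φ)) : LP P d →L[ℝ] ℝ)‖

theorem NN_nn (φ : (Fin d → ℝ) → ℝ) : 0 ≤ NN P φ := by unfold NN; positivity

/-- the right-hand side of the weak formulation -/
def WW (b : ℝ → Fin d → Fin d → ℝ) (φ : (Fin d → ℝ) → ℝ) (r : ℝ) (g : LP P d) : ℝ :=
  ∑ i, ∑ j, b r i j * prL (pd i (pd j φ)) g

theorem WW_le (b : ℝ → Fin d → Fin d → ℝ) (φ : (Fin d → ℝ) → ℝ) (r : ℝ) (g : LP P d) :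
    |WW b φ r g| ≤ bs b r * (NN P φ * ‖g‖) := by
  unfold WW NN
  simp only [Finset.sum_mul, Finset.mul_sum]
  refine (Finset.abs_sum_le_sum_abs _ _).trans (Finset.sum_le_sum fun i _ => ?_)
  refine (Finset.abs_sum_le_sum_abs _ _).trans (Finset.sum_le_sum fun j _ => ?_)
  rw [abs_mul]
  have h1 := le_bs b r i j
  have h2 : |prL (pd i (pd j φ)) g| ≤ ‖(prL (pd i (pd j φ)) : LP P d →L[ℝ] ℝ)‖ * ‖g‖ := by
    rw [← Real.norm_eq_abs]; exact ContinuousLinearMap.le_opNorm _ g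
  exact mul_le_mul h1 h2 (abs_nonneg _) (bs_nn b r)

theorem WW_sub (b : ℝ → Fin d → Fin d → ℝ) (φ : (Fin d → ℝ) → ℝ) (r : ℝ) (g h : LP P d) :
    WW b φ r (g - h) = WW b φ r g - WW b φ r h := by
  simp only [WW, map_sub, mul_sub, Finset.sum_sub_distrib]

theorem Coef.WW_int (hb : Coef b) (φ : (Fin d → ℝ) → ℝ) {z : ℝ → LP P d} {s t : ℝ} (h : s ≤ t) (hz : ContinuousOn z (Icc s t)) :
    IntervalIntegrable (fun r => WW b φ r (z r)) volume s t := by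
  unfold WW
  have hh : ∀ i j, IntervalIntegrable (fun r => b r i j * prL (pd i (pd j φ)) (z r)) volume s t := fun i j =>
    ((hb.int i j).intervalIntegrable).mul_continuousOn (by
      rw [uIcc_of_le h]; exact (prL (pd i (pd j φ))).continuous.comp_continuousOn hz)
  exact (intervalIntegrable_iff_integrableOn_Ioc_of_le h).2 (integrable_finsetSum _ fun i _ => integrable_finsetSum _ fun j _ =>
    (intervalIntegrable_iff_integrableOn_Ioc_of_le h).1 (hh i j))

theorem Coef.WW_const (hb : Coef b) (φ : (Fin d → ℝ) → ℝ) (g : LP P d) (s t : ℝ) :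
    ∫ r in s..t, WW b φ r g = (∑ i, ∑ j, CC b s t i j * prL (pd i (pd j φ)) g) / 2 := by
  unfold WW
  rw [intervalIntegral.integral_finsetSum, Finset.sum_div]
  · refine Finset.sum_congr rfl fun i _ => ?_
    rw [intervalIntegral.integral_finsetSum, Finset.sum_div]
    · refine Finset.sum_congr rfl fun j _ => ?_
      rw [intervalIntegral.integral_mul_const]
      simp only [CC, of_apply, intervalIntegral.integral_const_mul]
      ring
    · intro j _
      exact ((hb.int i j).mul_const _).intervalIntegrable
  · intro i _
    exact (integrable_finsetSum _ fun j _ => ((hb.int i j).mul_const _)).intervalIntegrable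

/-- bound of an oscillation -/
theorem Coef.WW_osc (hb : Coef b) (φ : (Fin d → ℝ) → ℝ) {z : ℝ → LP P d} {s t ε : ℝ} (h : s ≤ t) (hz : ContinuousOn z (Icc s t))
    (H : ∀ r ∈ Icc s t, NN P φ * ‖z r‖ ≤ ε) : |∫ r in s..t, WW b φ r (z r)| ≤ ε * (MM b t - MM b s) := by
  rw [← hb.MM_sub, ← intervalIntegral.integral_const_mul]
  refine (intervalIntegral.abs_integral_le_integral_abs h).trans ?_
  refine intervalIntegral.integral_mono_on h (hb.WW_int φ h hz).abs (hb.bs_int.const_mul _).intervalIntegrable fun r hr => ?_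
  refine (WW_le b φ r (z r)).trans ?_
  rw [mul_comm]
  exact mul_le_mul_of_nonneg_right (H r hr) (bs_nn b r)

theorem Coef.UU_ct (hb : Coef b) (s : ℝ) (g : LP P d) : Continuous fun t => UU b s t g :=
  (hb.UU_cont g).comp (g := fun z : ℝ × ℝ => UU b z.1 z.2 g) (f := fun t => (s, t)) (Continuous.prodMk_right s)

/-- the evolution operator solves the equation weakly -/
theorem Coef.UU_weak (hb : Coef b) {φ : (Fin d → ℝ) → ℝ} (h : Test φ) (g : LP P d) {S T : ℝ} (hST : S ≤ T) :
    prL φ (UU b S T g) = prL φ g + ∫ r in S..T, WW b φ r (UU b S r g) := by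
  have hc := hb.UU_ct S g
  have key := partition (Φ := fun t => prL φ (UU b S t g) - ∫ r in S..t, WW b φ r (UU b S r g)) (m := MM b) hST ?_
  · simp only [UU_self, intervalIntegral.integral_same, sub_zero] at key
    linarith
  intro ε hε
  set c0 := KG P φ * ‖g‖ * (d * M3 * (2 * d : ℝ) ^ (3/2:ℝ)) with hc0
  have hc0n : 0 ≤ c0 := mul_nonneg (mul_nonneg (KG_nonneg φ) (norm_nonneg _)) (mul_nonneg (mul_nonneg (by positivity) M3_nonneg) (by positivity))
  have hM := hb.MM_cont
  obtain ⟨η1, h1, H1⟩ := near_diag (S := S) (T := T) (q := fun z => c0 * (MM b z.2 - MM b z.1) ^ (1/2:ℝ))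
    (Continuous.continuousOn (continuous_const.mul (((hM.comp continuous_snd).sub (hM.comp continuous_fst)).rpow_const
      (fun _ => Or.inr (by norm_num))))) (fun s _ => by simp) (half_pos hε)
  obtain ⟨η2, h2, H2⟩ := near_diag (S := S) (T := T) (q := fun z => NN P φ * ‖UU b S z.1 g - UU b S z.2 g‖)
    (Continuous.continuousOn (continuous_const.mul ((hc.comp continuous_fst).sub (hc.comp continuous_snd)).norm)) (fun s _ => by simp) (half_pos hε)
  refine ⟨min η1 η2, lt_min h1 h2, fun s t hs hst ht hlt => ?_⟩
  set w := UU b S s g with hw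
  have hΔ : 0 ≤ MM b t - MM b s := sub_nonneg.2 (hb.MM_mono hst)
  have e1 : UU b S t g = Gam (CC b s t) w := by
    rw [← hb.UU_comp hs hst, ← hw]; simp only [UU, min_eq_left hst]
  have ge := gauss_expand h (hb.CC_psd hst) w
  rw [← hb.WW_const] at ge
  have e2 : KG P φ * ‖w‖ * (d * M3 * (CC b s t).trace ^ (3/2:ℝ)) ≤ ε / 2 * (MM b t - MM b s) := by
    have t1 : (CC b s t).trace ^ (3/2:ℝ) ≤ (2 * d : ℝ) ^ (3/2:ℝ) * ((MM b t - MM b s) ^ (1/2:ℝ) * (MM b t - MM b s)) := by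
      have : (MM b t - MM b s) ^ (1/2:ℝ) * (MM b t - MM b s) = (MM b t - MM b s) ^ (3/2:ℝ) := by
        rw [show (3/2:ℝ) = 1/2 + 1 by norm_num, Real.rpow_add_of_nonneg hΔ (by norm_num) (by norm_num), Real.rpow_one]
      rw [this, ← Real.mul_rpow (by positivity) hΔ]
      exact Real.rpow_le_rpow (trace_nn (hb.CC_psd hst)) (hb.CC_trace hst) (by norm_num)
    have t2 : ‖w‖ ≤ ‖g‖ := UU_norm_le _ _ _ _
    have t3 := H1 s t hs hst ht (hlt.trans_le (min_le_left _ _))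
    calc KG P φ * ‖w‖ * (d * M3 * (CC b s t).trace ^ (3/2:ℝ))
        ≤ KG P φ * ‖g‖ * (d * M3 * ((2 * d : ℝ) ^ (3/2:ℝ) * ((MM b t - MM b s) ^ (1/2:ℝ) * (MM b t - MM b s)))) := by
          have := KG_nonneg (P := P) φ
          have := M3_nonneg
          have t4 := trace_nn (hb.CC_psd hst)
          gcongr
      _ = (c0 * (MM b t - MM b s) ^ (1/2:ℝ)) * (MM b t - MM b s) := by rw [hc0]; ring
      _ ≤ _ := mul_le_mul_of_nonneg_right t3 hΔ
  have osc := hb.WW_osc φ (z := fun r => w - UU b S r g) (ε := ε / 2) hst (continuous_const.sub hc).continuousOn (fun r hr =>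
    H2 s r hs hr.1 (hr.2.trans ht) (lt_of_le_of_lt (by linarith [hr.2]) (hlt.trans_le (min_le_right _ _))))
  have i1 : IntervalIntegrable (fun r => WW b φ r w) volume s t := hb.WW_int φ hst continuousOn_const
  have ig : ∀ s t, s ≤ t → IntervalIntegrable (fun r => WW b φ r (UU b S r g)) volume s t := fun s t hst => hb.WW_int φ hst hc.continuousOn
  simp only [WW_sub] at osc
  rw [intervalIntegral.integral_sub i1 (ig s t hst)] at osc
  have e3 := intervalIntegral.integral_add_adjacent_intervals (ig S s hs) (ig s t hst)
  rw [← e3, e1]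
  have : (prL φ) ((Gam (CC b s t)) w) - ((∫ r in S..s, WW b φ r (UU b S r g)) + ∫ r in s..t, WW b φ r (UU b S r g)) -
      (prL φ w - ∫ r in S..s, WW b φ r (UU b S r g)) = (prL φ (Gam (CC b s t) w) - prL φ w - ∫ r in s..t, WW b φ r w)
       + ((∫ r in s..t, WW b φ r w) - ∫ r in s..t, WW b φ r (UU b S r g)) := by ring
  rw [this]
  refine (abs_add_le _ _).trans ?_
  linarith

/-- uniqueness -/
theorem Coef.unique (hb : Coef b) {z : ℝ → LP P d} {T : ℝ} (hT : 0 ≤ T) (hz : ContinuousOn z (Icc 0 T))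
    (H : ∀ φ, Test φ → ∀ t ∈ Icc 0 T, prL φ (z t) = ∫ r in (0:ℝ)..t, WW b φ r (z r)) : z T = 0 := by
  refine LP_ext fun φ h => ?_
  rw [map_zero]
  have z0 : z 0 = 0 := LP_ext fun φ h => by rw [H φ h 0 ⟨le_rfl, hT⟩]; simp
  have hU : ContinuousOn (fun q : ℝ × ℝ => UU b q.1 q.2 (z q.1)) (Icc 0 T ×ˢ Icc 0 T) :=
    hb.UU_cont3.comp_continuousOn (g := fun z : (ℝ × ℝ) × LP P d => UU b z.1.1 z.1.2 z.2) (f := fun q : ℝ × ℝ => (q, z q.1))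
      (ContinuousOn.prodMk continuousOn_id (hz.comp continuousOn_fst fun q hq => hq.1))
  have key := partition (Φ := fun s => prL φ (UU b s T (z s))) (m := MM b) hT ?_
  · simpa [UU_self, z0] using key
  intro ε hε
  obtain ⟨η, h2, H2⟩ := near_diag (S := 0) (T := T) (q := fun q => NN P φ * ‖z q.2 - UU b q.1 q.2 (z q.1)‖)
    (continuousOn_const.mul ((hz.comp continuousOn_snd fun q hq => hq.2).sub hU).norm) (fun s _ => by simp [UU_self]) hε
  refine ⟨η, h2, fun s t hs hst ht hlt => ?_⟩
  have e1 : UU b s T (z s) = UU b t T (UU b s t (z s)) := (hb.UU_comp hst ht _).symm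
  rw [e1, ← map_sub, ← map_sub]
  have e2 : prL φ (UU b t T (z t - UU b s t (z s))) = ∫ y, prL φ (tr y (z t - UU b s t (z s))) ∂(gam (CC b (min t T) T)) :=
    pr_Gam _ _ _
  rw [e2, ← Real.norm_eq_abs]
  have hΔ : 0 ≤ MM b t - MM b s := sub_nonneg.2 (hb.MM_mono hst)
  have hbd : ∀ y, ‖prL φ (tr y (z t - UU b s t (z s)))‖ ≤ ε * (MM b t - MM b s) := by
    intro y
    rw [pr_tr h, map_sub]
    set ψ : (Fin d → ℝ) → ℝ := fun x => φ (x - y) with hψ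
    have hT' : Test ψ := h.shift y
    have a1 := H ψ hT' t ⟨hs.trans hst, ht⟩
    have a2 := H ψ hT' s ⟨hs, hst.trans ht⟩
    have a3 := hb.UU_weak hT' (z s) hst
    have c1 : ContinuousOn z (Icc s t) := hz.mono (Icc_subset_Icc hs ht)
    have i0 : IntervalIntegrable (fun r => WW b ψ r (z r)) volume 0 s := hb.WW_int ψ hs (hz.mono (Icc_subset_Icc le_rfl (hst.trans ht)))
    have i1 : IntervalIntegrable (fun r => WW b ψ r (z r)) volume s t := hb.WW_int ψ hst c1
    have i2 : IntervalIntegrable (fun r => WW b ψ r (UU b s r (z s))) volume s t := hb.WW_int ψ hst (hb.UU_ct _ _).continuousOn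
    have hN : NN P ψ ≤ NN P φ := by
      refine Finset.sum_le_sum fun i _ => Finset.sum_le_sum fun j _ => ?_
      refine ContinuousLinearMap.opNorm_le_bound _ (norm_nonneg _) fun g => ?_
      have : pd i (pd j ψ) = fun x => pd i (pd j φ) (x - y) := by
        rw [hψ, pd_shift, pd_shift]
      rw [this, ← pr_tr ((h.pd j).pd i)]
      exact ff_bound _ g y
    have osc := hb.WW_osc ψ (z := fun r => z r - UU b s r (z s)) (ε := ε) hst (c1.sub (hb.UU_ct _ _).continuousOn) (fun r hr =>
      (mul_le_mul_of_nonneg_right hN (norm_nonneg _)).trans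
        (H2 s r hs hr.1 (hr.2.trans ht) (lt_of_le_of_lt (by linarith [hr.2]) hlt)))
    simp only [WW_sub] at osc
    rw [intervalIntegral.integral_sub i1 i2] at osc
    have e3 := intervalIntegral.integral_add_adjacent_intervals i0 i1
    rw [Real.norm_eq_abs]
    have : prL ψ (z t) - prL ψ (UU b s t (z s)) = (∫ r in s..t, WW b ψ r (z r)) - ∫ r in s..t, WW b ψ r (UU b s r (z s)) := by
      rw [a1, a3, a2, ← e3]; ring
    rw [this]; exact osc
  refine (norm_integral_le_of_norm_le_const (C := ε * (MM b t - MM b s)) (Eventually.of_forall hbd)).trans ?_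
  simp

end MR

end

section

namespace MR
open ProbabilityTheory Matrix Filter Topology

variable {d : ℕ} {P : ℝ≥0∞} [Fact (1 ≤ P)] [Fact (P ≠ ∞)] {b : ℝ → Fin d → Fin d → ℝ}

/-- the mild solution -/
def uu (b : ℝ → Fin d → Fin d → ℝ) (f : ℝ → LP P d) (t : ℝ) : LP P d := ∫ s in Iic t, UU b s t (f s)

theorem Coef.UU_meas (hb : Coef b) {f : ℝ → LP P d} {m : Measure ℝ} (hf : AEStronglyMeasurable f m) (t : ℝ) :
    AEStronglyMeasurable (fun s => UU b s t (f s)) m :=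
  hb.UU_cont3.comp_aestronglyMeasurable (g := fun z : (ℝ × ℝ) × LP P d => UU b z.1.1 z.1.2 z.2) (f := fun s => ((s, t), f s))
    (AEStronglyMeasurable.prodMk (Continuous.aestronglyMeasurable (by fun_prop)) hf)

theorem Coef.UU_int (hb : Coef b) {f : ℝ → LP P d} (hf : Integrable f) (t : ℝ) : Integrable (fun s => UU b s t (f s)) :=
  hf.norm.mono' (hb.UU_meas hf.1 t) (Eventually.of_forall fun _ => UU_norm_le _ _ _ _)

theorem uu_norm (b : ℝ → Fin d → Fin d → ℝ) {f : ℝ → LP P d} (hf : Integrable f) (t : ℝ) : ‖uu b f t‖ ≤ ∫ s in Iic t, ‖f s‖ :=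
  norm_integral_le_of_norm_le hf.norm.integrableOn (Eventually.of_forall fun _ => UU_norm_le _ _ _ _)

theorem Coef.uu_cont (hb : Coef b) {f : ℝ → LP P d} (hf : Integrable f) : Continuous (uu b f) := by
  have e : uu b f = fun t => ∫ s, (Iic t).indicator (fun s => UU b s t (f s)) s := by
    ext1 t; rw [integral_indicator measurableSet_Iic]; rfl
  rw [e, continuous_iff_continuousAt]
  intro t0
  refine continuousAt_of_dominated (bound := fun s => ‖f s‖) (Eventually.of_forall fun t => ?_) (Eventually.of_forall fun t =>
    Eventually.of_forall fun s => ?_) hf.norm ?_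
  · exact (hb.UU_meas hf.1 t).indicator measurableSet_Iic
  · exact (norm_indicator_le_norm_self _ _).trans (UU_norm_le _ _ _ _)
  · have : ∀ᵐ s : ℝ, s ≠ t0 := by simp [ae_iff]
    filter_upwards [this] with s hs
    rcases lt_or_gt_of_ne hs with h | h
    · refine ((hb.UU_ct s (f s)).continuousAt).congr ?_
      filter_upwards [eventually_gt_nhds h] with t ht
      rw [indicator_of_mem (by exact ht.le)]
    · refine (continuousAt_const (y := (0 : LP P d))).congr ?_
      filter_upwards [eventually_lt_nhds h] with t ht
      rw [indicator_of_notMem (by simpa using ht)]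

theorem Coef.uu_weak (hb : Coef b) {f : ℝ → LP P d} (hf : Integrable f) {φ : (Fin d → ℝ) → ℝ} (h : Test φ) (t : ℝ) :
    prL φ (uu b f t) = (∫ s in Iic t, prL φ (f s)) + ∫ r in Iic t, WW b φ r (uu b f r) := by
  let G : ℝ → ℝ → ℝ := fun s r => WW b φ r (UU b s r (f s))
  have hGm : AEStronglyMeasurable (Function.uncurry G) (volume.prod volume) := by
    have hU : AEStronglyMeasurable (fun z : ℝ × ℝ => UU b z.1 z.2 (f z.1)) (volume.prod volume) :=
      hb.UU_cont3.comp_aestronglyMeasurable (g := fun z : (ℝ × ℝ) × LP P d => UU b z.1.1 z.1.2 z.2) (f := fun z : ℝ × ℝ => (z, f z.1))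
        (AEStronglyMeasurable.prodMk (Continuous.aestronglyMeasurable (by fun_prop)) hf.1.comp_fst)
    show AEStronglyMeasurable (fun z : ℝ × ℝ => ∑ i, ∑ j, b z.2 i j * prL (pd i (pd j φ)) (UU b z.1 z.2 (f z.1))) _
    refine Finset.aestronglyMeasurable_fun_sum _ fun i _ => Finset.aestronglyMeasurable_fun_sum _ fun j _ => ?_
    exact ((hb.int i j).1.comp_snd).mul ((prL (pd i (pd j φ))).continuous.comp_aestronglyMeasurable hU)
  let A : Set (ℝ × ℝ) := {z | z.1 < z.2 ∧ z.2 ≤ t}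
  have hA : MeasurableSet A := (measurableSet_lt measurable_fst measurable_snd).inter (measurable_snd measurableSet_Iic)
  have hGi : Integrable (A.indicator (Function.uncurry G)) (volume.prod volume) := by
    refine Integrable.mono' (((hf.norm).mul_prod (hb.bs_int.const_mul (NN P φ)))) (hGm.indicator hA) (Eventually.of_forall fun z => ?_)
    refine (norm_indicator_le_norm_self _ _).trans ?_
    refine (WW_le b φ z.2 _).trans ?_
    have := mul_le_mul_of_nonneg_left (UU_norm_le b z.1 z.2 (f z.1)) (mul_nonneg (bs_nn b z.2) (NN_nn (P := P) φ))
    linarith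
  have sw := integral_integral_swap (f := fun s r => A.indicator (Function.uncurry G) (s, r)) hGi
  have L1 : ∀ s, ∫ r, A.indicator (Function.uncurry G) (s, r) = (Iic t).indicator (fun s => ∫ r in s..t, G s r) s := by
    intro s
    by_cases hs : s ≤ t
    · rw [indicator_of_mem (by exact hs), intervalIntegral.integral_of_le hs, ← integral_indicator measurableSet_Ioc]
      rfl
    · rw [indicator_of_notMem (by exact hs)]
      have : ∀ r, A.indicator (Function.uncurry G) (s, r) = 0 := fun r => by
        rw [indicator_of_notMem]
        rintro ⟨h1, h2⟩
        exact hs (h1.le.trans h2)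
      simp [this]
  have L2 : ∀ r, ∫ s, A.indicator (Function.uncurry G) (s, r) = (Iic t).indicator (fun r => WW b φ r (uu b f r)) r := by
    intro r
    by_cases hr : r ≤ t
    · rw [indicator_of_mem (by exact hr)]
      have : (fun s => A.indicator (Function.uncurry G) (s, r)) = (Iio r).indicator (fun s => G s r) := by
        ext s
        by_cases hs : s < r
        · rw [indicator_of_mem (by exact ⟨hs, hr⟩), indicator_of_mem (by exact hs)]; rfl
        · rw [indicator_of_notMem (fun hh => hs hh.1), indicator_of_notMem (by exact hs)]
      rw [this, integral_indicator measurableSet_Iio, setIntegral_congr_set (Iio_ae_eq_Iic (a := r))]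
      have hi := (hb.UU_int hf r).integrableOn (s := Iic r)
      simp only [G, WW]
      rw [integral_finsetSum]
      · refine Finset.sum_congr rfl fun i _ => ?_
        rw [integral_finsetSum]
        · refine Finset.sum_congr rfl fun j _ => ?_
          rw [integral_const_mul, ContinuousLinearMap.integral_comp_comm _ hi]; rfl
        · intro j _
          exact ((prL (pd i (pd j φ))).integrable_comp hi).const_mul _
      · intro i _
        exact integrable_finsetSum _ fun j _ => ((prL (pd i (pd j φ))).integrable_comp hi).const_mul _
    · rw [indicator_of_notMem (by exact hr)]
      have : ∀ s, A.indicator (Function.uncurry G) (s, r) = 0 := fun s => by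
        rw [indicator_of_notMem]
        rintro ⟨h1, h2⟩
        exact hr h2
      simp [this]
  have hLi : IntegrableOn (fun s => ∫ r in s..t, G s r) (Iic t) := by
    rw [← integrable_indicator_iff measurableSet_Iic]
    have := hGi.integral_prod_left
    simp only [L1] at this
    exact this
  simp only [L1, L2] at sw
  rw [integral_indicator measurableSet_Iic, integral_indicator measurableSet_Iic] at sw
  have e1 : prL φ (uu b f t) = ∫ s in Iic t, (prL φ (f s) + ∫ r in s..t, G s r) := by
    unfold uu
    rw [← ContinuousLinearMap.integral_comp_comm _ (hb.UU_int hf t).integrableOn]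
    refine setIntegral_congr_fun measurableSet_Iic fun s hs => ?_
    exact hb.UU_weak h (f s) hs
  rw [e1, integral_add ((prL φ).integrable_comp hf).integrableOn hLi, sw]

end MR

end

section

namespace MR
open ProbabilityTheory Matrix Filter Topology

variable {d : ℕ}

theorem hk_lint {v : ℝ} (hv : 0 < v) (c : ℝ) (hc : 0 ≤ c) : ∫⁻ x, ENNReal.ofReal (c * hk (d := d) v x) = ENNReal.ofReal c := by
  have h := hk_int (d := d) hv
  rw [← ofReal_integral_eq_lintegral_ofReal (h.1.const_mul c) (Eventually.of_forall fun x => mul_nonneg hc (hk_nonneg v x)),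
    integral_const_mul, h.2, mul_one]

theorem L1diff {φ φ' G : ℝ → (Fin d → ℝ) → ℝ} {a b M : ℝ} (hab : a ≤ b)
    (hd : ∀ x, ∀ θ ∈ Icc a b, HasDerivAt (fun θ => φ θ x) (φ' θ x) θ) (hG : Continuous (Function.uncurry G))
    (hb : ∀ θ ∈ Icc a b, ∀ x, |φ' θ x| ≤ G θ x) (hM : ∀ θ, ∫⁻ x, ENNReal.ofReal (G θ x) ≤ ENNReal.ofReal M) :
    ∫⁻ x, ‖φ b x - φ a x‖ₑ ≤ ENNReal.ofReal ((b - a) * M) := by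
  have hGx : ∀ x, Continuous fun θ => G θ x := fun x => hG.comp (Continuous.prodMk_left x)
  have h1 : ∀ x, ‖φ b x - φ a x‖ₑ ≤ ∫⁻ θ in Ioc a b, ENNReal.ofReal (G θ x) := by
    intro x
    have h2 : ‖φ b x - φ a x‖ ≤ ∫ θ in a..b, G θ x := by
      refine image_norm_le_of_norm_deriv_right_le_deriv_boundary (f := fun θ => φ θ x - φ a x) (f' := fun θ => φ' θ x)
        (B := fun t => ∫ θ in a..t, G θ x) (B' := fun θ => G θ x) (a := a) (b := b) ?_ ?_ (by simp) ?_ ?_ (right_mem_Icc.2 hab)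
      · exact fun θ hθ => ((hd x θ hθ).sub_const _).continuousAt.continuousWithinAt
      · exact fun θ hθ => ((hd x θ ⟨hθ.1, hθ.2.le⟩).sub_const _).hasDerivWithinAt
      · exact fun t => ((hGx x).integral_hasStrictDerivAt a t).hasDerivAt
      · exact fun θ hθ => hb θ ⟨hθ.1, hθ.2.le⟩ x
    rw [intervalIntegral.integral_of_le hab] at h2
    rw [← ofReal_norm_eq_enorm, ← ofReal_integral_eq_lintegral_ofReal]
    · exact ENNReal.ofReal_le_ofReal h2
    · exact (hGx x).integrableOn_Icc.mono_set Ioc_subset_Icc_self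
    · filter_upwards [ae_restrict_mem measurableSet_Ioc] with θ hθ
      exact (abs_nonneg _).trans (hb θ ⟨hθ.1.le, hθ.2⟩ x)
  calc ∫⁻ x, ‖φ b x - φ a x‖ₑ ≤ ∫⁻ x, ∫⁻ θ in Ioc a b, ENNReal.ofReal (G θ x) := lintegral_mono h1
    _ = ∫⁻ θ in Ioc a b, ∫⁻ x, ENNReal.ofReal (G θ x) := by
        rw [lintegral_lintegral_swap]
        exact ((hG.comp continuous_swap).measurable.ennreal_ofReal).aemeasurable
    _ ≤ ∫⁻ θ in Ioc a b, ENNReal.ofReal M := lintegral_mono fun θ => hM θ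
    _ = _ := by
        simp only [lintegral_const, Measure.restrict_apply, MeasurableSet.univ, univ_inter, Real.volume_Ioc]
        rw [mul_comm, ← ENNReal.ofReal_mul (by linarith)]

/-- third derivatives of the Gaussian density -/
def kd (v : ℝ) (i j k : Fin d) (x : Fin d → ℝ) : ℝ :=
  -(v⁻¹ * ((if k = i then hk1 v j x else 0) + x i * kk v k j x)) - (if i = j then 1 / v else 0) * hk1 v k x

theorem kk_fd (v : ℝ) (i j : Fin d) (x : Fin d → ℝ) :
    HasFDerivAt (kk v i j) (∑ k, kd v i j k x • (ContinuousLinearMap.proj (R := ℝ) k : (Fin d → ℝ) →L[ℝ] ℝ)) x := by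
  have h1 := ((((ContinuousLinearMap.proj (R := ℝ) i : (Fin d → ℝ) →L[ℝ] ℝ).hasFDerivAt (x := x)).mul_const (-v⁻¹)).mul
    (hk1_fd v j x)).sub ((hk_fd v x).const_mul (if i = j then 1 / v else 0))
  have e : kk v i j = (fun x : Fin d → ℝ => (ContinuousLinearMap.proj (R := ℝ) i : (Fin d → ℝ) →L[ℝ] ℝ) x * (-v⁻¹)) * hk1 v j
      - fun x => (if i = j then 1 / v else 0) * hk v x := by
    ext x
    simp only [kk, hk1, Pi.sub_apply, Pi.mul_apply, ContinuousLinearMap.proj_apply]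
    by_cases hv : v = 0
    · simp [hv]
    · field_simp
  rw [e]
  refine h1.congr_fderiv ?_
  refine ContinuousLinearMap.ext fun y => ?_
  simp only [ContinuousLinearMap.smul_apply, ContinuousLinearMap.sum_apply, smul_eq_mul, ContinuousLinearMap.proj_apply,
    ContinuousLinearMap.add_apply, ContinuousLinearMap.sub_apply]
  have e2 : hk1 v j x * (-v⁻¹ * y i) = ∑ k, hk1 v j x * (-v⁻¹ * (if k = i then y k else 0)) := by
    rw [← Finset.mul_sum, ← Finset.mul_sum]; simp
  rw [e2, Finset.mul_sum, Finset.mul_sum, ← Finset.sum_add_distrib, ← Finset.sum_sub_distrib]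
  refine Finset.sum_congr rfl fun k _ => ?_
  unfold kd
  split_ifs <;> ring

theorem coord_div {v : ℝ} (hv : 0 < v) (i : Fin d) (x : Fin d → ℝ) : |x i| / v ≤ (√v)⁻¹ * (1 + sq x / v) := by
  have h1 : |x i| / v = (√v)⁻¹ * |x i / √v| := by
    rw [abs_div, abs_of_nonneg (Real.sqrt_nonneg v)]
    have h2 : √v ≠ 0 := by positivity
    field_simp
    rw [Real.sq_sqrt hv.le]
  rw [h1]
  gcongr
  refine (abs_le_one_add_sq _).trans ?_
  rw [div_pow, Real.sq_sqrt hv.le]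
  gcongr
  exact coord_sq x i

theorem kd_bound {v : ℝ} (hv : 0 < v) (i j k : Fin d) (x : Fin d → ℝ) :
    |kd v i j k x| ≤ 4 * cB d * (v * √v)⁻¹ * hk (2 * v) x := by
  have hq : 0 ≤ sq x / v := div_nonneg (sq_nn x) hv.le
  have h0 := hk_nonneg v x
  have hs : 0 < √v := by positivity
  have e : (v * √v)⁻¹ = v⁻¹ * (√v)⁻¹ := mul_inv _ _
  have b1 : ∀ i, |hk1 v i x| ≤ (√v)⁻¹ * ((1 + sq x / v) * hk v x) := fun i => hk1_bound hv i x
  have b2 := kk_bound hv k j x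
  have b3 := coord_div hv i x
  have p := hk_poly hv x
  set q := sq x / v
  have s1 : |kd v i j k x| ≤ v⁻¹ * (|hk1 v j x| + |x i| * |kk v k j x|) + v⁻¹ * |hk1 v k x| := by
    unfold kd
    refine (abs_sub _ _).trans (add_le_add ?_ ?_)
    · rw [abs_neg, abs_mul, abs_of_pos (by positivity : 0 < v⁻¹)]
      gcongr
      refine (abs_add_le _ _).trans (add_le_add ?_ (abs_mul _ _).le)
      split_ifs <;> simp
    · rw [abs_mul]
      gcongr
      split_ifs
      · simp [abs_of_pos hv]
      · simp [hv.le]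
  have s2 : |x i| * |kk v k j x| ≤ (√v)⁻¹ * (1 + q) * ((1 + q) * hk v x) := by
    calc |x i| * |kk v k j x| ≤ |x i| * (v⁻¹ * ((1 + q) * hk v x)) := by gcongr
      _ = (|x i| / v) * ((1 + q) * hk v x) := by ring
      _ ≤ _ := by gcongr
  calc |kd v i j k x| ≤ v⁻¹ * ((√v)⁻¹ * ((1 + q) * hk v x) + (√v)⁻¹ * (1 + q) * ((1 + q) * hk v x)) + v⁻¹ * ((√v)⁻¹ * ((1 + q) * hk v x)) := by
        refine s1.trans ?_
        gcongr
        · exact b1 j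
        · exact b1 k
    _ = (v * √v)⁻¹ * ((3 + 4 * q + q ^ 2) * hk v x) := by rw [e]; ring
    _ ≤ (v * √v)⁻¹ * (4 * (cB d * hk (2 * v) x)) := by
        refine mul_le_mul_of_nonneg_left ?_ (by positivity)
        refine le_trans ?_ (mul_le_mul_of_nonneg_left p (by norm_num : (0:ℝ) ≤ 4))
        rw [← mul_assoc]
        gcongr
        nlinarith
    _ = _ := by ring

/-- space regularity of the kernel in `L¹` -/
theorem kk_space {v : ℝ} (hv : 0 < v) (i j : Fin d) (y : Fin d → ℝ) :
    ∫⁻ x, ‖kk v i j (x - y) - kk v i j x‖ₑ ≤ ENNReal.ofReal (4 * cB d * d * ‖y‖ * (v * √v)⁻¹) := by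
  have hcB := cB_pos d
  have := L1diff (φ := fun θ x => kk v i j (x - θ • y)) (φ' := fun θ x => ∑ k, kd v i j k (x - θ • y) * (- y k))
    (G := fun θ x => 4 * cB d * d * ‖y‖ * (v * √v)⁻¹ * hk (2 * v) (x - θ • y)) (a := 0) (b := 1) (M := 4 * cB d * d * ‖y‖ * (v * √v)⁻¹) (by norm_num) ?_ ?_ ?_ ?_
  · simpa using this
  · intro x θ _
    have h1 : HasDerivAt (fun θ : ℝ => x - θ • y) (-y) θ := by
      simpa using ((hasDerivAt_id θ).smul_const y).const_sub x
    refine ((kk_fd v i j (x - θ • y)).comp_hasDerivAt θ h1).congr_deriv ?_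
    simp [ContinuousLinearMap.sum_apply]
  · have := hk_cont (d := d) (2 * v)
    exact continuous_const.mul (this.comp (by fun_prop))
  · intro θ _ x
    refine (Finset.abs_sum_le_sum_abs _ _).trans ?_
    calc ∑ k, |kd v i j k (x - θ • y) * (- y k)| ≤ ∑ _k : Fin d, 4 * cB d * (v * √v)⁻¹ * hk (2 * v) (x - θ • y) * ‖y‖ := by
          refine Finset.sum_le_sum fun k _ => ?_
          rw [abs_mul, abs_neg]
          exact mul_le_mul (kd_bound hv i j k _) (coord_le y k) (abs_nonneg _) (by have := hk_nonneg (2 * v) (x - θ • y); positivity)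
      _ = _ := by simp; ring
  · intro θ
    rw [lintegral_sub_right_eq_self (fun x => ENNReal.ofReal (4 * cB d * d * ‖y‖ * (v * √v)⁻¹ * hk (2 * v) x)) (θ • y)]
    exact (hk_lint (by positivity) _ (by positivity)).le

theorem hk_dv {v : ℝ} (hv : 0 < v) (x : Fin d → ℝ) :
    HasDerivAt (fun v => hk v x) ((sq x / v / 2 - d / 2) * v⁻¹ * hk v x) v := by
  have hpos : 0 < 2 * Real.pi * v := by positivity
  have h1 : HasDerivAt (fun v : ℝ => 2 * Real.pi * v) (2 * Real.pi) v := by simpa using (hasDerivAt_id v).const_mul (2 * Real.pi)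
  have h2 := ((h1.sqrt hpos.ne').inv (by positivity)).pow d
  have h3 : HasDerivAt (fun v : ℝ => -(∑ k, x k ^ 2) / (2 * v)) (sq x / (2 * v ^ 2)) v := by
    have := ((hasDerivAt_id v).const_mul 2).inv (by simp; positivity)
    have := this.const_mul (-(∑ k, x k ^ 2))
    refine (this.congr_deriv ?_)
    simp only [sq, id]
    field_simp
  have h4 := h2.mul h3.exp
  refine h4.congr_deriv ?_
  simp only [hk, Pi.pow_apply, Pi.inv_apply]
  have hs : √(2 * Real.pi * v) ≠ 0 := by positivity
  have hss : √(2 * Real.pi * v) ^ 2 = 2 * Real.pi * v := Real.sq_sqrt hpos.le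
  have e : ∀ n : ℕ, (n:ℝ) * (√(2 * Real.pi * v))⁻¹ ^ (n - 1) * (-(2 * Real.pi / (2 * √(2 * Real.pi * v))) / √(2 * Real.pi * v) ^ 2)
      = - (n / 2) * v⁻¹ * (√(2 * Real.pi * v))⁻¹ ^ n := by
    intro n
    rcases n with _ | n
    · simp
    · rw [hss]
      simp only [Nat.add_sub_cancel, pow_succ]
      field_simp
  rw [e]
  field_simp
  ring

/-- time derivative of the kernel -/
def kt (v : ℝ) (i j : Fin d) (x : Fin d → ℝ) : ℝ :=
  (-(2 * (x i * x j) / v ^ 3) + (if i = j then 1 / v ^ 2 else 0)) * hk v x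
    + (x i * x j / v ^ 2 - (if i = j then 1 / v else 0)) * ((sq x / v / 2 - d / 2) * v⁻¹ * hk v x)

theorem kk_dv {v : ℝ} (hv : 0 < v) (i j : Fin d) (x : Fin d → ℝ) : HasDerivAt (fun v => kk v i j x) (kt v i j x) v := by
  have h1 : HasDerivAt (fun v : ℝ => x i * x j / v ^ 2 - (if i = j then 1 / v else 0))
      (-(2 * (x i * x j) / v ^ 3) + (if i = j then 1 / v ^ 2 else 0)) v := by
    have a1 : HasDerivAt (fun v : ℝ => x i * x j / v ^ 2) (-(2 * (x i * x j) / v ^ 3)) v := by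
      have := (((hasDerivAt_id v).pow 2).inv (by simp; positivity)).const_mul (x i * x j)
      refine this.congr_deriv ?_
      simp
      field_simp
    split_ifs
    · have a2 : HasDerivAt (fun v : ℝ => 1 / v) (-(1 / v ^ 2)) v := by
        have := hasDerivAt_inv hv.ne'
        simpa using this
      refine (a1.sub a2).congr_deriv (by ring)
    · simpa using a1
  exact h1.mul (hk_dv hv x)

theorem kt_bound {v : ℝ} (hv : 0 < v) (i j : Fin d) (x : Fin d → ℝ) :
    |kt v i j x| ≤ (4 + d) * cB d * (v ^ 2)⁻¹ * hk (2 * v) x := by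
  have hq : 0 ≤ sq x / v := div_nonneg (sq_nn x) hv.le
  have h0 := hk_nonneg v x
  have p := hk_poly hv x
  have b2 := kk_bound hv i j x
  have c2 : |x i * x j| ≤ v * (sq x / v) := by
    rw [mul_div_cancel₀ _ hv.ne']; exact coord_mul x i j
  have e2 : kt v i j x = (-(2 * (x i * x j) / v ^ 3) + (if i = j then 1 / v ^ 2 else 0)) * hk v x
    + kk v i j x * ((sq x / v / 2 - d / 2) * v⁻¹) := by unfold kt kk; ring
  set q := sq x / v
  rw [e2]
  have t1 : |(-(2 * (x i * x j) / v ^ 3) + (if i = j then 1 / v ^ 2 else 0)) * hk v x| ≤ (v ^ 2)⁻¹ * (2 * q + 1) * hk v x := by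
    rw [abs_mul, abs_of_nonneg h0]
    gcongr
    refine (abs_add_le _ _).trans ?_
    rw [abs_neg, abs_div, abs_mul, abs_two, abs_of_pos (by positivity : 0 < v ^ 3), mul_add]
    refine add_le_add ?_ ?_
    · rw [div_le_iff₀ (by positivity)]
      calc 2 * |x i * x j| ≤ 2 * (v * q) := by gcongr
        _ = _ := by field_simp
    · split_ifs
      · simp
      · simp; positivity
  have t2 : |kk v i j x * ((q / 2 - d / 2) * v⁻¹)| ≤ v⁻¹ * ((1 + q) * hk v x) * ((q / 2 + d / 2) * v⁻¹) := by
    rw [abs_mul]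
    gcongr
    rw [abs_mul, abs_of_pos (by positivity : 0 < v⁻¹)]
    gcongr
    refine (abs_sub _ _).trans ?_
    rw [abs_of_nonneg (by positivity), abs_of_nonneg (by positivity)]
  refine (abs_add_le _ _).trans ((add_le_add t1 t2).trans ?_)
  calc (v ^ 2)⁻¹ * (2 * q + 1) * hk v x + v⁻¹ * ((1 + q) * hk v x) * ((q / 2 + d / 2) * v⁻¹)
      = (v ^ 2)⁻¹ * (((2 * q + 1) + (1 + q) * (q / 2 + d / 2)) * hk v x) := by field_simp
    _ ≤ (v ^ 2)⁻¹ * ((4 + d) * (cB d * hk (2 * v) x)) := by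
        refine mul_le_mul_of_nonneg_left ?_ (by positivity)
        refine le_trans ?_ (mul_le_mul_of_nonneg_left p (by positivity : (0:ℝ) ≤ 4 + d))
        rw [← mul_assoc]
        gcongr
        have : (0:ℝ) ≤ d := by positivity
        nlinarith [mul_nonneg this hq, mul_nonneg this (mul_nonneg hq hq), mul_nonneg hq hq]
    _ = _ := by ring

theorem hk_cont_max {v : ℝ} (hv : 0 < v) : Continuous fun z : ℝ × (Fin d → ℝ) => hk (2 * max v z.1) z.2 := by
  unfold hk
  have h1 : ∀ z : ℝ × (Fin d → ℝ), 0 < max v z.1 := fun z => lt_max_of_lt_left hv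
  refine Continuous.mul (Continuous.pow (Continuous.inv₀ (by fun_prop) fun z => ?_) d) (Continuous.rexp (Continuous.div (by fun_prop) (by fun_prop) fun z => ?_))
  · have := h1 z; positivity
  · have := h1 z; positivity

/-- time regularity of the kernel in `L¹` -/
theorem kk_time {v v' : ℝ} (hv : 0 < v) (h : v ≤ v') (i j : Fin d) :
    ∫⁻ x, ‖kk v' i j x - kk v i j x‖ₑ ≤ ENNReal.ofReal ((v' - v) * ((4 + d) * cB d * (v ^ 2)⁻¹)) := by
  have hcB := cB_pos d
  refine L1diff (φ := fun θ x => kk θ i j x) (φ' := fun θ x => kt θ i j x)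
    (G := fun θ x => (4 + d) * cB d * (v ^ 2)⁻¹ * hk (2 * max v θ) x) h ?_ ?_ ?_ ?_
  · intro x θ hθ
    exact kk_dv (hv.trans_le hθ.1) i j x
  · exact continuous_const.mul (hk_cont_max hv)
  · intro θ hθ x
    have hθ0 := hv.trans_le hθ.1
    rw [max_eq_right hθ.1]
    refine (kt_bound hθ0 i j x).trans ?_
    have := hk_nonneg (2 * θ) x
    have := hθ.1
    gcongr
  · intro θ
    exact (hk_lint (by have := lt_max_of_lt_left (b := v) (c := θ) hv; positivity) _ (by positivity)).le

/-- size and first moment of the kernel -/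
theorem kk_lint {v : ℝ} (hv : 0 < v) (i j : Fin d) : ∫⁻ x, ‖kk v i j x‖ₑ ≤ ENNReal.ofReal (cB d * v⁻¹) := by
  have hcB := cB_pos d
  rw [← hk_lint (d := d) (v := 2 * v) (by positivity) (cB d * v⁻¹) (by positivity)]
  refine lintegral_mono fun x => ?_
  rw [← ofReal_norm_eq_enorm]
  refine ENNReal.ofReal_le_ofReal ((kk_bound' hv i j x).trans (le_of_eq (by ring)))

theorem kk_tail {v : ℝ} (hv : 0 < v) (i j : Fin d) {L : ℝ} (hL : 0 < L) :
    ∫⁻ x in {x | L ≤ ‖x‖}, ‖kk v i j x‖ₑ ≤ ENNReal.ofReal (2 * cB d * L⁻¹ * (√v)⁻¹) := by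
  have hcB := cB_pos d
  rw [← hk_lint (d := d) (v := 2 * v) (by positivity) (2 * cB d * L⁻¹ * (√v)⁻¹) (by positivity)]
  rw [← lintegral_indicator (measurableSet_le measurable_const measurable_norm)]
  refine lintegral_mono fun x => ?_
  by_cases hx : L ≤ ‖x‖
  · rw [indicator_of_mem (by exact hx), ← ofReal_norm_eq_enorm]
    refine ENNReal.ofReal_le_ofReal ?_
    have hq : 0 ≤ sq x / v := div_nonneg (sq_nn x) hv.le
    have h0 := hk_nonneg v x
    have p := hk_poly hv x
    have b := kk_bound hv i j x
    have hs : √v ≠ 0 := by positivity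
    have n1 : ‖x‖ ≤ √v * (1 + sq x / v) := by
      have h1 : ‖x‖ = √v * |‖x‖ / √v| := by
        rw [abs_of_nonneg (by positivity)]; field_simp
      rw [h1]
      gcongr
      refine (abs_le_one_add_sq _).trans ?_
      rw [div_pow, Real.sq_sqrt hv.le]
      gcongr
      exact norm_sq_le x
    set q := sq x / v
    have n2 : 1 ≤ L⁻¹ * (√v * (1 + q)) := by
      calc 1 = L⁻¹ * L := (inv_mul_cancel₀ hL.ne').symm
        _ ≤ _ := mul_le_mul_of_nonneg_left (hx.trans n1) (by positivity)
    calc ‖kk v i j x‖ ≤ v⁻¹ * ((1 + q) * hk v x) := b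
      _ ≤ (v⁻¹ * ((1 + q) * hk v x)) * (L⁻¹ * (√v * (1 + q))) := le_mul_of_one_le_right (by positivity) n2
      _ = L⁻¹ * (√v)⁻¹ * ((1 + q) ^ 2 * hk v x) := by
          have : v⁻¹ * √v = (√v)⁻¹ := by
            field_simp; rw [Real.sq_sqrt hv.le]
          rw [← this]; ring
      _ ≤ L⁻¹ * (√v)⁻¹ * (2 * (cB d * hk (2 * v) x)) := by
          refine mul_le_mul_of_nonneg_left ?_ (by positivity)
          refine le_trans ?_ (mul_le_mul_of_nonneg_left p (by norm_num : (0:ℝ) ≤ 2))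
          rw [← mul_assoc]
          gcongr
          nlinarith
      _ = _ := by ring
  · rw [indicator_of_notMem (by exact hx)]; exact bot_le

end MR

end

section

namespace MR
open ProbabilityTheory Matrix Filter Topology

variable {d : ℕ} {P : ℝ≥0∞} [Fact (1 ≤ P)] [Fact (P ≠ ∞)]

instance fact_two_ne_top : Fact ((2 : ℝ≥0∞) ≠ ∞) := ⟨by norm_num⟩

/-- `L¹` norms via lower integrals -/
theorem L1_of_lint {k : (Fin d → ℝ) → ℝ} {M : ℝ} (hk : AEStronglyMeasurable k volume) (hM : 0 ≤ M) (h : ∫⁻ x, ‖k x‖ₑ ≤ ENNReal.ofReal M) :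
    ∫ x, ‖k x‖ ≤ M := by
  rw [integral_norm_eq_lintegral_enorm hk]
  exact ENNReal.toReal_le_of_le_ofReal hM h

theorem Kop_time {v v' : ℝ} (hv : 0 < v) (h : v ≤ v') (i j : Fin d) (g : LP P d) :
    ‖Kop v' i j g - Kop v i j g‖ ≤ (v' - v) * ((4 + d) * cB d * (v ^ 2)⁻¹) * ‖g‖ := by
  have := cB_pos d
  refine (cv_sub_norm (kk_int (hv.trans_le h) i j) (kk_int hv i j) g).trans ?_
  refine mul_le_mul_of_nonneg_right ?_ (norm_nonneg _)
  exact L1_of_lint (k := fun y => kk v' i j y - kk v i j y) ((kk_cont _ _ _).sub (kk_cont _ _ _)).aestronglyMeasurable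
    (by have : 0 ≤ v' - v := by linarith
        positivity) (kk_time hv h i j)

theorem Kop_cont2 {η : ℝ} (hη : 0 < η) (i j : Fin d) : Continuous fun z : ℝ × LP P d => Kop (max η z.1) i j z.2 := by
  have hc := cB_pos d
  set L := (4 + d) * cB d * (η ^ 2)⁻¹ with hL
  have hLn : 0 ≤ L := by positivity
  have h1 : ∀ v v' : ℝ, η ≤ v → v ≤ v' → ∀ g : LP P d, ‖Kop v' i j g - Kop v i j g‖ ≤ L * (v' - v) * ‖g‖ := by
    intro v v' h1 h2 g
    refine (Kop_time (hη.trans_le h1) h2 i j g).trans ?_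
    refine mul_le_mul_of_nonneg_right ?_ (norm_nonneg _)
    rw [mul_comm]
    refine mul_le_mul_of_nonneg_right ?_ (by linarith)
    rw [hL]; gcongr
  have h2 : ∀ v v' : ℝ, η ≤ v → η ≤ v' → ∀ g : LP P d, ‖Kop v' i j g - Kop v i j g‖ ≤ L * |v' - v| * ‖g‖ := by
    intro v v' a b g
    rcases le_total v v' with h | h
    · rw [abs_of_nonneg (by linarith)]; exact h1 v v' a h g
    · rw [abs_sub_comm, norm_sub_rev, abs_of_nonneg (by linarith)]; exact h1 v' v b h g
  rw [continuous_iff_continuousAt]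
  rintro ⟨r, g⟩
  rw [ContinuousAt, tendsto_iff_norm_sub_tendsto_zero]
  have lim : Tendsto (fun z : ℝ × LP P d => L * |max η z.1 - max η r| * ‖g‖ + cB d / η * ‖z.2 - g‖) (𝓝 (r, g)) (𝓝 0) := by
    have : Continuous fun z : ℝ × LP P d => L * |max η z.1 - max η r| * ‖g‖ + cB d / η * ‖z.2 - g‖ := by fun_prop
    simpa using this.tendsto (r, g)
  refine squeeze_zero (fun _ => norm_nonneg _) (fun z => ?_) lim
  have e : Kop (max η z.1) i j z.2 - Kop (max η r) i j g =
      (Kop (max η z.1) i j g - Kop (max η r) i j g) + Kop (max η z.1) i j (z.2 - g) := by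
    rw [map_sub]; abel
  show ‖Kop (max η z.1) i j z.2 - Kop (max η r) i j g‖ ≤ _
  rw [e]
  refine (norm_add_le _ _).trans (add_le_add (h2 _ _ (le_max_left _ _) (le_max_left _ _) g) ?_)
  refine (Kop_norm (hη.trans_le (le_max_left _ _)) i j _).trans ?_
  gcongr
  exact le_max_left _ _

/-- first-order operators -/
def A1 (v : ℝ) (i : Fin d) : LP P d →L[ℝ] LP P d := cv (hk1 v i)

theorem pr_A1 {φ : (Fin d → ℝ) → ℝ} (h : Test φ) {v : ℝ} (hv : 0 < v) (i : Fin d) (g : LP P d) :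
    prL φ (A1 v i g) = prL (pd i φ) (Gam (v • (1 : Matrix (Fin d) (Fin d) ℝ)) g) := by
  rw [Gam_eq_cv hv, A1, pr_cv _ (hk1_int hv i)]
  have e2 := ibp h g i (k := hk v) (hk_int hv).1 (by rw [pd_hk]; exact hk1_int hv i)
    (fun x => (hk_fd v x).differentiableAt)
  rw [pd_hk] at e2
  exact e2

theorem A1_A1 {v : ℝ} (hv : 0 < v) (i j : Fin d) (g : LP P d) : A1 v i (A1 v j g) = Kop (v + v) i j g := by
  refine LP_ext fun φ h => ?_
  rw [pr_A1 h hv, A1, ← cv_Gam, ← A1, pr_A1 (h.pd i) hv, Kop, kk_symm, ← Kop, pr_Kop h (by linarith), add_smul,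
    Gam_add (smul_one_psd hv.le) (smul_one_psd hv.le)]

theorem A1_norm {v : ℝ} (hv : 0 < v) (i : Fin d) (g : LP P d) : ‖A1 v i g‖ ≤ cB d / √v * ‖g‖ := by
  refine (cv_norm_le (hk1_int hv i) g).trans ?_
  refine mul_le_mul_of_nonneg_right ?_ (norm_nonneg _)
  have h := hk_int (d := d) (by linarith : 0 < 2 * v)
  calc ∫ x, ‖hk1 v i x‖ ≤ ∫ x, (√v)⁻¹ * (cB d * hk (2 * v) x) :=
        integral_mono (hk1_int hv i).norm ((h.1.const_mul (cB d)).const_mul (√v)⁻¹) (hk1_bound' hv i)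
    _ = _ := by rw [integral_const_mul, integral_const_mul, h.2]; ring

theorem inner_cv {k : (Fin d → ℝ) → ℝ} (hk : Integrable k) (f g : LP 2 d) :
    inner ℝ (cv k f) g = inner ℝ f (cv (fun y => k (-y)) g) := by
  have hk' : Integrable fun y => k (-y) := hk.comp_neg
  rw [cv_apply hk, cv_apply hk', ← integral_inner (cv_int hk' g), real_inner_comm, ← integral_inner (cv_int hk f)]
  rw [← integral_neg_eq_self]
  refine integral_congr_ae (Eventually.of_forall fun y => ?_)
  simp only [inner_smul_right]
  congr 1
  have := (tr (P := 2) (-y)).inner_map_map f (tr y g)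
  rw [tr_tr, neg_add_cancel, tr_zero] at this
  rw [real_inner_comm, this]

theorem inner_A1 {v : ℝ} (hv : 0 < v) (i : Fin d) (f g : LP 2 d) : inner ℝ (A1 v i f) g = - inner ℝ f (A1 v i g) := by
  rw [A1, inner_cv (hk1_int hv i)]
  have : (fun y => hk1 v i (-y)) = fun y => - hk1 v i y := by
    ext y; simp [hk1, hk]; ring
  rw [this, cv_apply (k := fun y => - hk1 v i y) (hk1_int hv i).neg, cv_apply (hk1_int hv i)]
  simp [integral_neg, inner_neg_right]

/-- heat coefficients -/
def bH (d : ℕ) (R : ℝ) (t : ℝ) (i j : Fin d) : ℝ := (Ioc 0 R).indicator (fun _ => if i = j then 1 / 2 else 0) t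

theorem bH_coef (R : ℝ) : Coef (bH d R) where
  int i j := by
    unfold bH
    rw [integrable_indicator_iff measurableSet_Ioc]
    exact integrableOn_const (by simp)
  sym t i j := by unfold bH; simp [eq_comm]
  psd t ξ := by
    unfold bH
    by_cases h : t ∈ Ioc 0 R
    · simp only [indicator_of_mem h]
      simp only [ite_mul, zero_mul, Finset.sum_ite_eq, Finset.mem_univ, if_true]
      exact Finset.sum_nonneg fun i _ => by nlinarith [sq_nonneg (ξ i)]
    · simp [indicator_of_notMem h]

theorem CC_bH {R t : ℝ} (h0 : 0 ≤ t) (hR : t ≤ R) : CC (bH d R) 0 t = t • (1 : Matrix (Fin d) (Fin d) ℝ) := by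
  ext i j
  simp only [CC, Matrix.of_apply, Matrix.smul_apply, Matrix.one_apply, smul_eq_mul]
  rw [intervalIntegral.integral_of_le h0]
  rw [setIntegral_congr_fun (g := fun _ => if i = j then (1:ℝ) else 0) measurableSet_Ioc]
  · simp [h0]
  · intro r hr
    simp only [bH]
    rw [indicator_of_mem (show r ∈ Ioc 0 R from ⟨hr.1, hr.2.trans hR⟩)]
    split_ifs <;> norm_num

theorem heat_int {η R : ℝ} (hη : 0 < η) (hR : 0 ≤ R) (g : LP P d) :
    Gam ((R + η) • (1 : Matrix (Fin d) (Fin d) ℝ)) g - Gam (η • (1 : Matrix (Fin d) (Fin d) ℝ)) g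
      = ∫ r in (0:ℝ)..R, (1 / 2 : ℝ) • ∑ i, Kop (max η (r + η)) i i g := by
  have hc : Continuous fun r : ℝ => (1 / 2 : ℝ) • ∑ i, Kop (P := P) (max η (r + η)) i i g := by
    refine Continuous.fun_const_smul (continuous_finset_sum _ fun i _ => ?_) _
    exact (Kop_cont2 hη i i).comp (g := fun z : ℝ × LP P d => Kop (max η z.1) i i z.2) (f := fun r : ℝ => (r + η, g)) (by fun_prop)
  refine LP_ext fun φ h => ?_
  rw [← ContinuousLinearMap.intervalIntegral_comp_comm _ (hc.intervalIntegrable _ _)]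
  have h1 := (bH_coef R).UU_weak h (Gam (η • (1 : Matrix (Fin d) (Fin d) ℝ)) g) hR
  have hU : ∀ r, 0 ≤ r → r ≤ R → UU (bH d R) 0 r (Gam (η • (1 : Matrix (Fin d) (Fin d) ℝ)) g) = Gam ((r + η) • (1 : Matrix (Fin d) (Fin d) ℝ)) g := by
    intro r h0 hr
    rw [UU, min_eq_left h0, CC_bH h0 hr, add_smul, Gam_add (smul_one_psd h0) (smul_one_psd hη.le)]
  rw [hU R hR le_rfl] at h1
  rw [map_sub, h1, add_sub_cancel_left, intervalIntegral.integral_of_le hR, intervalIntegral.integral_of_le hR]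
  refine setIntegral_congr_fun measurableSet_Ioc fun r hr => ?_
  rw [hU r hr.1.le hr.2, max_eq_right (by linarith [hr.1]), map_smul, map_sum, WW, Finset.smul_sum]
  refine Finset.sum_congr rfl fun i _ => ?_
  rw [Finset.sum_eq_single i]
  · rw [pr_Kop h (by linarith [hr.1]), bH, indicator_of_mem hr]; simp
  · intro j _ hj
    rw [bH, indicator_of_mem hr, if_neg hj.symm, zero_mul]
  · simp

theorem A1_sq {v : ℝ} (hv : 0 < v) (i : Fin d) (g : LP 2 d) : ‖A1 v i g‖ ^ 2 = - inner ℝ (Kop (v + v) i i g) g := by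
  rw [← A1_A1 hv, inner_A1 hv, neg_neg, real_inner_self_eq_norm_sq]

theorem energy {η R : ℝ} (hη : 0 < η) (hR : 0 ≤ R) (i : Fin d) (g : LP 2 d) :
    ∫ r in (0:ℝ)..R, (- inner ℝ (Kop (max η (r + η)) i i g) g) ≤ 4 * ‖g‖ ^ 2 := by
  have hcK : ∀ i : Fin d, Continuous fun r : ℝ => Kop (P := 2) (max η (r + η)) i i g := fun i =>
    (Kop_cont2 hη i i).comp (g := fun z : ℝ × LP 2 d => Kop (max η z.1) i i z.2) (f := fun r : ℝ => (r + η, g)) (by fun_prop)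
  have hc : Continuous fun r : ℝ => (1 / 2 : ℝ) • ∑ i, Kop (P := 2) (max η (r + η)) i i g :=
    Continuous.fun_const_smul (continuous_finset_sum _ fun i _ => hcK i) _
  have hq : ∀ i, Continuous fun r : ℝ => - inner ℝ (Kop (P := 2) (max η (r + η)) i i g) g := fun i => ((hcK i).inner continuous_const).neg
  have h1 := heat_int hη hR g
  have h2 := congrArg (fun z => (innerSL ℝ g) z) h1
  rw [← ContinuousLinearMap.intervalIntegral_comp_comm _ (hc.intervalIntegrable _ _)] at h2
  have nn : ∀ i r, 0 ≤ - inner ℝ (Kop (P := 2) (max η (r + η)) i i g) g := by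
    intro i r
    have hp : 0 < max η (r + η) / 2 := by have := hη.trans_le (le_max_left η (r + η)); positivity
    have := A1_sq hp i g
    rw [add_halves] at this
    rw [← this]; positivity
  have h3 : ∫ r in (0:ℝ)..R, (- inner ℝ (Kop (P := 2) (max η (r + η)) i i g) g) ≤
      ∫ r in (0:ℝ)..R, (-2 : ℝ) * (innerSL ℝ g) ((1 / 2 : ℝ) • ∑ i, Kop (P := 2) (max η (r + η)) i i g) := by
    refine intervalIntegral.integral_mono_on hR ((hq i).intervalIntegrable _ _) ?_ ?_
    · exact ((((innerSL ℝ g).continuous.comp hc)).const_mul _).intervalIntegrable _ _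
    · intro r _
      rw [map_smul, map_sum, smul_eq_mul]
      have : (-2:ℝ) * (1 / 2 * ∑ i, (innerSL ℝ g) (Kop (P := 2) (max η (r + η)) i i g)) = ∑ i, - inner ℝ (Kop (P := 2) (max η (r + η)) i i g) g := by
        rw [← mul_assoc, Finset.mul_sum]
        refine Finset.sum_congr rfl fun i _ => ?_
        rw [innerSL_apply_apply, real_inner_comm]; ring
      rw [this]
      exact Finset.single_le_sum (f := fun i => - inner ℝ (Kop (P := 2) (max η (r + η)) i i g) g) (fun i _ => nn i r) (Finset.mem_univ i)
  refine h3.trans ?_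
  rw [intervalIntegral.integral_const_mul, ← h2, innerSL_apply_apply, inner_sub_right]
  have e1 := abs_real_inner_le_norm g (Gam ((R + η) • (1 : Matrix (Fin d) (Fin d) ℝ)) g)
  have e2 := abs_real_inner_le_norm g (Gam (η • (1 : Matrix (Fin d) (Fin d) ℝ)) g)
  have e3 := Gam_norm_le ((R + η) • (1 : Matrix (Fin d) (Fin d) ℝ)) g
  have e4 := Gam_norm_le (η • (1 : Matrix (Fin d) (Fin d) ℝ)) g
  rw [abs_le] at e1 e2
  nlinarith [norm_nonneg g, mul_le_mul_of_nonneg_left e3 (norm_nonneg g), mul_le_mul_of_nonneg_left e4 (norm_nonneg g)]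

end MR

end

section

namespace MR
open ProbabilityTheory Matrix Filter Topology

variable {d : ℕ} {P : ℝ≥0∞} [Fact (1 ≤ P)] [Fact (P ≠ ∞)]

/-- dissipation -/
def qq (η : ℝ) (i : Fin d) (r : ℝ) (g : LP 2 d) : ℝ := - inner ℝ (Kop (max η (r + η)) i i g) g

theorem qq_eq {η : ℝ} (hη : 0 < η) (i : Fin d) (r : ℝ) (g : LP 2 d) : qq η i r g = ‖A1 (max η (r + η) / 2) i g‖ ^ 2 := by
  have hp : 0 < max η (r + η) / 2 := by have := hη.trans_le (le_max_left η (r + η)); positivity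
  have := A1_sq hp i g
  rw [add_halves] at this
  rw [this]; rfl

theorem qq_cont {η : ℝ} (hη : 0 < η) (i : Fin d) : Continuous fun z : ℝ × LP 2 d => qq η i z.1 z.2 := by
  unfold qq
  have := (Kop_cont2 (P := 2) hη i i).comp (g := fun z : ℝ × LP 2 d => Kop (max η z.1) i i z.2) (f := fun z : ℝ × LP 2 d => (z.1 + η, z.2)) (by fun_prop)
  exact (this.inner continuous_snd).neg

theorem qq_nn {η : ℝ} (hη : 0 < η) (i : Fin d) (r : ℝ) (g : LP 2 d) : 0 ≤ qq η i r g := by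
  rw [qq_eq hη]; positivity

theorem Kop_qq {η : ℝ} (hη : 0 < η) (i j : Fin d) (r : ℝ) (f g : LP 2 d) :
    inner ℝ (Kop (max η (r + η)) i j f) g ≤ 4 * qq η j r f + qq η i r g / 16 := by
  have hp : 0 < max η (r + η) / 2 := by have := hη.trans_le (le_max_left η (r + η)); positivity
  rw [qq_eq hη, qq_eq hη]
  have h1 := A1_A1 hp i j f
  rw [add_halves] at h1
  rw [← h1, inner_A1 hp]
  have h2 := abs_real_inner_le_norm (A1 (max η (r + η) / 2) j f) (A1 (max η (r + η) / 2) i g)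
  rw [abs_le] at h2
  nlinarith [sq_nonneg (8 * ‖A1 (max η (r + η) / 2) j f‖ - ‖A1 (max η (r + η) / 2) i g‖)]

/-- extended dissipation density -/
def JJ (η : ℝ) (i : Fin d) (r : ℝ) (g : LP 2 d) : ℝ≥0∞ := (Ici (0:ℝ)).indicator (fun r => ENNReal.ofReal (qq η i r g)) r

theorem JJ_meas {η : ℝ} (hη : 0 < η) (i : Fin d) {F : ℝ → LP 2 d} (hF : Continuous F) :
    Measurable fun z : ℝ × ℝ => JJ η i (z.1 - z.2) (F z.2) := by
  have h0 : Continuous fun z : ℝ × ℝ => qq η i (z.1 - z.2) (F z.2) :=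
    (qq_cont hη i).comp (g := fun z : ℝ × LP 2 d => qq η i z.1 z.2) (f := fun z : ℝ × ℝ => (z.1 - z.2, F z.2)) (by fun_prop)
  exact h0.measurable.ennreal_ofReal.indicator (s := {z : ℝ × ℝ | z.1 - z.2 ∈ Ici (0:ℝ)}) ((measurable_fst.sub measurable_snd) measurableSet_Ici)

theorem ofReal_int_le {α : Type*} [MeasurableSpace α] {μ : Measure α} (f : α → ℝ) :
    ENNReal.ofReal (∫ x, f x ∂μ) ≤ ∫⁻ x, ENNReal.ofReal (f x) ∂μ := by
  by_cases hf : Integrable f μ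
  · rw [integral_eq_lintegral_pos_part_sub_lintegral_neg_part hf]
    refine (ENNReal.ofReal_le_ofReal (sub_le_self _ ENNReal.toReal_nonneg)).trans ENNReal.ofReal_toReal_le
  · rw [integral_undef hf]; simp

theorem JJ_int {η : ℝ} (hη : 0 < η) (i : Fin d) (g : LP 2 d) : ∫⁻ r, JJ η i r g ≤ ENNReal.ofReal (4 * ‖g‖ ^ 2) := by
  have hq : Continuous fun r => qq η i r g := (qq_cont hη i).comp (g := fun z : ℝ × LP 2 d => qq η i z.1 z.2) (f := fun r => (r, g)) (by fun_prop)
  have hb : ∀ R : ℝ, 0 ≤ R → ∫ r in (0:ℝ)..R, qq η i r g ≤ 4 * ‖g‖ ^ 2 := fun R hR => energy hη hR i g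
  have h1 : IntegrableOn (fun r => qq η i r g) (Ioi 0) := by
    refine integrableOn_Ioi_of_intervalIntegral_norm_bounded (4 * ‖g‖ ^ 2) 0 (b := fun n : ℕ => (n:ℝ)) (l := atTop) ?_ tendsto_natCast_atTop_atTop ?_
    · intro n; exact hq.integrableOn_Ioc
    · refine Eventually.of_forall fun n => ?_
      simp_rw [Real.norm_of_nonneg (qq_nn hη i _ g)]
      exact hb n (by positivity)
  have h2 : ∫ r in Ioi 0, qq η i r g ≤ 4 * ‖g‖ ^ 2 := by
    refine le_of_tendsto (intervalIntegral_tendsto_integral_Ioi 0 h1 tendsto_id) ?_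
    filter_upwards [eventually_ge_atTop 0] with R hR using hb R hR
  unfold JJ
  rw [lintegral_indicator measurableSet_Ici, setLIntegral_congr Ioi_ae_eq_Ici.symm,
    ← ofReal_integral_eq_lintegral_ofReal h1 (Eventually.of_forall fun r => qq_nn hη i r g)]
  exact ENNReal.ofReal_le_ofReal h2

/-- the singular integral operator (regularized by `η`) on vector valued functions -/
def HW (η : ℝ) (i j : Fin d) (F : ℝ → LP P d) (t : ℝ) : LP P d := ∫ s in Iic t, Kop (max η (t - s + η)) i j (F s)

theorem HW_int {η : ℝ} (hη : 0 < η) (i j : Fin d) {F : ℝ → LP P d} (hF : Integrable F) (t : ℝ) :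
    Integrable fun s => Kop (max η (t - s + η)) i j (F s) := by
  refine Integrable.mono' (hF.norm.const_mul (cB d / η)) ?_ (Eventually.of_forall fun s => ?_)
  · exact (Kop_cont2 hη i j).comp_aestronglyMeasurable (g := fun z : ℝ × LP P d => Kop (max η z.1) i j z.2) (f := fun s : ℝ => (t - s + η, F s))
      ((by fun_prop : Continuous fun s : ℝ => t - s + η).aestronglyMeasurable.prodMk hF.1)
  · refine (Kop_norm (hη.trans_le (le_max_left _ _)) i j _).trans ?_
    have := cB_pos d
    gcongr
    exact le_max_left _ _

theorem HW_L2 {η : ℝ} (hη : 0 < η) (i j : Fin d) {F : ℝ → LP 2 d} (hF : Continuous F) (hFi : Integrable F) :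
    ∫⁻ t, ‖HW η i j F t‖ₑ ^ 2 ≤ 64 * ∫⁻ s, ‖F s‖ₑ ^ 2 := by
  have h1 : ∀ t, ‖HW η i j F t‖ₑ ^ 2 ≤ 16 * ∫⁻ s, JJ η j (t - s) (F s) := by
    intro t
    set w := HW η i j F t with hw
    have e1 : ‖w‖ ^ 2 = ∫ s in Iic t, inner ℝ (Kop (max η (t - s + η)) i j (F s)) w := by
      rw [← real_inner_self_eq_norm_sq]
      nth_rw 2 [hw]
      rw [HW, ← integral_inner (HW_int hη i j hFi t).integrableOn]
      exact integral_congr_ae (Eventually.of_forall fun s => real_inner_comm _ _)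
    have e2 : ENNReal.ofReal (‖w‖ ^ 2) ≤ ∫⁻ s in Iic t, ENNReal.ofReal (inner ℝ (Kop (max η (t - s + η)) i j (F s)) w) := by
      rw [e1]; exact ofReal_int_le _
    have e3 : ∫⁻ s in Iic t, ENNReal.ofReal (inner ℝ (Kop (max η (t - s + η)) i j (F s)) w) ≤
        ∫⁻ s, (4 * JJ η j (t - s) (F s) + JJ η i (t - s) w / 16) := by
      rw [← lintegral_indicator measurableSet_Iic]
      refine lintegral_mono fun s => ?_
      by_cases hs : s ≤ t
      · rw [indicator_of_mem (by exact hs), JJ, JJ, indicator_of_mem (by simpa using hs), indicator_of_mem (by simpa using hs)]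
        refine (ENNReal.ofReal_le_ofReal (Kop_qq hη i j (t - s) (F s) w)).trans ?_
        rw [ENNReal.ofReal_add (by have := qq_nn hη j (t - s) (F s); positivity) (by have := qq_nn hη i (t - s) w; positivity),
          ENNReal.ofReal_mul (by norm_num), ENNReal.ofReal_div_of_pos (by norm_num)]
        simp
      · rw [indicator_of_notMem (by exact hs)]; exact bot_le
    have m1 : Measurable fun s => JJ η j (t - s) (F s) :=
      (JJ_meas hη j hF).comp (g := fun z : ℝ × ℝ => JJ η j (z.1 - z.2) (F z.2)) (f := fun s : ℝ => (t, s)) (by fun_prop)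
    have e4 : ∫⁻ s, JJ η i (t - s) w / 16 ≤ ENNReal.ofReal (‖w‖ ^ 2 / 4) := by
      rw [lintegral_sub_left_eq_self (fun r => JJ η i r w / 16) t]
      simp_rw [div_eq_mul_inv]
      rw [lintegral_mul_const' _ _ (by simp)]
      calc _ ≤ ENNReal.ofReal (4 * ‖w‖ ^ 2) * 16⁻¹ := by gcongr; exact JJ_int hη i w
        _ = _ := by
          rw [← div_eq_mul_inv, show (16 : ℝ≥0∞) = ENNReal.ofReal 16 by simp, ← ENNReal.ofReal_div_of_pos (by norm_num)]
          congr 1; ring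
    rw [lintegral_add_left (m1.const_mul 4), lintegral_const_mul _ m1] at e3
    have e5 : ENNReal.ofReal (‖w‖ ^ 2 / 4) + ENNReal.ofReal (3 * ‖w‖ ^ 2 / 4) ≤ ENNReal.ofReal (‖w‖ ^ 2 / 4) + 4 * ∫⁻ s, JJ η j (t - s) (F s) := by
      rw [← ENNReal.ofReal_add (by positivity) (by positivity)]
      rw [show ‖w‖ ^ 2 / 4 + 3 * ‖w‖ ^ 2 / 4 = ‖w‖ ^ 2 by ring, add_comm]
      exact e2.trans (e3.trans (by gcongr))
    have e6 := (ENNReal.add_le_add_iff_left ENNReal.ofReal_ne_top).1 e5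
    calc ‖w‖ₑ ^ 2 = ENNReal.ofReal (‖w‖ ^ 2) := by rw [← ofReal_norm_eq_enorm, ENNReal.ofReal_pow (norm_nonneg _)]
      _ ≤ ENNReal.ofReal (4 * (3 * ‖w‖ ^ 2 / 4)) := ENNReal.ofReal_le_ofReal (by nlinarith [sq_nonneg ‖w‖])
      _ = 4 * ENNReal.ofReal (3 * ‖w‖ ^ 2 / 4) := by rw [ENNReal.ofReal_mul (by norm_num)]; simp
      _ ≤ 4 * (4 * ∫⁻ s, JJ η j (t - s) (F s)) := by gcongr
      _ = _ := by rw [← mul_assoc]; norm_num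
  have m2 : Measurable fun z : ℝ × ℝ => JJ η j (z.1 - z.2) (F z.2) :=
    JJ_meas hη j hF
  calc ∫⁻ t, ‖HW η i j F t‖ₑ ^ 2 ≤ ∫⁻ t, 16 * ∫⁻ s, JJ η j (t - s) (F s) := lintegral_mono h1
    _ = 16 * ∫⁻ t, ∫⁻ s, JJ η j (t - s) (F s) := lintegral_const_mul' _ _ (by simp)
    _ = 16 * ∫⁻ s, ∫⁻ t, JJ η j (t - s) (F s) := by rw [lintegral_lintegral_swap m2.aemeasurable]
    _ ≤ 16 * ∫⁻ s, 4 * ‖F s‖ₑ ^ 2 := by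
        gcongr with s
        rw [lintegral_sub_right_eq_self (fun t => JJ η j t (F s)) s]
        refine (JJ_int hη j (F s)).trans (le_of_eq ?_)
        rw [ENNReal.ofReal_mul (by norm_num), ← ofReal_norm_eq_enorm, ENNReal.ofReal_pow (norm_nonneg _)]; simp
    _ = _ := by rw [lintegral_const_mul' _ _ (by simp), ← mul_assoc]; norm_num

end MR

end

section

namespace MR
open ProbabilityTheory Matrix Filter Topology

variable {d : ℕ}

/-- space-time -/
abbrev XX (d : ℕ) := ℝ × (Fin d → ℝ)

instance XX_haar : (volume : Measure (XX d)).IsAddHaarMeasure := by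
  rw [Measure.volume_eq_prod]; infer_instance

instance XX_negInv : (volume : Measure (XX d)).IsNegInvariant :=
  Measure.IsAddHaarMeasure.isNegInvariant_of_regular volume

theorem kk_neg (v : ℝ) (i j : Fin d) (x : Fin d → ℝ) : kk v i j (-x) = kk v i j x := by
  unfold kk hk; simp

/-- the space-time kernel -/
def KK (η : ℝ) (i j : Fin d) (z : XX d) : ℝ := if 0 ≤ z.1 then kk (max η (z.1 + η)) i j z.2 else 0

theorem KK_neg (η : ℝ) (i j : Fin d) (r : ℝ) (x : Fin d → ℝ) : KK η i j (r, -x) = KK η i j (r, x) := by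
  unfold KK; simp [kk_neg]

theorem kk_cont_max {η : ℝ} (hη : 0 < η) (i j : Fin d) : Continuous fun z : XX d => kk (max η (z.1 + η)) i j z.2 := by
  unfold kk hk
  have h1 : ∀ z : ℝ × (Fin d → ℝ), 0 < max η (z.1 + η) := fun z => lt_max_of_lt_left hη
  refine Continuous.mul (Continuous.sub (Continuous.div (by fun_prop) (by fun_prop) fun z => ?_) ?_)
    (Continuous.mul (Continuous.pow (Continuous.inv₀ (by fun_prop) fun z => ?_) d) (Continuous.rexp (Continuous.div (by fun_prop) (by fun_prop) fun z => ?_)))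
  · have := h1 z; positivity
  · split_ifs
    · exact Continuous.div (by fun_prop) (by fun_prop) fun z => (h1 z).ne'
    · exact continuous_const
  · have := h1 z; positivity
  · have := h1 z; positivity

theorem KK_meas {η : ℝ} (hη : 0 < η) (i j : Fin d) : Measurable (KK η i j) := by
  unfold KK
  exact Measurable.ite (measurableSet_le measurable_const measurable_fst) (kk_cont_max hη i j).measurable measurable_const

/-- sup bound for the kernel -/
def MK (η : ℝ) (d : ℕ) : ℝ := cB d * (√(2 * Real.pi * (2 * η)))⁻¹ ^ d

theorem MK_nn {η : ℝ} (d : ℕ) : 0 ≤ MK η d := by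
  have := cB_pos d
  unfold MK; positivity

theorem hk_le {η v : ℝ} (hη : 0 < η) (h : η ≤ v) (x : Fin d → ℝ) : hk v x ≤ (√(2 * Real.pi * η))⁻¹ ^ d := by
  unfold hk
  have h1 : Real.exp (-(∑ k, x k ^ 2) / (2 * v)) ≤ 1 := by
    rw [Real.exp_le_one_iff]
    have : 0 ≤ ∑ k, x k ^ 2 := sq_nn x
    have hv := hη.trans_le h
    rw [neg_div]
    have : 0 ≤ (∑ k, x k ^ 2) / (2 * v) := by positivity
    linarith
  calc _ ≤ (√(2 * Real.pi * η))⁻¹ ^ d * 1 := by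
        have hv := hη.trans_le h
        gcongr
    _ = _ := mul_one _

theorem KK_bound {η : ℝ} (hη : 0 < η) (i j : Fin d) (z : XX d) : |KK η i j z| ≤ (max η (z.1 + η))⁻¹ * MK η d := by
  have hm : 0 < max η (z.1 + η) := lt_max_of_lt_left hη
  have hM := MK_nn (η := η) d
  unfold KK
  split_ifs
  · refine (kk_bound' hm i j z.2).trans ?_
    refine mul_le_mul_of_nonneg_left ?_ (by positivity)
    unfold MK
    refine mul_le_mul_of_nonneg_left ?_ (cB_pos d).le
    exact hk_le (by positivity) (by linarith [le_max_left η (z.1 + η)]) _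
  · simp; positivity

theorem KK_bdd {η : ℝ} (hη : 0 < η) (i j : Fin d) (z : XX d) : ‖KK η i j z‖ ≤ η⁻¹ * MK η d := by
  refine (KK_bound hη i j z).trans ?_
  have hM := MK_nn (η := η) d
  gcongr
  exact le_max_left _ _

theorem KK_L2 {η : ℝ} (hη : 0 < η) (i j : Fin d) : MemLp (KK η i j) 2 volume := by
  have hM := MK_nn (η := η) d
  have hcB := cB_pos d
  refine ⟨(KK_meas hη i j).aestronglyMeasurable, ?_⟩
  rw [eLpNorm_lt_top_iff_lintegral_rpow_enorm_lt_top (by norm_num) (by norm_num)]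
  have h1 : ∀ z : XX d, ‖KK η i j z‖ₑ ^ (2:ℝ≥0∞).toReal ≤ (Ici (0:ℝ)).indicator (fun r => ENNReal.ofReal ((r + η)⁻¹ * MK η d)) z.1 * ‖kk (max η (z.1 + η)) i j z.2‖ₑ := by
    intro z
    have e : (2:ℝ≥0∞).toReal = (2:ℕ) := by simp
    rw [e, ENNReal.rpow_natCast, pow_two]
    by_cases hz : 0 ≤ z.1
    · rw [indicator_of_mem (by exact hz)]
      have e2 : KK η i j z = kk (max η (z.1 + η)) i j z.2 := by unfold KK; rw [if_pos hz]
      have := KK_bound hη i j z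
      rw [max_eq_right (by linarith)] at this
      refine mul_le_mul' ?_ (by rw [e2])
      rw [← ofReal_norm_eq_enorm]
      exact ENNReal.ofReal_le_ofReal this
    · have e2 : KK η i j z = 0 := by unfold KK; rw [if_neg hz]
      rw [e2]; simp
  refine (lintegral_mono h1).trans_lt ?_
  rw [Measure.volume_eq_prod, lintegral_prod]
  · have h2 : ∀ r : ℝ, ∫⁻ y, (Ici (0:ℝ)).indicator (fun r => ENNReal.ofReal ((r + η)⁻¹ * MK η d)) r * ‖kk (max η (r + η)) i j y‖ₑ
        ≤ (Ici (0:ℝ)).indicator (fun r => ENNReal.ofReal (MK η d * cB d * (r + η) ^ (-2:ℝ))) r := by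
      intro r
      by_cases hr : 0 ≤ r
      · rw [indicator_of_mem (by exact hr), indicator_of_mem (by exact hr), lintegral_const_mul' _ _ ENNReal.ofReal_ne_top, max_eq_right (by linarith)]
        refine (mul_le_mul_right (kk_lint (by linarith) i j) _).trans ?_
        rw [← ENNReal.ofReal_mul (by positivity)]
        refine ENNReal.ofReal_le_ofReal (le_of_eq ?_)
        have hp : 0 < r + η := by linarith
        rw [Real.rpow_neg hp.le, Real.rpow_two]
        field_simp
      · rw [indicator_of_notMem (by exact hr), indicator_of_notMem (by exact hr)]; simp
    refine (lintegral_mono h2).trans_lt ?_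
    rw [lintegral_indicator measurableSet_Ici]
    have h3 : IntegrableOn (fun r : ℝ => MK η d * cB d * (r + η) ^ (-2:ℝ)) (Ici 0) := by
      rw [integrableOn_Ici_iff_integrableOn_Ioi]
      exact (integrableOn_add_rpow_Ioi_of_lt (by norm_num) (by linarith)).const_mul _
    exact (hasFiniteIntegral_iff_ofReal (by
      filter_upwards [ae_restrict_mem measurableSet_Ici] with r hr
      have : 0 < r + η := by have : 0 ≤ r := hr
                             linarith
      positivity)).1 h3.2
  · refine (Measurable.mul ?_ ?_).aemeasurable
    · have : Measurable ((Ici (0:ℝ)).indicator (fun r => ENNReal.ofReal ((r + η)⁻¹ * MK η d))) :=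
        Measurable.indicator (by fun_prop) measurableSet_Ici
      exact this.comp measurable_fst
    · exact (kk_cont_max hη i j).measurable.enorm

/-- the scalar singular integral operator -/
def TT (η : ℝ) (i j : Fin d) (h : XX d → ℝ) (x : XX d) : ℝ := ∫ z, KK η i j (x - z) * h z

theorem KK_sub_L2 {η : ℝ} (hη : 0 < η) (i j : Fin d) (x : XX d) : MemLp (fun z => KK η i j (x - z)) 2 volume :=
  (KK_L2 hη i j).comp_measurePreserving (Measure.measurePreserving_sub_left volume x)

theorem TT_int {η : ℝ} (hη : 0 < η) (i j : Fin d) {h : XX d → ℝ} (hh : MemLp h 2 volume) (x : XX d) :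
    Integrable (fun z => KK η i j (x - z) * h z) := (KK_sub_L2 hη i j x).integrable_mul hh

theorem TT_int1 {η : ℝ} (hη : 0 < η) (i j : Fin d) {h : XX d → ℝ} (hh : Integrable h) (x : XX d) :
    Integrable (fun z => KK η i j (x - z) * h z) :=
  hh.bdd_mul ((KK_meas hη i j).comp (measurable_const.sub measurable_id)).aestronglyMeasurable (Eventually.of_forall fun z => KK_bdd hη i j _)

theorem TT_meas {η : ℝ} (hη : 0 < η) (i j : Fin d) {h : XX d → ℝ} (hh : AEStronglyMeasurable h volume) : StronglyMeasurable (TT η i j h) := by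
  have e : TT η i j h = TT η i j (hh.mk h) := by
    ext x
    refine integral_congr_ae ?_
    filter_upwards [hh.ae_eq_mk] with z hz
    rw [hz]
  rw [e]
  refine StronglyMeasurable.integral_prod_right (f := fun x z => KK η i j (x - z) * hh.mk h z) ?_
  refine Measurable.stronglyMeasurable ?_
  exact ((KK_meas hη i j).comp (measurable_fst.sub measurable_snd)).mul (hh.stronglyMeasurable_mk.measurable.comp measurable_snd)

end MR

end

section

namespace MR
open ProbabilityTheory Matrix Filter Topology

variable {d : ℕ} {P : ℝ≥0∞} [Fact (1 ≤ P)] [Fact (P ≠ ∞)]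

/-- continuous functions with compact support -/
def CCf (h : XX d → ℝ) : Prop := Continuous h ∧ HasCompactSupport h

theorem CCf.memLp {h : XX d → ℝ} (hh : CCf h) (q : ℝ≥0∞) : MemLp h q volume := hh.1.memLp_of_hasCompactSupport hh.2

theorem CCf.integrable {h : XX d → ℝ} (hh : CCf h) : Integrable h := hh.1.integrable_of_hasCompactSupport hh.2

theorem CCf.slice_supp {h : XX d → ℝ} (s : ℝ) (x : Fin d → ℝ) (hx : x ∉ Prod.snd '' tsupport h) : h (s, x) = 0 := by
  by_contra hne
  exact hx ⟨(s, x), subset_tsupport _ hne, rfl⟩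

theorem CCf.slice {h : XX d → ℝ} (hh : CCf h) (s : ℝ) : Continuous (fun x => h (s, x)) ∧ HasCompactSupport (fun x => h (s, x)) :=
  ⟨hh.1.comp (by fun_prop), HasCompactSupport.intro (hh.2.isCompact.image continuous_snd) fun x hx => CCf.slice_supp s x hx⟩

theorem CCf.slice_memLp {h : XX d → ℝ} (hh : CCf h) (s : ℝ) (q : ℝ≥0∞) : MemLp (fun x => h (s, x)) q volume :=
  (hh.slice s).1.memLp_of_hasCompactSupport (hh.slice s).2

/-- a space-time function as a curve in `L_p` -/
def sl (P : ℝ≥0∞) (h : XX d → ℝ) (s : ℝ) : LP P d :=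
  open Classical in
  if hs : MemLp (fun x => h (s, x)) P volume then hs.toLp else 0

theorem CCf.sl_eq {h : XX d → ℝ} (hh : CCf h) (s : ℝ) : sl P h s = (hh.slice_memLp s P).toLp := by
  rw [sl, dif_pos (hh.slice_memLp s P)]

theorem CCf.sl_coe {h : XX d → ℝ} (hh : CCf h) (s : ℝ) : (sl P h s : (Fin d → ℝ) → ℝ) =ᵐ[volume] fun x => h (s, x) := by
  rw [hh.sl_eq]; exact MemLp.coeFn_toLp _

theorem CCf.sl_supp {h : XX d → ℝ} (hh : CCf h) : HasCompactSupport (sl P h) := by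
  refine HasCompactSupport.intro (hh.2.isCompact.image continuous_fst) fun s hs => ?_
  apply Lp.ext
  have h0 : ∀ x, h (s, x) = 0 := by
    intro x
    by_contra hne
    exact hs ⟨(s, x), subset_tsupport _ hne, rfl⟩
  filter_upwards [hh.sl_coe (P := P) s, Lp.coeFn_zero ℝ P volume] with x h1 h2
  rw [h1, h0, h2]; rfl

theorem CCf.sl_cont {h : XX d → ℝ} (hh : CCf h) : Continuous (sl P h) := by
  have hu : UniformContinuous h := hh.2.uniformContinuous_of_continuous hh.1
  set S : Set (Fin d → ℝ) := Prod.snd '' tsupport h with hS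
  have hSc : IsCompact S := hh.2.isCompact.image continuous_snd
  set V : ℝ≥0∞ := volume S ^ P.toReal⁻¹ with hV
  have hVt : V ≠ ∞ := ENNReal.rpow_ne_top_of_nonneg (by positivity) hSc.measure_lt_top.ne
  have key : ∀ s t ε : ℝ, 0 ≤ ε → (∀ x, |h (s, x) - h (t, x)| ≤ ε) → ‖sl P h s - sl P h t‖ ≤ V.toReal * ε := by
    intro s t ε hε H
    rw [hh.sl_eq, hh.sl_eq, ← MemLp.toLp_sub, Lp.norm_toLp]
    have h2 : eLpNorm ((fun x => h (s, x)) - fun x => h (t, x)) P volume ≤ V * ENNReal.ofReal ε := by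
      rw [← eLpNorm_restrict_eq_of_support_subset (s := S)]
      · refine (eLpNorm_le_of_ae_bound (C := ε) (Eventually.of_forall fun x => H x)).trans ?_
        simp [hV]
      · intro x hx
        by_contra hxS
        exact hx (by simp [CCf.slice_supp s x hxS, CCf.slice_supp t x hxS])
    calc _ ≤ (V * ENNReal.ofReal ε).toReal := ENNReal.toReal_mono (ENNReal.mul_ne_top hVt ENNReal.ofReal_ne_top) h2
      _ = _ := by rw [ENNReal.toReal_mul, ENNReal.toReal_ofReal hε]
  rw [Metric.continuous_iff]
  intro t ε hε
  obtain ⟨δ, hδ, H⟩ := Metric.uniformContinuous_iff.1 hu (ε / (V.toReal + 1)) (by positivity)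
  refine ⟨δ, hδ, fun s hs => ?_⟩
  rw [dist_eq_norm]
  refine (key s t (ε / (V.toReal + 1)) (by positivity) fun x => ?_).trans_lt ?_
  · have := H (a := (s, x)) (b := (t, x)) (by rw [Prod.dist_eq]; simpa using hs)
    exact this.le
  · have hv : 0 ≤ V.toReal := ENNReal.toReal_nonneg
    rw [mul_div_assoc', div_lt_iff₀ (by positivity)]
    nlinarith

theorem CCf.sl_int {h : XX d → ℝ} (hh : CCf h) : Integrable (sl P h) := hh.sl_cont.integrable_of_hasCompactSupport hh.sl_supp

theorem pr_cv_fun {φ : (Fin d → ℝ) → ℝ} (hφ : Test φ) {k : (Fin d → ℝ) → ℝ} (hk : Integrable k) (hkm : Continuous k) {M : ℝ} (hkb : ∀ x, ‖k x‖ ≤ M)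
    {g : (Fin d → ℝ) → ℝ} (hg : Continuous g) (hgs : HasCompactSupport g) (hgm : MemLp g P volume) :
    prL φ (cv k (hgm.toLp : LP P d)) = ∫ z, ∫ x, k (z - x) * g z * φ x := by
  have hgi := hg.integrable_of_hasCompactSupport hgs (μ := volume)
  have hφi := hφ.1.continuous.integrable_of_hasCompactSupport hφ.2 (μ := volume)
  obtain ⟨B, hB⟩ := hg.bounded_above_of_compact_support hgs
  rw [pr_cv _ hk]
  have e1 : ∀ y, k y * prL φ (tr y (hgm.toLp : LP P d)) = ∫ x, k y * g (x + y) * φ x := by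
    intro y
    rw [prT hφ, ← integral_const_mul]
    have h1 := (measurePreserving_add_right (volume : Measure (Fin d → ℝ)) y).quasiMeasurePreserving.ae_eq_comp hgm.coeFn_toLp
    refine integral_congr_ae ?_
    filter_upwards [tr_coe y (hgm.toLp : LP P d), h1] with x a b
    rw [a]
    have : (MemLp.toLp g hgm : LP P d) (x + y) = g (x + y) := b
    rw [this]; ring
  simp_rw [e1]
  rw [integral_integral_swap]
  · have e2 : ∀ x, ∫ y, k y * g (x + y) * φ x = ∫ z, k (z - x) * g z * φ x := by
      intro x
      rw [← integral_sub_right_eq_self (fun y => k y * g (x + y) * φ x) x]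
      simp
    simp_rw [e2]
    rw [integral_integral_swap]
    have h3 : Integrable (fun z : (Fin d → ℝ) × (Fin d → ℝ) => k (z.2 - z.1) * (φ z.1 * g z.2)) (volume.prod volume) := by
      refine (hφi.mul_prod hgi).bdd_mul ?_ (Eventually.of_forall fun z => hkb _)
      exact (hkm.comp (continuous_snd.sub continuous_fst)).aestronglyMeasurable
    refine h3.congr (Eventually.of_forall fun z => ?_)
    simp only [Function.uncurry]; ring
  · have h3 : Integrable (fun z : (Fin d → ℝ) × (Fin d → ℝ) => g (z.2 + z.1) * (k z.1 * φ z.2)) (volume.prod volume) := by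
      refine (hk.mul_prod hφi).bdd_mul ?_ (Eventually.of_forall fun z => hB _)
      exact (hg.comp (continuous_snd.add continuous_fst)).aestronglyMeasurable
    refine h3.congr (Eventually.of_forall fun z => ?_)
    simp only [Function.uncurry]; ring

theorem kk_bdd {η v : ℝ} (hη : 0 < η) (h : η ≤ v) (i j : Fin d) (x : Fin d → ℝ) : ‖kk v i j x‖ ≤ η⁻¹ * MK η d := by
  have := KK_bdd hη i j (v - η, x)
  unfold KK at this
  simpa [h] using this

theorem pr_HW {η : ℝ} (hη : 0 < η) (i j : Fin d) {h : XX d → ℝ} (hh : CCf h) {φ : (Fin d → ℝ) → ℝ} (hφ : Test φ) (t : ℝ) :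
    prL φ (HW η i j (sl P h) t) = ∫ x, TT η i j h (t, x) * φ x := by
  have hφi := hφ.1.continuous.integrable_of_hasCompactSupport hφ.2 (μ := volume)
  have G : Integrable (fun q : XX d × (Fin d → ℝ) => KK η i j ((t, q.2) - q.1) * h q.1 * φ q.2) ((volume : Measure (XX d)).prod volume) := by
    have : Integrable (fun q : XX d × (Fin d → ℝ) => KK η i j ((t, q.2) - q.1) * (h q.1 * φ q.2)) ((volume : Measure (XX d)).prod volume) := by
      refine (hh.integrable.mul_prod hφi).bdd_mul ?_ (Eventually.of_forall fun z => KK_bdd hη i j _)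
      exact ((KK_meas hη i j).comp (by fun_prop)).aestronglyMeasurable
    exact this.congr (Eventually.of_forall fun z => by simp only; ring)
  have e1 : ∫ x, TT η i j h (t, x) * φ x = ∫ z : XX d, ∫ x, KK η i j ((t, x) - z) * h z * φ x := by
    rw [integral_integral_swap G]
    refine integral_congr_ae (Eventually.of_forall fun x => ?_)
    simp only [TT]
    rw [integral_mul_const]
  rw [e1, Measure.volume_eq_prod, integral_prod _ G.integral_prod_left, HW,
    ← ContinuousLinearMap.integral_comp_comm _ (HW_int hη i j hh.sl_int t).integrableOn, ← integral_indicator measurableSet_Iic]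
  refine integral_congr_ae (Eventually.of_forall fun s => ?_)
  simp only
  by_cases hs : s ≤ t
  · rw [indicator_of_mem (by exact hs), hh.sl_eq, Kop]
    rw [pr_cv_fun hφ (kk_int (lt_max_of_lt_left hη) i j) (kk_cont _ i j) (kk_bdd hη (le_max_left _ _) i j) (hh.slice s).1 (hh.slice s).2]
    refine integral_congr_ae (Eventually.of_forall fun z => integral_congr_ae (Eventually.of_forall fun x => ?_))
    simp only [KK, Prod.mk_sub_mk]
    rw [if_pos (by linarith), ← kk_neg, neg_sub]
  · rw [indicator_of_notMem (by exact hs)]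
    simp only [KK, Prod.mk_sub_mk]
    simp [hs]

theorem HW_coe {η : ℝ} (hη : 0 < η) (i j : Fin d) {h : XX d → ℝ} (hh : CCf h) (t : ℝ) :
    (HW η i j (sl P h) t : (Fin d → ℝ) → ℝ) =ᵐ[volume] fun x => TT η i j h (t, x) := by
  have hm := (TT_meas hη i j hh.integrable.1).comp_measurable (g := fun x : Fin d → ℝ => (t, x)) (by fun_prop)
  refine ae_eq_of_integral_contDiff_smul_eq (LP_locInt _) ?_ ?_
  · have : LocallyIntegrable (fun _ : Fin d → ℝ => η⁻¹ * MK η d * ∫ z, ‖h z‖) volume := locallyIntegrable_const _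
    refine this.mono hm.aestronglyMeasurable (Eventually.of_forall fun x => ?_)
    refine le_trans ?_ (le_abs_self _)
    refine (norm_integral_le_integral_norm _).trans ?_
    rw [← integral_const_mul]
    refine integral_mono (TT_int1 hη i j hh.integrable _).norm (hh.integrable.norm.const_mul _) fun z => ?_
    simp only [norm_mul]
    exact mul_le_mul_of_nonneg_right (KK_bdd hη i j _) (norm_nonneg _)
  · intro φ h1 h2
    have := pr_HW (P := P) hη i j hh (φ := φ) ⟨h1, h2⟩ t
    rw [prT ⟨h1, h2⟩] at this
    simpa [mul_comm] using this

theorem enorm_LP {p : ℝ} (hp : 1 ≤ p) (hP : P = ENNReal.ofReal p) (g : LP P d) : ‖g‖ₑ ^ p = ∫⁻ x, ‖g x‖ₑ ^ p := by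
  have hP0 : P ≠ 0 := by rw [hP]; simp; linarith
  have e : P.toReal = p := by rw [hP, ENNReal.toReal_ofReal (by linarith)]
  rw [Lp.enorm_def, eLpNorm_eq_lintegral_rpow_enorm_toReal hP0 Fact.out, e, ← ENNReal.rpow_mul,
    one_div, inv_mul_cancel₀ (by linarith), ENNReal.rpow_one]

theorem bridge_f {p : ℝ} (hp : 1 ≤ p) (hP : P = ENNReal.ofReal p) {h : XX d → ℝ} (hh : CCf h) : ∫⁻ t, ‖sl P h t‖ₑ ^ p = ∫⁻ z, ‖h z‖ₑ ^ p := by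
  rw [Measure.volume_eq_prod, lintegral_prod]
  · refine lintegral_congr fun t => ?_
    rw [enorm_LP hp hP]
    refine lintegral_congr_ae ?_
    filter_upwards [hh.sl_coe (P := P) t] with x hx
    rw [hx]
  · exact (hh.1.measurable.enorm.pow_const p).aemeasurable

theorem bridge_T {p : ℝ} (hp : 1 ≤ p) (hP : P = ENNReal.ofReal p) {η : ℝ} (hη : 0 < η) (i j : Fin d) {h : XX d → ℝ} (hh : CCf h) :
    ∫⁻ t, ‖HW η i j (sl P h) t‖ₑ ^ p = ∫⁻ z, ‖TT η i j h z‖ₑ ^ p := by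
  rw [Measure.volume_eq_prod, lintegral_prod]
  · refine lintegral_congr fun t => ?_
    rw [enorm_LP hp hP]
    refine lintegral_congr_ae ?_
    filter_upwards [HW_coe (P := P) hη i j hh t] with x hx
    rw [hx]
  · exact ((TT_meas hη i j hh.integrable.1).measurable.enorm.pow_const p).aemeasurable

theorem TT_L2c {η : ℝ} (hη : 0 < η) (i j : Fin d) {h : XX d → ℝ} (hh : CCf h) :
    ∫⁻ z, ‖TT η i j h z‖ₑ ^ (2:ℝ) ≤ 64 * ∫⁻ z, ‖h z‖ₑ ^ (2:ℝ) := by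
  have h1 := HW_L2 hη i j (hh.sl_cont (P := 2)) hh.sl_int
  rw [← bridge_T (P := 2) (by norm_num) (by simp) hη i j hh, ← bridge_f (P := 2) (by norm_num) (by simp) hh]
  simpa using h1

theorem TT_tendsto {η : ℝ} (hη : 0 < η) (i j : Fin d) {h : XX d → ℝ} (hh : MemLp h 2 volume) {u : ℕ → XX d → ℝ} (hu : ∀ n, MemLp (u n) 2 volume)
    (hlim : Tendsto (fun n => eLpNorm (h - u n) 2 volume) atTop (𝓝 0)) (x : XX d) : Tendsto (fun n => TT η i j (u n) x) atTop (𝓝 (TT η i j h x)) := by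
  rw [tendsto_iff_edist_tendsto_0]
  have hK := (KK_sub_L2 hη i j x)
  have b : ∀ n, edist (TT η i j (u n) x) (TT η i j h x) ≤ eLpNorm (fun z => KK η i j (x - z)) 2 volume * eLpNorm (h - u n) 2 volume := by
    intro n
    rw [edist_comm, edist_eq_enorm_sub, TT, TT, ← integral_sub (TT_int hη i j hh x) (TT_int hη i j (hu n) x)]
    refine (enorm_integral_le_lintegral_enorm _).trans ?_
    have := eLpNorm_smul_le_mul_eLpNorm (p := 2) (q := 2) (r := 1) (hh.1.sub (hu n).1) hK.1
    rw [eLpNorm_one_eq_lintegral_enorm] at this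
    refine le_trans (le_of_eq ?_) this
    refine lintegral_congr fun z => ?_
    simp [mul_sub]
  refine tendsto_of_tendsto_of_tendsto_of_le_of_le tendsto_const_nhds ?_ (fun _ => bot_le) b
  have := ENNReal.Tendsto.const_mul (a := eLpNorm (fun z => KK η i j (x - z)) 2 volume) hlim (Or.inr hK.2.ne)
  simpa using this

theorem TT_L2 {η : ℝ} (hη : 0 < η) (i j : Fin d) {h : XX d → ℝ} (hh : MemLp h 2 volume) :
    ∫⁻ z, ‖TT η i j h z‖ₑ ^ (2:ℝ) ≤ 64 * ∫⁻ z, ‖h z‖ₑ ^ (2:ℝ) := by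
  have hex : ∀ n : ℕ, ∃ g : XX d → ℝ, CCf g ∧ eLpNorm (h - g) 2 volume ≤ (n + 1 : ℝ≥0∞)⁻¹ := by
    intro n
    obtain ⟨g, a, b, c, _⟩ := hh.exists_hasCompactSupport_eLpNorm_sub_le (by norm_num) (ε := (n + 1 : ℝ≥0∞)⁻¹) (by simp)
    exact ⟨g, ⟨c, a⟩, b⟩
  choose u hu hle using hex
  have hz : Tendsto (fun n : ℕ => (n + 1 : ℝ≥0∞)⁻¹) atTop (𝓝 0) := by
    have := (tendsto_add_atTop_iff_nat 1).2 ENNReal.tendsto_inv_nat_nhds_zero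
    simpa using this
  have hlim : Tendsto (fun n => eLpNorm (h - u n) 2 volume) atTop (𝓝 0) :=
    tendsto_of_tendsto_of_tendsto_of_le_of_le tendsto_const_nhds hz (fun _ => bot_le) hle
  have e2 : ∀ g : XX d → ℝ, ∫⁻ z, ‖g z‖ₑ ^ (2:ℝ) = eLpNorm g 2 volume ^ (2:ℝ) := by
    intro g
    rw [eLpNorm_eq_lintegral_rpow_enorm_toReal (by norm_num) (by norm_num), ← ENNReal.rpow_mul]; simp
  have lim2 : Tendsto (fun n => eLpNorm (u n) 2 volume) atTop (𝓝 (eLpNorm h 2 volume)) := by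
    have b1 : ∀ n : ℕ, eLpNorm (u n) 2 volume ≤ eLpNorm h 2 volume + (n + 1 : ℝ≥0∞)⁻¹ := by
      intro n
      have : u n = h - (h - u n) := by simp
      calc eLpNorm (u n) 2 volume = eLpNorm (h - (h - u n)) 2 volume := by rw [← this]
        _ ≤ _ := (eLpNorm_sub_le hh.1 (hh.1.sub ((hu n).memLp 2).1) (by norm_num)).trans (by gcongr; exact hle n)
    have b2 : ∀ n : ℕ, eLpNorm h 2 volume - (n + 1 : ℝ≥0∞)⁻¹ ≤ eLpNorm (u n) 2 volume := by
      intro n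
      rw [tsub_le_iff_right]
      calc eLpNorm h 2 volume = eLpNorm (u n + (h - u n)) 2 volume := by congr 1; simp
        _ ≤ _ := (eLpNorm_add_le ((hu n).memLp 2).1 (hh.1.sub ((hu n).memLp 2).1) (by norm_num)).trans (by gcongr; exact hle n)
    refine tendsto_of_tendsto_of_tendsto_of_le_of_le ?_ ?_ b2 b1
    · have := ENNReal.Tendsto.sub (tendsto_const_nhds (x := eLpNorm h 2 volume) (f := (atTop : Filter ℕ))) hz (Or.inl hh.2.ne)
      simpa using this
    · simpa using (tendsto_const_nhds (x := eLpNorm h 2 volume) (f := (atTop : Filter ℕ))).add hz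
  calc ∫⁻ z, ‖TT η i j h z‖ₑ ^ (2:ℝ) = ∫⁻ z, liminf (fun n => ‖TT η i j (u n) z‖ₑ ^ (2:ℝ)) atTop := by
        refine lintegral_congr fun z => ?_
        refine (Tendsto.liminf_eq ?_).symm
        exact (ENNReal.continuous_rpow_const.tendsto _).comp ((TT_tendsto hη i j hh (fun n => (hu n).memLp 2) hlim z).enorm)
    _ ≤ liminf (fun n => ∫⁻ z, ‖TT η i j (u n) z‖ₑ ^ (2:ℝ)) atTop :=
        lintegral_liminf_le fun n => (TT_meas hη i j (hu n).integrable.1).measurable.enorm.pow_const _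
    _ ≤ liminf (fun n => 64 * eLpNorm (u n) 2 volume ^ (2:ℝ)) atTop := by
        refine liminf_le_liminf (Eventually.of_forall fun n => ?_)
        rw [← e2]; exact TT_L2c hη i j (hu n)
    _ = 64 * ∫⁻ z, ‖h z‖ₑ ^ (2:ℝ) := by
        rw [e2]
        refine Tendsto.liminf_eq ?_
        exact ENNReal.Tendsto.const_mul ((ENNReal.continuous_rpow_const.tendsto _).comp lim2) (Or.inr (by norm_num))

end MR

end

section

namespace MR
open ProbabilityTheory Matrix Filter Topology

variable {d : ℕ}

/-- auxiliary time weight -/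
def q1 (ℓ s : ℝ) : ℝ≥0∞ := (Ioc 0 (2 * ℓ ^ 2)).indicator (fun s => ENNReal.ofReal (s ^ (-(1/2) : ℝ))) s

def q2 (d : ℕ) (ℓ s : ℝ) : ℝ≥0∞ := (Ioi (ℓ ^ 2)).indicator
  (fun s => ENNReal.ofReal (4 * cB d * d * ℓ * s ^ (-(3/2) : ℝ)) + ENNReal.ofReal (ℓ ^ 2 * ((4 + d) * cB d) * s ^ (-2 : ℝ))) s

theorem q1_int {ℓ : ℝ} (hℓ : 0 < ℓ) : ∫⁻ s, q1 ℓ s ≤ ENNReal.ofReal (4 * ℓ) := by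
  unfold q1
  rw [lintegral_indicator measurableSet_Ioc]
  have hi : IntegrableOn (fun s : ℝ => s ^ (-(1/2) : ℝ)) (Ioc 0 (2 * ℓ ^ 2)) := by
    have := intervalIntegral.intervalIntegrable_rpow' (a := 0) (b := 2 * ℓ ^ 2) (r := -(1/2)) (by norm_num)
    rwa [intervalIntegrable_iff_integrableOn_Ioc_of_le (by positivity)] at this
  rw [← ofReal_integral_eq_lintegral_ofReal hi ((ae_restrict_mem measurableSet_Ioc).mono fun s hs => Real.rpow_nonneg hs.1.le _)]
  apply ENNReal.ofReal_le_ofReal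
  rw [← intervalIntegral.integral_of_le (by positivity), integral_rpow (Or.inl (by norm_num))]
  have e : (-(1/2) + 1 : ℝ) = 1/2 := by norm_num
  rw [e, ← Real.sqrt_eq_rpow, Real.zero_rpow (by norm_num)]
  have h2 : √(2 * ℓ ^ 2) ≤ 2 * ℓ := by
    rw [Real.sqrt_le_left (by positivity)]; nlinarith [sq_nonneg ℓ]
  linarith

theorem q2_int {ℓ : ℝ} (hℓ : 0 < ℓ) : ∫⁻ s, q2 d ℓ s ≤ ENNReal.ofReal (8 * cB d * d) + ENNReal.ofReal ((4 + d) * cB d) := by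
  have hcB := cB_pos d
  unfold q2
  have h2 : 0 < ℓ ^ 2 := by positivity
  have aux : ∀ (a c : ℝ), a < -1 → 0 ≤ c → ∫⁻ s in Ioi (ℓ ^ 2), ENNReal.ofReal (c * s ^ a) = ENNReal.ofReal (c * (-(ℓ ^ 2) ^ (a + 1) / (a + 1))) := by
    intro a c ha hc
    have hi := (integrableOn_Ioi_rpow_of_lt ha h2).const_mul c
    rw [← ofReal_integral_eq_lintegral_ofReal hi ((ae_restrict_mem measurableSet_Ioi).mono fun s hs =>
      mul_nonneg hc (Real.rpow_nonneg (h2.le.trans (le_of_lt hs)) _)), integral_const_mul, integral_Ioi_rpow_of_lt ha h2]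
  rw [lintegral_indicator measurableSet_Ioi, lintegral_add_left (by fun_prop), aux _ _ (by norm_num) (by positivity), aux _ _ (by norm_num) (by positivity)]
  have e1 : (ℓ ^ 2) ^ (-(3/2) + 1 : ℝ) = ℓ⁻¹ := by
    rw [← Real.rpow_natCast, ← Real.rpow_mul hℓ.le]; norm_num [Real.rpow_neg_one]
  have e2 : (ℓ ^ 2) ^ (-2 + 1 : ℝ) = (ℓ ^ 2)⁻¹ := by norm_num [Real.rpow_neg_one]
  rw [e1, e2]
  refine add_le_add (ENNReal.ofReal_le_ofReal (le_of_eq ?_)) (ENNReal.ofReal_le_ofReal (le_of_eq ?_))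
  · field_simp; norm_num; ring
  · field_simp; norm_num

/-- the dilated box -/
def BS (d : ℕ) (ℓ : ℝ) : Set (XX d) := {w | 0 ≤ w.1 ∧ w.1 ≤ 2 * ℓ ^ 2 ∧ ‖w.2‖ ≤ 3 * ℓ}

theorem BS_meas (ℓ : ℝ) : MeasurableSet (BS d ℓ) := by
  unfold BS
  exact (measurableSet_le measurable_const measurable_fst).inter ((measurableSet_le measurable_fst measurable_const).inter (measurableSet_le measurable_snd.norm measurable_const))

theorem hor_slice {η ℓ : ℝ} (hη : 0 < η) (hℓ : 0 < ℓ) (i j : Fin d) {y : XX d} (h0 : 0 ≤ y.1) (h1 : y.1 ≤ ℓ ^ 2) (h2 : ‖y.2‖ ≤ ℓ)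
    {r : ℝ} (hr : r ≠ 0) (hr' : r ≠ y.1) :
    ∫⁻ x, (BS d ℓ)ᶜ.indicator (fun w => ‖KK η i j (w - y) - KK η i j w‖ₑ) (r, x) ≤
      ENNReal.ofReal (cB d * ℓ⁻¹) * q1 ℓ (r - y.1) + ENNReal.ofReal (cB d * ℓ⁻¹) * q1 ℓ r + q2 d ℓ (r - ℓ ^ 2) := by
  have hcB := cB_pos d
  have tail : ∀ s : ℝ, s ≠ 0 → s ≤ 2 * ℓ ^ 2 → ∫⁻ x in {x | 2 * ℓ ≤ ‖x‖}, ‖KK η i j (s, x)‖ₑ ≤ ENNReal.ofReal (cB d * ℓ⁻¹) * q1 ℓ s := by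
    intro s hs hsl
    unfold KK
    by_cases h : 0 < s
    · simp only [h.le, if_true]
      refine (kk_tail (lt_max_of_lt_left hη) i j (by positivity)).trans ?_
      rw [q1, indicator_of_mem (by exact ⟨h, hsl⟩), ← ENNReal.ofReal_mul (by positivity)]
      apply ENNReal.ofReal_le_ofReal
      rw [Real.rpow_neg h.le, ← Real.sqrt_eq_rpow]
      have : (√(max η (s + η)))⁻¹ ≤ (√s)⁻¹ := by
        gcongr
        exact (by linarith : s ≤ s + η).trans (le_max_right _ _)
      calc 2 * cB d * (2 * ℓ)⁻¹ * (√(max η (s + η)))⁻¹ ≤ 2 * cB d * (2 * ℓ)⁻¹ * (√s)⁻¹ := by gcongr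
        _ = _ := by field_simp
    · have : ¬ 0 ≤ s := fun h' => h (lt_of_le_of_ne h' (Ne.symm hs))
      simp [this]
  rcases lt_or_ge r 0 with hneg | hpos
  · refine le_trans (le_of_eq ?_) bot_le
    refine (lintegral_eq_zero_iff' ?_).2 ?_
    rotate_left
    · refine Eventually.of_forall fun x => ?_
      have a1 : ¬ 0 ≤ r - y.1 := by linarith
      have a2 : ¬ 0 ≤ r := by linarith
      simp only [indicator, KK, Prod.fst_sub, Prod.snd_sub, if_neg a1, if_neg a2]
      simp
    · refine Measurable.aemeasurable ?_
      have : Measurable ((BS d ℓ)ᶜ.indicator (fun w => ‖KK η i j (w - y) - KK η i j w‖ₑ)) := by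
        refine Measurable.indicator ?_ (BS_meas ℓ).compl
        exact (((KK_meas hη i j).comp (measurable_id.sub_const y)).sub (KK_meas hη i j)).enorm
      exact this.comp (by fun_prop)
  rcases le_or_gt r (2 * ℓ ^ 2) with hs | hs
  · refine le_trans ?_ le_self_add
    have sp : ∀ x, (BS d ℓ)ᶜ.indicator (fun w => ‖KK η i j (w - y) - KK η i j w‖ₑ) (r, x) ≤
        {x | 2 * ℓ ≤ ‖x‖}.indicator (fun x => ‖KK η i j (r - y.1, x)‖ₑ) (x - y.2) + {x | 2 * ℓ ≤ ‖x‖}.indicator (fun x => ‖KK η i j (r, x)‖ₑ) x := by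
      intro x
      by_cases hx : ‖x‖ ≤ 3 * ℓ
      · rw [indicator_of_notMem]
        · exact bot_le
        · rw [Set.notMem_compl_iff]
          exact ⟨hpos, hs, hx⟩
      · push Not at hx
        rw [indicator_of_mem (a := (r, x)), indicator_of_mem, indicator_of_mem]
        · exact (enorm_sub_le (a := KK η i j ((r, x) - y)) (b := KK η i j (r, x)))
        · show 2 * ℓ ≤ ‖x‖
          linarith
        · show 2 * ℓ ≤ ‖x - y.2‖
          have := norm_sub_norm_le x y.2
          linarith
        · rintro ⟨_, _, h3⟩
          exact absurd h3 (not_le.2 hx)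
    refine (lintegral_mono sp).trans ?_
    have hm : MeasurableSet {x : Fin d → ℝ | 2 * ℓ ≤ ‖x‖} := measurableSet_le measurable_const (by fun_prop)
    rw [lintegral_add_right, lintegral_sub_right_eq_self (fun x => {x : Fin d → ℝ | 2 * ℓ ≤ ‖x‖}.indicator (fun x => ‖KK η i j (r - y.1, x)‖ₑ) x),
      lintegral_indicator hm, lintegral_indicator hm]
    · gcongr
      · exact tail _ (sub_ne_zero.2 hr') (by linarith)
      · exact tail _ hr hs
    · exact Measurable.indicator (((KK_meas hη i j).comp (by fun_prop)).enorm) hm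
  · refine le_trans ?_ le_add_self
    have hs1 : 0 ≤ r - y.1 := by nlinarith [sq_nonneg ℓ]
    have hℓ2 : 0 < ℓ ^ 2 := by positivity
    set s := r - ℓ ^ 2 with hsdef
    have hsl : ℓ ^ 2 < s := by linarith
    have hs0 : 0 < s := by linarith
    set v := r - y.1 + η with hv
    have hsv : s ≤ v := by linarith
    have hv0 : 0 < v := by linarith
    have e1 : ∀ x, KK η i j ((r, x) - y) = kk v i j (x - y.2) := by
      intro x
      simp only [KK, Prod.fst_sub, Prod.snd_sub]
      rw [if_pos hs1, max_eq_right (by linarith)]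
    have e2 : ∀ x, KK η i j (r, x) = kk (r + η) i j x := by
      intro x
      simp only [KK]
      rw [if_pos hpos, max_eq_right (by linarith)]
    calc _ ≤ ∫⁻ x, (‖kk v i j (x - y.2) - kk v i j x‖ₑ + ‖kk (r + η) i j x - kk v i j x‖ₑ) := by
          refine lintegral_mono fun x => ?_
          refine (indicator_le_self _ _ _).trans ?_
          rw [e1, e2]
          have : kk v i j (x - y.2) - kk (r + η) i j x = (kk v i j (x - y.2) - kk v i j x) - (kk (r + η) i j x - kk v i j x) := by ring
          rw [this]
          exact enorm_sub_le
      _ = (∫⁻ x, ‖kk v i j (x - y.2) - kk v i j x‖ₑ) + ∫⁻ x, ‖kk (r + η) i j x - kk v i j x‖ₑ := by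
          rw [lintegral_add_right]
          exact (((kk_cont _ i j).sub (kk_cont _ i j)).measurable).enorm
      _ ≤ ENNReal.ofReal (4 * cB d * d * ‖y.2‖ * (v * √v)⁻¹) + ENNReal.ofReal ((r + η - v) * ((4 + d) * cB d * (v ^ 2)⁻¹)) :=
          add_le_add (kk_space hv0 i j _) (kk_time hv0 (by linarith) i j)
      _ ≤ q2 d ℓ s := by
          rw [q2, indicator_of_mem (by exact hsl)]
          have r1 : s ^ (-(3/2) : ℝ) = (s * √s)⁻¹ := by
            rw [Real.rpow_neg hs0.le, Real.sqrt_eq_rpow]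
            nth_rewrite 2 [← Real.rpow_one s]
            rw [← Real.rpow_add hs0]; norm_num
          have r2 : s ^ (-2 : ℝ) = (s ^ 2)⁻¹ := by
            rw [Real.rpow_neg hs0.le]; norm_num
          rw [r1, r2]
          refine add_le_add (ENNReal.ofReal_le_ofReal ?_) (ENNReal.ofReal_le_ofReal ?_)
          · gcongr
          · have : r + η - v ≤ ℓ ^ 2 := by rw [hv]; linarith
            have h3 : (v ^ 2)⁻¹ ≤ (s ^ 2)⁻¹ := by gcongr
            calc _ ≤ ℓ ^ 2 * ((4 + d) * cB d * (s ^ 2)⁻¹) := by gcongr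
              _ = _ := by ring

/-- the Hormander constant -/
def AH (d : ℕ) : ℝ := 8 * cB d + 8 * cB d * d + (4 + d) * cB d

theorem AH_nn (d : ℕ) : 0 ≤ AH d := by have := cB_pos d; unfold AH; positivity

theorem hor_diff {η : ℝ} (hη : 0 < η) (i j : Fin d) (y : XX d) : Measurable fun w => ‖KK η i j (w - y) - KK η i j w‖ₑ :=
  (((KK_meas hη i j).comp (measurable_id.sub_const y)).sub (KK_meas hη i j)).enorm

theorem q1_meas (ℓ : ℝ) : Measurable (q1 ℓ) := by
  unfold q1
  exact Measurable.indicator (by fun_prop) measurableSet_Ioc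

theorem hor {η ℓ : ℝ} (hη : 0 < η) (hℓ : 0 < ℓ) (i j : Fin d) {y : XX d} (h0 : 0 ≤ y.1) (h1 : y.1 ≤ ℓ ^ 2) (h2 : ‖y.2‖ ≤ ℓ) :
    ∫⁻ w in (BS d ℓ)ᶜ, ‖KK η i j (w - y) - KK η i j w‖ₑ ≤ ENNReal.ofReal (AH d) := by
  have hcB := cB_pos d
  rw [← lintegral_indicator (BS_meas ℓ).compl, Measure.volume_eq_prod, lintegral_prod _ ((hor_diff hη i j y).indicator (BS_meas ℓ).compl).aemeasurable]
  have ae1 : ∀ᵐ r : ℝ, r ≠ 0 ∧ r ≠ y.1 := by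
    refine (Measure.ae_ne volume 0).and (Measure.ae_ne volume y.1)
  refine (lintegral_mono_ae (ae1.mono fun r hr => hor_slice hη hℓ i j h0 h1 h2 hr.1 hr.2)).trans ?_
  have m1 := q1_meas ℓ
  have m3 : Measurable fun r => ENNReal.ofReal (cB d * ℓ⁻¹) * q1 ℓ r := m1.const_mul _
  have m2 : Measurable fun r => ENNReal.ofReal (cB d * ℓ⁻¹) * q1 ℓ (r - y.1) := (m1.comp (measurable_id.sub_const _)).const_mul _
  rw [lintegral_add_left (f := fun r => ENNReal.ofReal (cB d * ℓ⁻¹) * q1 ℓ (r - y.1) + ENNReal.ofReal (cB d * ℓ⁻¹) * q1 ℓ r) (m2.add m3), lintegral_add_left m2, lintegral_const_mul _ m1,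
    lintegral_const_mul (f := fun r => q1 ℓ (r - y.1)) _ (m1.comp (measurable_id.sub_const _)), lintegral_sub_right_eq_self (q1 ℓ), lintegral_sub_right_eq_self (q2 d ℓ)]
  have b1 : ENNReal.ofReal (cB d * ℓ⁻¹) * ∫⁻ s, q1 ℓ s ≤ ENNReal.ofReal (4 * cB d) := by
    calc _ ≤ ENNReal.ofReal (cB d * ℓ⁻¹) * ENNReal.ofReal (4 * ℓ) := by gcongr; exact q1_int hℓ
      _ = _ := by rw [← ENNReal.ofReal_mul (by positivity)]; congr 1; field_simp
  calc _ ≤ ENNReal.ofReal (4 * cB d) + ENNReal.ofReal (4 * cB d) + (ENNReal.ofReal (8 * cB d * d) + ENNReal.ofReal ((4 + d) * cB d)) :=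
        add_le_add (add_le_add b1 b1) (q2_int hℓ)
    _ = _ := by
        rw [← ENNReal.ofReal_add (by positivity) (by positivity), ← ENNReal.ofReal_add (by positivity) (by positivity), ← ENNReal.ofReal_add (by positivity) (by positivity)]
        congr 1; unfold AH; ring

theorem hor_TT {η ℓ : ℝ} (hη : 0 < η) (hℓ : 0 < ℓ) (i j : Fin d) (c : XX d) {β : XX d → ℝ} (hm : Measurable β) (hβ : Integrable β)
    (hs : ∀ z, β z ≠ 0 → c.1 ≤ z.1 ∧ z.1 ≤ c.1 + ℓ ^ 2 ∧ ‖z.2 - c.2‖ ≤ ℓ) (h0 : ∫ z, β z = 0) :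
    ∫⁻ x in {x | x - c ∈ BS d ℓ}ᶜ, ‖TT η i j β x‖ₑ ≤ ENNReal.ofReal (AH d) * ∫⁻ z, ‖β z‖ₑ := by
  have mS : MeasurableSet {x : XX d | x - c ∈ BS d ℓ} := (BS_meas ℓ).preimage (measurable_id.sub_const c)
  have e : ∀ x, TT η i j β x = ∫ z, (KK η i j (x - z) - KK η i j (x - c)) * β z := by
    intro x
    have : ∫ z, KK η i j (x - c) * β z = 0 := by rw [integral_const_mul, h0, mul_zero]
    simp_rw [sub_mul]
    rw [integral_sub (TT_int1 hη i j hβ x) (hβ.const_mul _), this, sub_zero]; rfl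
  have mm : Measurable fun q : XX d × XX d => ‖(KK η i j (q.1 - q.2) - KK η i j (q.1 - c)) * β q.2‖ₑ := by
    have := KK_meas hη i j
    refine Measurable.enorm (Measurable.mul (Measurable.sub ?_ ?_) (hm.comp measurable_snd))
    · exact this.comp (measurable_fst.sub measurable_snd)
    · exact this.comp (measurable_fst.sub_const c)
  calc _ ≤ ∫⁻ x in {x | x - c ∈ BS d ℓ}ᶜ, ∫⁻ z, ‖(KK η i j (x - z) - KK η i j (x - c)) * β z‖ₑ := by
        refine lintegral_mono fun x => ?_
        rw [e]; exact enorm_integral_le_lintegral_enorm _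
    _ = ∫⁻ z, ∫⁻ x in {x | x - c ∈ BS d ℓ}ᶜ, ‖(KK η i j (x - z) - KK η i j (x - c)) * β z‖ₑ := lintegral_lintegral_swap mm.aemeasurable
    _ ≤ ∫⁻ z, ENNReal.ofReal (AH d) * ‖β z‖ₑ := by
        refine lintegral_mono fun z => ?_
        simp only [enorm_mul]
        have m3 : Measurable fun x => ‖KK η i j (x - z) - KK η i j (x - c)‖ₑ :=
          (((KK_meas hη i j).comp (measurable_id.sub_const z)).sub ((KK_meas hη i j).comp (measurable_id.sub_const c))).enorm
        rw [lintegral_mul_const _ m3]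
        by_cases hz : β z = 0
        · simp [hz]
        · obtain ⟨a1, a2, a3⟩ := hs z hz
          gcongr
          have := hor hη hℓ i j (y := z - c) (by simpa using a1) (by simp; linarith) (by simpa using a3)
          refine le_trans (le_of_eq ?_) this
          rw [← lintegral_indicator mS.compl, ← lintegral_indicator (BS_meas ℓ).compl,
            ← lintegral_sub_right_eq_self (fun w => (BS d ℓ)ᶜ.indicator (fun w => ‖KK η i j (w - (z - c)) - KK η i j w‖ₑ) w) c]
          refine lintegral_congr fun x => ?_
          by_cases hx : x - c ∈ BS d ℓ
          · rw [indicator_of_notMem (by simpa using hx), indicator_of_notMem (by simpa using hx)]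
          · rw [indicator_of_mem (by exact hx), indicator_of_mem (by exact hx)]
            simp
    _ = _ := lintegral_const_mul _ hm.enorm

theorem BS_vol {ℓ : ℝ} (hℓ : 0 < ℓ) (c : XX d) : volume {x : XX d | x - c ∈ BS d ℓ} = ENNReal.ofReal (2 * 6 ^ d) * ENNReal.ofReal (ℓ ^ 2 * ℓ ^ d) := by
  have : {x : XX d | x - c ∈ BS d ℓ} = Icc c.1 (c.1 + 2 * ℓ ^ 2) ×ˢ Metric.closedBall c.2 (3 * ℓ) := by
    ext x
    simp only [BS, mem_setOf_eq, mem_prod, mem_Icc, Metric.mem_closedBall, dist_eq_norm, Prod.fst_sub, Prod.snd_sub]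
    constructor
    · rintro ⟨a, b, c⟩; exact ⟨⟨by linarith, by linarith⟩, c⟩
    · rintro ⟨⟨a, b⟩, c⟩; exact ⟨by linarith, by linarith, c⟩
  rw [this, Measure.volume_eq_prod, Measure.prod_prod, Real.volume_Icc, Real.volume_pi_closedBall _ (by positivity),
    ← ENNReal.ofReal_mul (by nlinarith [sq_nonneg ℓ]), ← ENNReal.ofReal_mul (by positivity)]
  congr 1
  rw [Fintype.card_fin]
  have : (2 * (3 * ℓ)) ^ d = 6 ^ d * ℓ ^ d := by rw [← mul_pow]; ring_nf
  rw [this]; ring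

end MR

end

section

namespace MR
open ProbabilityTheory Matrix Filter Topology

variable {d : ℕ}

/-- indicator of a half-open interval -/
def I1 (a l x : ℝ) : ℝ := if a ≤ x ∧ x < a + l then 1 else 0

theorem I1_eq (a l : ℝ) : I1 a l = (Ico a (a + l)).indicator (fun _ => (1:ℝ)) := by
  ext x; simp [I1, indicator]

theorem I1_meas (a l : ℝ) : Measurable (I1 a l) := by
  rw [I1_eq]; exact measurable_const.indicator measurableSet_Ico

theorem I1_int {a l : ℝ} (hl : 0 ≤ l) : ∫ x, I1 a l x = l := by
  rw [I1_eq, integral_indicator measurableSet_Ico]; simp [hl]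

theorem I1_integrable (a l : ℝ) : Integrable (I1 a l) := by
  rw [I1_eq, integrable_indicator_iff measurableSet_Ico]
  exact integrableOn_const (by simp)

theorem I1_01 (a l x : ℝ) : I1 a l x = 0 ∨ I1 a l x = 1 := by
  unfold I1; split_ifs <;> simp

theorem I1_add {l m : ℝ} (hl : 0 ≤ l) (hm : 0 ≤ m) (a x : ℝ) : I1 a l x + I1 (a + l) m x = I1 a (l + m) x := by
  unfold I1
  rcases lt_or_ge x (a + l) with h | h
  · rw [if_neg (fun h' : a + l ≤ x ∧ _ => absurd h (not_lt.2 h'.1)), add_zero]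
    exact if_congr ⟨fun h' => ⟨h'.1, by linarith⟩, fun h' => ⟨h'.1, h⟩⟩ rfl rfl
  · rw [if_neg (fun h' : a ≤ x ∧ x < a + l => absurd h'.2 (not_lt.2 h)), zero_add]
    exact if_congr ⟨fun h' => ⟨by linarith, by linarith [h'.2]⟩, fun h' => ⟨h, by linarith [h'.2]⟩⟩ rfl rfl

theorem I1_split2 {l : ℝ} (hl : 0 < l) (a x : ℝ) : ∑ k : Fin 2, I1 (a + (k : ℕ) * (l / 2)) (l / 2) x = I1 a l x := by
  have h2 : 0 ≤ l / 2 := by positivity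
  rw [Fin.sum_univ_two, Fin.val_zero, Fin.val_one, Nat.cast_zero, Nat.cast_one, zero_mul, add_zero, one_mul, I1_add h2 h2, add_halves]

theorem I1_split4 {l : ℝ} (hl : 0 < l) (a x : ℝ) : ∑ k : Fin 4, I1 (a + (k : ℕ) * (l / 4)) (l / 4) x = I1 a l x := by
  have h4 : 0 ≤ l / 4 := by positivity
  rw [Fin.sum_univ_four]
  simp only [Fin.val_zero, Fin.val_one, Fin.val_two, show ((3 : Fin 4) : ℕ) = 3 from rfl]
  have e1 : a + ((1:ℕ):ℝ) * (l / 4) = a + l / 4 := by push_cast; ring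
  have e2 : a + ((2:ℕ):ℝ) * (l / 4) = a + (l / 4 + l / 4) := by push_cast; ring
  have e3 : a + ((3:ℕ):ℝ) * (l / 4) = a + (l / 4 + l / 4 + l / 4) := by push_cast; ring
  rw [e1, e2, e3, Nat.cast_zero, zero_mul, add_zero, I1_add h4 h4, I1_add (by positivity) h4, I1_add (by positivity) h4]
  congr 1; ring

/-- indicator of a parabolic box -/
def bi (c : XX d) (ℓ : ℝ) (z : XX d) : ℝ := I1 c.1 (ℓ ^ 2) z.1 * ∏ k, I1 (c.2 k) ℓ (z.2 k)

/-- volume of a parabolic box -/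
def bv (d : ℕ) (ℓ : ℝ) : ℝ := ℓ ^ 2 * ℓ ^ d

theorem bv_pos {ℓ : ℝ} (hℓ : 0 < ℓ) : 0 < bv d ℓ := by unfold bv; positivity

theorem bi_meas (c : XX d) (ℓ : ℝ) : Measurable (bi c ℓ) := by
  unfold bi
  refine Measurable.mul ((I1_meas _ _).comp measurable_fst) ?_
  refine Finset.measurable_fun_prod _ fun k _ => ?_
  exact (I1_meas (c.2 k) ℓ).comp ((measurable_pi_apply k).comp measurable_snd)

theorem bi_01 (c : XX d) (ℓ : ℝ) (z : XX d) : bi c ℓ z = 0 ∨ bi c ℓ z = 1 := by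
  unfold bi
  have : ∏ k, I1 (c.2 k) ℓ (z.2 k) = 0 ∨ ∏ k, I1 (c.2 k) ℓ (z.2 k) = 1 := by
    by_cases h : ∃ k, I1 (c.2 k) ℓ (z.2 k) = 0
    · obtain ⟨k, hk⟩ := h
      left; exact Finset.prod_eq_zero (Finset.mem_univ k) hk
    · push Not at h
      right; exact Finset.prod_eq_one fun k _ => (I1_01 _ _ _).resolve_left (h k)
  rcases I1_01 c.1 (ℓ ^ 2) z.1 with h1 | h1 <;> rcases this with h2 | h2 <;> simp [h1, h2]

theorem bi_nn (c : XX d) (ℓ : ℝ) (z : XX d) : 0 ≤ bi c ℓ z := by rcases bi_01 c ℓ z with h | h <;> simp [h]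
theorem bi_le (c : XX d) (ℓ : ℝ) (z : XX d) : bi c ℓ z ≤ 1 := by rcases bi_01 c ℓ z with h | h <;> simp [h]

theorem bi_supp {c : XX d} {ℓ : ℝ} (hℓ : 0 < ℓ) {z : XX d} (hz : bi c ℓ z ≠ 0) :
    c.1 ≤ z.1 ∧ z.1 < c.1 + ℓ ^ 2 ∧ ∀ k, c.2 k ≤ z.2 k ∧ z.2 k < c.2 k + ℓ := by
  unfold bi at hz
  have h1 := left_ne_zero_of_mul hz
  have h2 := Finset.prod_ne_zero_iff.1 (right_ne_zero_of_mul hz)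
  unfold I1 at h1 h2
  simp only [ne_eq, ite_eq_right_iff, one_ne_zero, imp_false, not_not, Finset.mem_univ, true_imp_iff] at h1 h2
  exact ⟨h1.1, h1.2, h2⟩

theorem bi_supp' {c : XX d} {ℓ : ℝ} (hℓ : 0 < ℓ) {z : XX d} (hz : bi c ℓ z ≠ 0) :
    c.1 ≤ z.1 ∧ z.1 ≤ c.1 + ℓ ^ 2 ∧ ‖z.2 - c.2‖ ≤ ℓ := by
  obtain ⟨a, b, h⟩ := bi_supp hℓ hz
  refine ⟨a, b.le, (pi_norm_le_iff_of_nonneg hℓ.le).2 fun k => ?_⟩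
  rw [Pi.sub_apply, Real.norm_eq_abs, abs_le]
  constructor <;> linarith [(h k).1, (h k).2]

theorem bi_dist {c : XX d} {ℓ : ℝ} (hℓ : 0 < ℓ) {x y : XX d} (hx : bi c ℓ x ≠ 0) (hy : bi c ℓ y ≠ 0) :
    |x.1 - y.1| ≤ ℓ ^ 2 ∧ ‖x.2 - y.2‖ ≤ ℓ := by
  obtain ⟨a, b, h⟩ := bi_supp hℓ hx
  obtain ⟨a', b', h'⟩ := bi_supp hℓ hy
  refine ⟨abs_le.2 ⟨by linarith, by linarith⟩, (pi_norm_le_iff_of_nonneg hℓ.le).2 fun k => ?_⟩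
  rw [Pi.sub_apply, Real.norm_eq_abs, abs_le]
  constructor <;> linarith [(h k).1, (h k).2, (h' k).1, (h' k).2]

theorem bi_integrable (c : XX d) (ℓ : ℝ) : Integrable (bi c ℓ) := by
  unfold bi
  have h2 : Integrable (fun x : Fin d → ℝ => ∏ k, I1 (c.2 k) ℓ (x k)) := Integrable.fintype_prod fun k => I1_integrable _ _
  exact (I1_integrable c.1 (ℓ ^ 2)).mul_prod h2

theorem bi_int (c : XX d) {ℓ : ℝ} (hℓ : 0 ≤ ℓ) : ∫ z, bi c ℓ z = bv d ℓ := by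
  unfold bi bv
  rw [Measure.volume_eq_prod, integral_prod_mul (f := I1 c.1 (ℓ ^ 2)) (g := fun x : Fin d → ℝ => ∏ k, I1 (c.2 k) ℓ (x k)), I1_int (by positivity)]
  congr 1
  rw [integral_fintype_prod_volume_eq_prod (fun k => I1 (c.2 k) ℓ)]
  simp [I1_int hℓ]

/-- corner of a child box -/
def ch (c : XX d) (ℓ : ℝ) (e : Fin 4 × (Fin d → Fin 2)) : XX d :=
  (c.1 + (e.1 : ℕ) * (ℓ ^ 2 / 4), fun k => c.2 k + (e.2 k : ℕ) * (ℓ / 2))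

theorem bi_split {ℓ : ℝ} (hℓ : 0 < ℓ) (c : XX d) (z : XX d) : ∑ e, bi (ch c ℓ e) (ℓ / 2) z = bi c ℓ z := by
  unfold bi ch
  simp only
  rw [Fintype.sum_prod_type, ← I1_split4 (by positivity), Finset.sum_mul]
  refine Finset.sum_congr rfl fun k _ => ?_
  have e1 : (ℓ / 2) ^ 2 = ℓ ^ 2 / 4 := by ring
  simp only
  rw [← Finset.mul_sum, e1]
  congr 1
  rw [← Fintype.piFinset_univ, ← Finset.prod_univ_sum (fun _ => (Finset.univ : Finset (Fin 2))) (fun k (i : Fin 2) => I1 (c.2 k + (i : ℕ) * (ℓ / 2)) (ℓ / 2) (z.2 k))]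
  exact Finset.prod_congr rfl fun k _ => I1_split2 hℓ _ _

theorem bv_half (ℓ : ℝ) : bv d ℓ = 2 ^ (d + 2) * bv d (ℓ / 2) := by
  unfold bv
  rw [div_pow, div_pow, pow_add]; field_simp

theorem bi_mul_int (c : XX d) (ℓ : ℝ) {h : XX d → ℝ} (hh : Integrable h) : Integrable fun z => bi c ℓ z * h z :=
  hh.bdd_mul (c := 1) (bi_meas c ℓ).aestronglyMeasurable (Eventually.of_forall fun z => by
    rw [Real.norm_eq_abs, abs_of_nonneg (bi_nn c ℓ z)]; exact bi_le c ℓ z)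

/-- the bad function attached to a box -/
def bet (h : XX d → ℝ) (c : XX d) (ℓ : ℝ) (x : XX d) : ℝ := bi c ℓ x * (h x - (∫ z, bi c ℓ z * h z) / bv d ℓ)

/-- integral of `|h|` on the box -/
def bm (h : XX d → ℝ) (c : XX d) (ℓ : ℝ) : ℝ := ∫ z, bi c ℓ z * |h z|

theorem bm_split {ℓ : ℝ} (hℓ : 0 < ℓ) (c : XX d) {h : XX d → ℝ} (hh : Integrable h) : ∑ e, bm h (ch c ℓ e) (ℓ / 2) = bm h c ℓ := by
  unfold bm
  rw [← integral_finsetSum _ fun e _ => bi_mul_int _ _ hh.abs]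
  refine integral_congr_ae (Eventually.of_forall fun z => ?_)
  simp only
  rw [← Finset.sum_mul, bi_split hℓ]

theorem bm_nn (h : XX d → ℝ) (c : XX d) (ℓ : ℝ) : 0 ≤ bm h c ℓ := integral_nonneg fun z => mul_nonneg (bi_nn _ _ _) (abs_nonneg _)

theorem abs_int_le_bm (h : XX d → ℝ) (c : XX d) (ℓ : ℝ) : |∫ z, bi c ℓ z * h z| ≤ bm h c ℓ := by
  refine (abs_integral_le_integral_abs).trans (le_of_eq ?_)
  unfold bm
  congr 1; ext z
  rw [abs_mul, abs_of_nonneg (bi_nn _ _ _)]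

/-- Calderon-Zygmund decomposition on a box -/
def Dec (h : XX d → ℝ) (lam K : ℝ) (c : XX d) (ℓ : ℝ) : Prop :=
  ∃ (ι : Type) (_ : Fintype ι) (cc : ι → XX d) (ll : ι → ℝ) (g : XX d → ℝ),
    (∀ k, 0 < ll k) ∧ Measurable g ∧ (∀ x, bi c ℓ x * h x = g x + ∑ k, bet h (cc k) (ll k) x) ∧
    (∀ x, |g x| ≤ K * bi c ℓ x) ∧ (∫ x, |g x| ≤ bm h c ℓ) ∧ (lam * ∑ k, bv d (ll k) ≤ bm h c ℓ) ∧ (∑ k, bm h (cc k) (ll k) ≤ bm h c ℓ)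

theorem Dec.sum {h : XX d → ℝ} {lam K : ℝ} {c : XX d} {ℓ : ℝ} (hℓ : 0 < ℓ) (hh : Integrable h)
    (H : ∀ e, Dec h lam K (ch c ℓ e) (ℓ / 2)) : Dec h lam K c ℓ := by
  choose ι hι cc ll g h1 h2 h3 h4 h5 h6 h7 using H
  have gi : ∀ e, Integrable (g e) := fun e => by
    refine ((bi_integrable (ch c ℓ e) (ℓ / 2)).const_mul K).mono' (h2 e).aestronglyMeasurable (Eventually.of_forall fun x => ?_)
    exact h4 e x
  refine ⟨Σ e, ι e, inferInstance, fun k => cc k.1 k.2, fun k => ll k.1 k.2, fun x => ∑ e, g e x, fun k => h1 _ _,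
    Finset.measurable_fun_sum _ fun e _ => h2 e, fun x => ?_, fun x => ?_, ?_, ?_, ?_⟩
  · rw [← bi_split hℓ, Finset.sum_mul, Finset.sum_congr rfl fun e _ => h3 e x, Finset.sum_add_distrib, Fintype.sum_sigma]
  · rw [← bi_split hℓ, Finset.mul_sum]
    exact (Finset.abs_sum_le_sum_abs _ _).trans (Finset.sum_le_sum fun e _ => h4 e x)
  · rw [← bm_split hℓ _ hh]
    calc _ ≤ ∫ x, ∑ e, |g e x| := by
          refine integral_mono (integrable_finsetSum _ fun e _ => gi e).abs (integrable_finsetSum _ fun e _ => (gi e).abs) fun x => ?_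
          exact Finset.abs_sum_le_sum_abs _ _
      _ = ∑ e, ∫ x, |g e x| := integral_finsetSum _ fun e _ => (gi e).abs
      _ ≤ _ := Finset.sum_le_sum fun e _ => h5 e
  · rw [← bm_split hℓ _ hh, Fintype.sum_sigma, Finset.mul_sum]
    exact Finset.sum_le_sum fun e _ => h6 e
  · rw [← bm_split hℓ _ hh, Fintype.sum_sigma]
    exact Finset.sum_le_sum fun e _ => h7 e

theorem Dec.leaf {h : XX d → ℝ} {lam K : ℝ} {c : XX d} {ℓ : ℝ} (hℓ : 0 < ℓ) (hK : 0 ≤ K)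
    (h1 : lam * bv d ℓ ≤ bm h c ℓ) (h2 : bm h c ℓ ≤ K * bv d ℓ) : Dec h lam K c ℓ := by
  have hv := bv_pos (d := d) hℓ
  have hab : |(∫ z, bi c ℓ z * h z) / bv d ℓ| ≤ K := by
    rw [abs_div, abs_of_pos hv, div_le_iff₀ hv]
    exact (abs_int_le_bm h c ℓ).trans h2
  refine ⟨Unit, inferInstance, fun _ => c, fun _ => ℓ, fun x => bi c ℓ x * ((∫ z, bi c ℓ z * h z) / bv d ℓ), fun _ => hℓ,
    (bi_meas c ℓ).mul_const _, fun x => ?_, fun x => ?_, ?_, ?_, ?_⟩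
  · simp [bet]; ring
  · rw [abs_mul, abs_of_nonneg (bi_nn _ _ _), mul_comm]
    exact mul_le_mul_of_nonneg_right hab (bi_nn _ _ _)
  · simp_rw [abs_mul, abs_of_nonneg (bi_nn _ _ _)]
    rw [integral_mul_const, bi_int c hℓ.le, abs_div, abs_of_pos hv, mul_div_cancel₀ _ hv.ne']
    exact abs_int_le_bm h c ℓ
  · simpa using h1
  · simp

theorem Dec.base {h : XX d → ℝ} (hm : Measurable h) (hh : Integrable h) {lam K : ℝ} {c : XX d} {ℓ : ℝ} (hℓ : 0 < ℓ) (hK : 2 * lam ≤ K)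
    (h1 : bm h c ℓ ≤ lam * bv d ℓ) (h2 : ∀ x y, bi c ℓ x ≠ 0 → bi c ℓ y ≠ 0 → |h x - h y| ≤ lam) : Dec h lam K c ℓ := by
  have hv := bv_pos (d := d) hℓ
  refine ⟨Empty, inferInstance, fun _ => c, fun _ => ℓ, fun x => bi c ℓ x * h x, fun _ => hℓ, (bi_meas c ℓ).mul hm,
    fun x => by simp, fun x => ?_, ?_, ?_, ?_⟩
  · rcases bi_01 c ℓ x with hx | hx
    · simp [hx]
    simp only
    rw [hx, one_mul, mul_one]
    refine le_trans ?_ hK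
    have : ∫ y, bi c ℓ y * |h x| ≤ ∫ y, (bi c ℓ y * |h y| + bi c ℓ y * lam) := by
      refine integral_mono ((bi_integrable c ℓ).mul_const _) ((bi_mul_int c ℓ hh.abs).add ((bi_integrable c ℓ).mul_const _)) fun y => ?_
      simp only
      rcases bi_01 c ℓ y with hy | hy
      · simp [hy]
      rw [hy]
      have h3 := h2 x y (by simp [hx]) (by simp [hy])
      have h4 := abs_sub_abs_le_abs_sub (h x) (h y)
      linarith
    rw [integral_mul_const, integral_add (bi_mul_int c ℓ hh.abs) ((bi_integrable c ℓ).mul_const _), integral_mul_const, bi_int c hℓ.le] at this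
    have h5 : bv d ℓ * |h x| ≤ bv d ℓ * (2 * lam) := by
      have : bv d ℓ * |h x| ≤ bm h c ℓ + bv d ℓ * lam := this
      linarith
    exact le_of_mul_le_mul_left h5 hv
  · unfold bm
    refine le_of_eq (integral_congr_ae (Eventually.of_forall fun x => ?_))
    simp only [abs_mul, abs_of_nonneg (bi_nn _ _ _)]
  · simpa using bm_nn h c ℓ
  · simpa using bm_nn h c ℓ

theorem bm_mono_ch {ℓ : ℝ} (hℓ : 0 < ℓ) (c : XX d) {h : XX d → ℝ} (hh : Integrable h) (e) : bm h (ch c ℓ e) (ℓ / 2) ≤ bm h c ℓ := by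
  rw [← bm_split hℓ c hh]
  exact Finset.single_le_sum (f := fun e => bm h (ch c ℓ e) (ℓ / 2)) (fun e _ => bm_nn _ _ _) (Finset.mem_univ e)

theorem dec {h : XX d → ℝ} (hm : Measurable h) (hh : Integrable h) {lam r : ℝ} (hl : 0 < lam) (hr : 0 < r)
    (H : ∀ x y : XX d, |x.1 - y.1| ≤ r ^ 2 → ‖x.2 - y.2‖ ≤ r → |h x - h y| ≤ lam) (M : ℕ) :
    ∀ (ℓ : ℝ) (c : XX d), 0 < ℓ → ℓ ≤ r * 2 ^ M → bm h c ℓ ≤ lam * bv d ℓ → Dec h lam (2 ^ (d + 2) * lam) c ℓ := by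
  induction M with
  | zero =>
    intro ℓ c hℓ hlr hb
    have h2 : (2:ℝ) ≤ 2 ^ (d + 2) := by
      calc (2:ℝ) = 2 ^ 1 := by norm_num
        _ ≤ _ := pow_le_pow_right₀ (by norm_num) (by omega)
    refine Dec.base hm hh hℓ (by gcongr) hb fun x y hx hy => ?_
    obtain ⟨a, b⟩ := bi_dist hℓ hx hy
    have hlr : ℓ ≤ r := by simpa using hlr
    exact H x y (a.trans (by gcongr)) (b.trans hlr)
  | succ M ih =>
    intro ℓ c hℓ hlr hb
    refine Dec.sum hℓ hh fun e => ?_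
    by_cases hc : bm h (ch c ℓ e) (ℓ / 2) ≤ lam * bv d (ℓ / 2)
    · refine ih _ _ (by positivity) ?_ hc
      rw [pow_succ] at hlr; linarith
    · push Not at hc
      refine Dec.leaf (by positivity) (by positivity) hc.le ?_
      refine ((bm_mono_ch hℓ c hh e).trans hb).trans (le_of_eq ?_)
      rw [bv_half ℓ]; ring

end MR

end

section

namespace MR
open ProbabilityTheory Matrix Filter Topology

variable {d : ℕ}

theorem bet_meas {h : XX d → ℝ} (hm : Measurable h) (c : XX d) (ℓ : ℝ) : Measurable (bet h c ℓ) := by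
  unfold bet; exact (bi_meas c ℓ).mul (hm.sub_const _)

theorem bet_integrable {h : XX d → ℝ} (hh : Integrable h) (c : XX d) (ℓ : ℝ) : Integrable (bet h c ℓ) := by
  unfold bet
  simp_rw [mul_sub]
  exact (bi_mul_int c ℓ hh).sub ((bi_integrable c ℓ).mul_const _)

theorem bet_int {h : XX d → ℝ} (hh : Integrable h) (c : XX d) {ℓ : ℝ} (hℓ : 0 < ℓ) : ∫ z, bet h c ℓ z = 0 := by
  unfold bet
  simp_rw [mul_sub]
  rw [integral_sub (bi_mul_int c ℓ hh) ((bi_integrable c ℓ).mul_const _), integral_mul_const, bi_int c hℓ.le, mul_div_cancel₀ _ (bv_pos hℓ).ne', sub_self]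

theorem bet_L1 {h : XX d → ℝ} (hh : Integrable h) (c : XX d) {ℓ : ℝ} (hℓ : 0 < ℓ) : ∫⁻ z, ‖bet h c ℓ z‖ₑ ≤ ENNReal.ofReal (2 * bm h c ℓ) := by
  have hv := bv_pos (d := d) hℓ
  rw [← ofReal_integral_norm_eq_lintegral_enorm (bet_integrable hh c ℓ)]
  apply ENNReal.ofReal_le_ofReal
  calc _ ≤ ∫ z, (bi c ℓ z * |h z| + bi c ℓ z * |(∫ z, bi c ℓ z * h z) / bv d ℓ|) := by
        refine integral_mono (bet_integrable hh c ℓ).norm ((bi_mul_int c ℓ hh.abs).add ((bi_integrable c ℓ).mul_const _)) fun z => ?_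
        simp only [bet, Real.norm_eq_abs, abs_mul, abs_of_nonneg (bi_nn _ _ _), ← mul_add]
        exact mul_le_mul_of_nonneg_left (abs_sub _ _) (bi_nn _ _ _)
    _ ≤ _ := by
        rw [integral_add (bi_mul_int c ℓ hh.abs) ((bi_integrable c ℓ).mul_const _), integral_mul_const, bi_int c hℓ.le, abs_div, abs_of_pos hv, mul_div_cancel₀ _ hv.ne']
        have := abs_int_le_bm h c ℓ
        unfold bm at *
        linarith

theorem bet_supp {h : XX d → ℝ} {c : XX d} {ℓ : ℝ} (hℓ : 0 < ℓ) (z : XX d) (hz : bet h c ℓ z ≠ 0) :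
    c.1 ≤ z.1 ∧ z.1 ≤ c.1 + ℓ ^ 2 ∧ ‖z.2 - c.2‖ ≤ ℓ := bi_supp' hℓ (left_ne_zero_of_mul hz)

/-- weak type constant -/
def CW (d : ℕ) : ℝ := 256 * 2 ^ (d + 2) + 2 * 6 ^ d + 4 * AH d

theorem CW_pos (d : ℕ) : 0 < CW d := by have := AH_nn d; unfold CW; positivity

theorem bad_part {η : ℝ} (hη : 0 < η) (i j : Fin d) {h : XX d → ℝ} (hm : Measurable h) (hh : Integrable h) {ι : Type} [Fintype ι]
    (cc : ι → XX d) (ll : ι → ℝ) (hl : ∀ k, 0 < ll k) {lam : ℝ} (hlam : 0 < lam)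
    (h6 : lam * ∑ k, bv d (ll k) ≤ ∫ x, |h x|) (h7 : ∑ k, bm h (cc k) (ll k) ≤ ∫ x, |h x|) :
    volume {x | lam / 2 < |∑ k, TT η i j (bet h (cc k) (ll k)) x|} ≤ ENNReal.ofReal ((2 * 6 ^ d + 4 * AH d) * lam⁻¹ * ∫ x, |h x|) := by
  have hA := AH_nn d
  have hI : 0 ≤ ∫ x, |h x| := integral_nonneg fun x => abs_nonneg _
  set E : Set (XX d) := ⋃ k, {x | x - cc k ∈ BS d (ll k)} with hE
  have Em : MeasurableSet E := MeasurableSet.iUnion fun k => (BS_meas _).preimage (measurable_id.sub_const _)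
  have tm : ∀ k, Measurable (TT η i j (bet h (cc k) (ll k))) := fun k => (TT_meas hη i j (bet_integrable hh _ _).1).measurable
  have v1 : volume E ≤ ENNReal.ofReal (2 * 6 ^ d * lam⁻¹ * ∫ x, |h x|) := by
    calc _ ≤ ∑ k, volume {x : XX d | x - cc k ∈ BS d (ll k)} := measure_iUnion_fintype_le _ _
      _ = ENNReal.ofReal (2 * 6 ^ d) * ENNReal.ofReal (∑ k, bv d (ll k)) := by
          rw [ENNReal.ofReal_sum_of_nonneg fun k _ => (bv_pos (hl k)).le, Finset.mul_sum]
          exact Finset.sum_congr rfl fun k _ => BS_vol (hl k) _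
      _ ≤ _ := by
          rw [← ENNReal.ofReal_mul (by positivity)]
          apply ENNReal.ofReal_le_ofReal
          have e0 : 2 * 6 ^ d * lam⁻¹ * ∫ x, |h x| = 2 * 6 ^ d * (lam⁻¹ * ∫ x, |h x|) := by ring
          rw [e0]
          refine mul_le_mul_of_nonneg_left ?_ (by positivity)
          rw [← div_eq_inv_mul, le_div_iff₀ hlam, mul_comm]; exact h6
  have v2 : ∫⁻ x in Eᶜ, ‖∑ k, TT η i j (bet h (cc k) (ll k)) x‖ₑ ≤ ENNReal.ofReal (2 * AH d * ∫ x, |h x|) := by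
    calc _ ≤ ∫⁻ x in Eᶜ, ∑ k, ‖TT η i j (bet h (cc k) (ll k)) x‖ₑ := lintegral_mono fun x => enorm_sum_le _ _
      _ = ∑ k, ∫⁻ x in Eᶜ, ‖TT η i j (bet h (cc k) (ll k)) x‖ₑ := lintegral_finsetSum _ fun k _ => (tm k).enorm
      _ ≤ ∑ k, ENNReal.ofReal (2 * AH d * bm h (cc k) (ll k)) := by
          refine Finset.sum_le_sum fun k _ => ?_
          calc _ ≤ ∫⁻ x in {x | x - cc k ∈ BS d (ll k)}ᶜ, ‖TT η i j (bet h (cc k) (ll k)) x‖ₑ := by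
                refine lintegral_mono_set (compl_subset_compl.2 ?_)
                exact subset_iUnion (fun k => {x | x - cc k ∈ BS d (ll k)}) k
            _ ≤ _ := hor_TT hη (hl k) i j (cc k) (bet_meas hm _ _) (bet_integrable hh _ _) (bet_supp (hl k)) (bet_int hh _ (hl k))
            _ ≤ ENNReal.ofReal (AH d) * ENNReal.ofReal (2 * bm h (cc k) (ll k)) := by gcongr; exact bet_L1 hh _ (hl k)
            _ = _ := by rw [← ENNReal.ofReal_mul hA]; congr 1; ring
      _ = ENNReal.ofReal (2 * AH d * ∑ k, bm h (cc k) (ll k)) := by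
          rw [← ENNReal.ofReal_sum_of_nonneg fun k _ => mul_nonneg (by positivity) (bm_nn _ _ _), Finset.mul_sum]
      _ ≤ _ := by
          apply ENNReal.ofReal_le_ofReal
          exact mul_le_mul_of_nonneg_left h7 (by positivity)
  set S := {x | lam / 2 < |∑ k, TT η i j (bet h (cc k) (ll k)) x|} with hS
  have Sm : MeasurableSet S := by
    have : Measurable fun x => ∑ k, TT η i j (bet h (cc k) (ll k)) x := Finset.measurable_fun_sum _ fun k _ => tm k
    exact measurableSet_lt measurable_const this.abs
  have v3 : ENNReal.ofReal (lam / 2) * volume (S ∩ Eᶜ) ≤ ENNReal.ofReal (2 * AH d * ∫ x, |h x|) := by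
    refine le_trans ?_ v2
    have := Finset.measurable_fun_sum Finset.univ fun k _ => tm k
    refine le_trans ?_ (mul_meas_ge_le_lintegral (μ := volume.restrict Eᶜ) (this.enorm) (ENNReal.ofReal (lam / 2)))
    rw [← Measure.restrict_apply Sm]
    refine mul_le_mul_right ?_ _
    refine measure_mono fun x hx => ?_
    have hx : lam / 2 < |∑ k, TT η i j (bet h (cc k) (ll k)) x| := hx
    simp only [mem_setOf_eq]
    rw [← ofReal_norm_eq_enorm]
    exact ENNReal.ofReal_le_ofReal hx.le
  have v4 : volume (S ∩ Eᶜ) ≤ ENNReal.ofReal (4 * AH d * lam⁻¹ * ∫ x, |h x|) := by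
    have : volume (S ∩ Eᶜ) ≤ ENNReal.ofReal (2 * AH d * ∫ x, |h x|) / ENNReal.ofReal (lam / 2) := by
      rw [ENNReal.le_div_iff_mul_le (Or.inl (by simpa using hlam)) (Or.inl ENNReal.ofReal_ne_top), mul_comm]
      exact v3
    refine this.trans (le_of_eq ?_)
    rw [← ENNReal.ofReal_div_of_pos (by positivity)]
    congr 1; field_simp; ring
  calc volume S ≤ volume (E ∪ (S ∩ Eᶜ)) := measure_mono fun x hx => by
        by_cases h : x ∈ E
        · exact Or.inl h
        · exact Or.inr ⟨hx, h⟩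
    _ ≤ _ := measure_union_le _ _
    _ ≤ ENNReal.ofReal (2 * 6 ^ d * lam⁻¹ * ∫ x, |h x|) + ENNReal.ofReal (4 * AH d * lam⁻¹ * ∫ x, |h x|) := add_le_add v1 v4
    _ = _ := by
        rw [← ENNReal.ofReal_add (by positivity) (by positivity)]
        congr 1; ring

theorem good_part {η : ℝ} (hη : 0 < η) (i j : Fin d) {g : XX d → ℝ} (hg : Measurable g) (gi : Integrable g) {K : ℝ} (hK : 0 ≤ K) (hb : ∀ x, |g x| ≤ K)
    {lam : ℝ} (hlam : 0 < lam) : volume {x | lam / 2 < |TT η i j g x|} ≤ ENNReal.ofReal (256 * K * (lam ^ 2)⁻¹ * ∫ x, |g x|) := by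
  have hI : 0 ≤ ∫ x, |g x| := integral_nonneg fun x => abs_nonneg _
  have l2 : ∫⁻ x, ‖g x‖ₑ ^ (2:ℝ) ≤ ENNReal.ofReal (K * ∫ x, |g x|) := by
    calc _ ≤ ∫⁻ x, ENNReal.ofReal K * ‖g x‖ₑ := by
          refine lintegral_mono fun x => ?_
          have : ‖g x‖ₑ ≤ ENNReal.ofReal K := by
            rw [← ofReal_norm_eq_enorm]; exact ENNReal.ofReal_le_ofReal (hb x)
          rw [ENNReal.rpow_two, pow_two]; gcongr
      _ = _ := by
          rw [lintegral_const_mul _ hg.enorm, ← ofReal_integral_norm_eq_lintegral_enorm gi, ← ENNReal.ofReal_mul hK]; rfl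
  have gL : MemLp g 2 volume := by
    refine ⟨hg.aestronglyMeasurable, ?_⟩
    rw [eLpNorm_lt_top_iff_lintegral_rpow_enorm_lt_top (by norm_num) (by norm_num)]
    simp only [ENNReal.toReal_ofNat]
    exact l2.trans_lt ENNReal.ofReal_lt_top
  have tm := (TT_meas hη i j gi.1).measurable
  have v3 : ENNReal.ofReal ((lam / 2) ^ 2) * volume {x | lam / 2 < |TT η i j g x|} ≤ ENNReal.ofReal (64 * (K * ∫ x, |g x|)) := by
    have e64 : ENNReal.ofReal (64 * (K * ∫ x, |g x|)) = 64 * ENNReal.ofReal (K * ∫ x, |g x|) := by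
      rw [ENNReal.ofReal_mul (by norm_num)]; simp
    refine le_trans ?_ (((TT_L2 hη i j gL).trans (by gcongr)).trans_eq e64.symm)
    refine le_trans ?_ (mul_meas_ge_le_lintegral (μ := volume) (tm.enorm.pow_const 2) (ENNReal.ofReal ((lam / 2) ^ 2)))
    gcongr with x
    intro hx
    simp only [← ofReal_norm_eq_enorm]
    rw [ENNReal.ofReal_rpow_of_nonneg (norm_nonneg _) (by norm_num)]
    apply ENNReal.ofReal_le_ofReal
    rw [Real.rpow_two]
    exact pow_le_pow_left₀ (by positivity) hx.le 2
  have : volume {x | lam / 2 < |TT η i j g x|} ≤ ENNReal.ofReal (64 * (K * ∫ x, |g x|)) / ENNReal.ofReal ((lam / 2) ^ 2) := by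
    rw [ENNReal.le_div_iff_mul_le (Or.inl (by simp; positivity)) (Or.inl ENNReal.ofReal_ne_top), mul_comm]
    exact v3
  refine this.trans (le_of_eq ?_)
  rw [← ENNReal.ofReal_div_of_pos (by positivity)]
  congr 1; field_simp; ring

theorem bi_one {c : XX d} {ℓ : ℝ} {z : XX d} (h1 : c.1 ≤ z.1 ∧ z.1 < c.1 + ℓ ^ 2) (h2 : ∀ k, c.2 k ≤ z.2 k ∧ z.2 k < c.2 k + ℓ) : bi c ℓ z = 1 := by
  unfold bi I1
  rw [if_pos h1, Finset.prod_congr rfl fun k _ => if_pos (h2 k)]; simp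

theorem weak11 {η : ℝ} (hη : 0 < η) (i j : Fin d) {h : XX d → ℝ} (hh : CCf h) {lam : ℝ} (hlam : 0 < lam) :
    volume {x | lam < |TT η i j h x|} ≤ ENNReal.ofReal (CW d * lam⁻¹ * ∫ x, |h x|) := by
  have hi := hh.integrable
  have hm := hh.1.measurable
  have hI : 0 ≤ ∫ x, |h x| := integral_nonneg fun x => abs_nonneg _
  have hu : UniformContinuous h := hh.2.uniformContinuous_of_continuous hh.1
  obtain ⟨δ, hδ, Hδ⟩ := Metric.uniformContinuous_iff.1 hu lam hlam
  set r := min (δ / 2) (1 / 2) with hr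
  have hr0 : 0 < r := by positivity
  have hr1 : r ≤ 1 / 2 := min_le_right _ _
  have hr2 : r < δ := (min_le_left _ _).trans_lt (by linarith)
  have H : ∀ x y : XX d, |x.1 - y.1| ≤ r ^ 2 → ‖x.2 - y.2‖ ≤ r → |h x - h y| ≤ lam := by
    intro x y h1 h2
    refine (Hδ (a := x) (b := y) ?_).le
    rw [Prod.dist_eq, max_lt_iff, Real.dist_eq, dist_eq_norm]
    exact ⟨h1.trans_lt (by nlinarith), h2.trans_lt hr2⟩
  obtain ⟨R0, hR0⟩ := hh.2.isCompact.isBounded.subset_closedBall (0 : XX d)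
  set R := max R0 0 with hR
  have hRn : 0 ≤ R := le_max_right _ _
  set L := 1 + 2 * R + (∫ x, |h x|) / lam with hL
  have hq : 0 ≤ (∫ x, |h x|) / lam := by positivity
  have hL1 : 1 ≤ L := by linarith
  have hL2 : L ≤ L ^ 2 := by nlinarith
  set c : XX d := (-R, fun _ => -R) with hc
  have hbi : ∀ x, bi c L x * h x = h x := by
    intro x
    by_cases hx : h x = 0
    · simp [hx]
    have h1 := hR0 (subset_tsupport _ hx)
    rw [Metric.mem_closedBall, dist_zero_right] at h1
    have h2 : ‖x‖ ≤ R := h1.trans (le_max_left _ _)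
    have h3 := (norm_fst_le x).trans h2
    have h4 := (norm_snd_le x).trans h2
    rw [Real.norm_eq_abs, abs_le] at h3
    rw [bi_one, one_mul]
    · simp only [hc]; constructor <;> linarith
    · intro k
      have h5 := (norm_le_pi_norm x.2 k).trans h4
      rw [Real.norm_eq_abs, abs_le] at h5
      simp only [hc]; constructor <;> linarith
  have hbm : bm h c L = ∫ x, |h x| := by
    unfold bm
    refine integral_congr_ae (Eventually.of_forall fun x => ?_)
    simp only
    rw [← abs_of_nonneg (bi_nn c L x), ← abs_mul, hbi]
  obtain ⟨M, hM⟩ := pow_unbounded_of_one_lt (L / r) (by norm_num : (1:ℝ) < 2)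
  have hD := dec hm hi hlam hr0 H M L c (by linarith) (by rw [div_lt_iff₀ hr0] at hM; linarith) (by
    rw [hbm, ← div_le_iff₀' hlam]
    unfold bv
    have : 1 ≤ L ^ d := one_le_pow₀ hL1
    nlinarith)
  obtain ⟨ι, _, cc, ll, g, d1, d2, d3, d4, d5, d6, d7⟩ := hD
  rw [hbm] at d5 d6 d7
  have gi : Integrable g := ((bi_integrable c L).const_mul _).mono' d2.aestronglyMeasurable (Eventually.of_forall d4)
  have hb : ∀ x, |g x| ≤ 2 ^ (d + 2) * lam := fun x => (d4 x).trans (mul_le_of_le_one_right (by positivity) (bi_le _ _ _))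
  have hT : ∀ x, TT η i j h x = TT η i j g x + ∑ k, TT η i j (bet h (cc k) (ll k)) x := by
    intro x
    unfold TT
    rw [← integral_finsetSum _ fun k _ => TT_int1 hη i j (bet_integrable hi (cc k) (ll k)) x,
      ← integral_add (TT_int1 hη i j gi x) (integrable_finsetSum _ fun k _ => TT_int1 hη i j (bet_integrable hi (cc k) (ll k)) x)]
    refine integral_congr_ae (Eventually.of_forall fun z => ?_)
    simp only
    rw [← Finset.mul_sum, ← mul_add, ← d3, hbi]
  have hA := AH_nn d
  calc _ ≤ volume ({x | lam / 2 < |TT η i j g x|} ∪ {x | lam / 2 < |∑ k, TT η i j (bet h (cc k) (ll k)) x|}) := by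
        refine measure_mono fun x hx => ?_
        have hx : lam < |TT η i j h x| := hx
        rw [hT] at hx
        have := abs_add_le (TT η i j g x) (∑ k, TT η i j (bet h (cc k) (ll k)) x)
        by_contra hn
        simp only [mem_union, mem_setOf_eq, not_or, not_lt] at hn
        linarith [hn.1, hn.2]
    _ ≤ _ := measure_union_le _ _
    _ ≤ ENNReal.ofReal (256 * (2 ^ (d + 2) * lam) * (lam ^ 2)⁻¹ * ∫ x, |g x|) + ENNReal.ofReal ((2 * 6 ^ d + 4 * AH d) * lam⁻¹ * ∫ x, |h x|) :=
        add_le_add (good_part hη i j d2 gi (by positivity) hb hlam) (bad_part hη i j hm hi cc ll d1 hlam d6 d7)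
    _ ≤ ENNReal.ofReal (256 * 2 ^ (d + 2) * lam⁻¹ * ∫ x, |h x|) + ENNReal.ofReal ((2 * 6 ^ d + 4 * AH d) * lam⁻¹ * ∫ x, |h x|) := by
        gcongr ?_ + _
        apply ENNReal.ofReal_le_ofReal
        calc _ = 256 * 2 ^ (d + 2) * lam⁻¹ * ∫ x, |g x| := by field_simp
          _ ≤ _ := mul_le_mul_of_nonneg_left d5 (by positivity)
    _ = _ := by
        rw [← ENNReal.ofReal_add (by positivity) (by positivity)]
        congr 1; unfold CW; ring

end MR

end

section

namespace MR
open ProbabilityTheory Matrix Filter Topology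

variable {d : ℕ}

/-- pointwise kernel for the distribution function -/
def mz (A t s : ℝ) : ℝ≥0∞ := if t < 2 * s then ENNReal.ofReal (A * s * t⁻¹) else ENNReal.ofReal (256 * s ^ 2 * (t ^ 2)⁻¹)

theorem mz_meas (A : ℝ) : Measurable (fun z : ℝ × ℝ => mz A z.1 z.2) := by
  unfold mz
  refine Measurable.ite (measurableSet_lt measurable_fst (measurable_snd.const_mul 2)) ?_ ?_
  · fun_prop
  · fun_prop

theorem mz_int {A q s : ℝ} (hA : 0 ≤ A) (hq1 : 1 < q) (hq2 : q < 2) (hs : 0 ≤ s) :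
    ∫⁻ t in Ioi (0:ℝ), mz A t s * ENNReal.ofReal (t ^ (q - 1)) ≤
      ENNReal.ofReal (A * 2 ^ (q - 1) / (q - 1) + 256 * 2 ^ (q - 2) / (2 - q)) * ENNReal.ofReal (s ^ q) := by
  rcases hs.eq_or_lt with rfl | hs
  · refine le_trans (le_of_eq ?_) bot_le
    rw [setLIntegral_congr_fun (g := fun _ => 0) measurableSet_Ioi]
    · simp
    · intro t ht
      have : ¬ t < 2 * (0:ℝ) := by simpa using (le_of_lt ht)
      simp [mz, this]
  have h2s : 0 < 2 * s := by positivity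
  have hq1' : 0 < q - 1 := by linarith
  have hq2' : 0 < 2 - q := by linarith
  rw [← Ioc_union_Ioi_eq_Ioi h2s.le]
  refine (lintegral_union_le _ _ _).trans ?_
  have b1 : ∫⁻ t in Ioc 0 (2 * s), mz A t s * ENNReal.ofReal (t ^ (q - 1)) ≤ ENNReal.ofReal (A * 2 ^ (q - 1) / (q - 1) * s ^ q) := by
    have hi : IntegrableOn (fun t : ℝ => A * s * t ^ (q - 2)) (Ioc 0 (2 * s)) := by
      have := intervalIntegral.intervalIntegrable_rpow' (a := 0) (b := 2 * s) (r := q - 2) (by linarith)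
      rw [intervalIntegrable_iff_integrableOn_Ioc_of_le h2s.le] at this
      exact this.const_mul _
    calc _ ≤ ∫⁻ t in Ioc 0 (2 * s), ENNReal.ofReal (A * s * t ^ (q - 2)) := by
          have hae : ∀ᵐ t ∂(volume.restrict (Ioc 0 (2 * s))), t ≠ 2 * s := ae_restrict_of_ae (Measure.ae_ne volume _)
          refine lintegral_mono_ae ?_
          filter_upwards [hae, ae_restrict_mem measurableSet_Ioc] with t ht ht2
          have ht3 : t < 2 * s := lt_of_le_of_ne ht2.2 ht
          have ht0 : 0 < t := ht2.1
          rw [mz, if_pos ht3, ← ENNReal.ofReal_mul (by positivity)]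
          apply le_of_eq; congr 1
          rw [mul_assoc, ← Real.rpow_neg_one, ← Real.rpow_add ht0]; congr 2; ring
      _ = ENNReal.ofReal (∫ t in Ioc 0 (2 * s), A * s * t ^ (q - 2)) := by
          rw [ofReal_integral_eq_lintegral_ofReal hi]
          exact (ae_restrict_mem measurableSet_Ioc).mono fun t ht => mul_nonneg (by positivity) (Real.rpow_nonneg ht.1.le _)
      _ = _ := by
          congr 1
          rw [integral_const_mul, ← intervalIntegral.integral_of_le h2s.le, integral_rpow (Or.inl (by linarith))]
          have e : q - 2 + 1 = q - 1 := by ring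
          rw [e, Real.zero_rpow hq1'.ne', Real.mul_rpow (by norm_num) hs.le]
          have : s ^ q = s * s ^ (q - 1) := by
            nth_rewrite 2 [← Real.rpow_one s]; rw [← Real.rpow_add hs]; congr 1; ring
          rw [this]; ring
  have b2 : ∫⁻ t in Ioi (2 * s), mz A t s * ENNReal.ofReal (t ^ (q - 1)) ≤ ENNReal.ofReal (256 * 2 ^ (q - 2) / (2 - q) * s ^ q) := by
    have hi : IntegrableOn (fun t : ℝ => 256 * s ^ 2 * t ^ (q - 3)) (Ioi (2 * s)) := (integrableOn_Ioi_rpow_of_lt (by linarith) h2s).const_mul _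
    calc _ ≤ ∫⁻ t in Ioi (2 * s), ENNReal.ofReal (256 * s ^ 2 * t ^ (q - 3)) := by
          refine lintegral_mono_ae ?_
          filter_upwards [ae_restrict_mem measurableSet_Ioi] with t ht
          have ht3 : ¬ t < 2 * s := not_lt.2 (le_of_lt ht)
          have ht0 : 0 < t := h2s.trans ht
          rw [mz, if_neg ht3, ← ENNReal.ofReal_mul (by positivity)]
          apply le_of_eq; congr 1
          have : (t ^ 2)⁻¹ = t ^ (-2 : ℝ) := by rw [Real.rpow_neg ht0.le]; norm_num
          rw [mul_assoc, this, ← Real.rpow_add ht0]; congr 2; ring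
      _ = ENNReal.ofReal (∫ t in Ioi (2 * s), 256 * s ^ 2 * t ^ (q - 3)) := by
          rw [ofReal_integral_eq_lintegral_ofReal hi]
          exact (ae_restrict_mem measurableSet_Ioi).mono fun t ht => mul_nonneg (by positivity) (Real.rpow_nonneg (h2s.le.trans (le_of_lt ht)) _)
      _ = _ := by
          congr 1
          rw [integral_const_mul, integral_Ioi_rpow_of_lt (by linarith) h2s]
          have e : q - 3 + 1 = q - 2 := by ring
          rw [e, Real.mul_rpow (by norm_num) hs.le]
          have : s ^ q = s ^ 2 * s ^ (q - 2) := by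
            rw [← Real.rpow_natCast s 2, ← Real.rpow_add hs]; congr 1; push_cast; ring
          rw [this]
          have : -(2 ^ (q - 2) * s ^ (q - 2)) / (q - 2) = 2 ^ (q - 2) * s ^ (q - 2) / (2 - q) := by
            rw [neg_div, ← div_neg]; congr 1; ring
          rw [this]; ring
  refine (add_le_add b1 b2).trans (le_of_eq ?_)
  rw [← ENNReal.ofReal_add (by positivity) (by positivity), ← ENNReal.ofReal_mul (by positivity)]
  congr 1; ring

/-- truncation -/
def clp (m x : ℝ) : ℝ := max (-m) (min m x)

theorem clp_cont (m : ℝ) : Continuous (clp m) := by unfold clp; fun_prop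

theorem clp_zero {m : ℝ} (hm : 0 ≤ m) : clp m 0 = 0 := by unfold clp; simp [hm]

theorem clp_abs {m : ℝ} (hm : 0 ≤ m) (x : ℝ) : |clp m x| ≤ m ∧ |clp m x| ≤ |x| := by
  unfold clp
  refine ⟨abs_le.2 ⟨le_max_left _ _, max_le (by linarith) (min_le_left _ _)⟩, ?_⟩
  rcases le_total 0 x with h | h
  · rw [abs_of_nonneg h, max_eq_right ((by linarith : -m ≤ 0).trans (le_min hm h)), abs_of_nonneg (le_min hm h)]; exact min_le_right _ _
  · rw [min_eq_right (h.trans hm), abs_of_nonpos h, abs_of_nonpos (max_le (by linarith) h)]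
    linarith [le_max_right (-m) x]

theorem clp_eq {m : ℝ} {x : ℝ} (h : |x| ≤ m) : clp m x = x := by
  rw [abs_le] at h
  unfold clp; rw [min_eq_right h.2, max_eq_right h.1]

theorem clp_sub {m : ℝ} (hm : 0 ≤ m) (x : ℝ) : |x - clp m x| ≤ |x| := by
  unfold clp
  rcases le_total 0 x with h | h
  · rw [max_eq_right ((by linarith : -m ≤ 0).trans (le_min hm h)), abs_of_nonneg h, abs_le]
    constructor <;> linarith [min_le_right m x, le_min hm h]
  · rw [min_eq_right (h.trans hm), abs_of_nonpos h, abs_le]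
    constructor <;> linarith [le_max_right (-m) x, max_le (by linarith : -m ≤ 0) h]

theorem CCf.clp {h : XX d → ℝ} (hh : CCf h) {m : ℝ} (hm : 0 ≤ m) : CCf (fun x => MR.clp m (h x)) :=
  ⟨(clp_cont m).comp hh.1, hh.2.comp_left (clp_zero hm)⟩

theorem CCf.sub {h k : XX d → ℝ} (hh : CCf h) (hk : CCf k) : CCf (fun x => h x - k x) := ⟨hh.1.sub hk.1, hh.2.sub hk.2⟩

theorem CCf.l1 {h : XX d → ℝ} (hh : CCf h) : ENNReal.ofReal (∫ x, |h x|) = ∫⁻ x, ENNReal.ofReal |h x| :=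
  ofReal_integral_eq_lintegral_ofReal hh.integrable.abs (Eventually.of_forall fun x => abs_nonneg _)

theorem distr {η : ℝ} (hη : 0 < η) (i j : Fin d) {h : XX d → ℝ} (hh : CCf h) {t : ℝ} (ht : 0 < t) :
    volume {x | t < |TT η i j h x|} ≤ ∫⁻ x, mz (2 * CW d + 128) t |h x| := by
  have hC := CW_pos d
  have ht2 : 0 ≤ t / 2 := by positivity
  set h2 : XX d → ℝ := fun x => clp (t / 2) (h x) with hh2
  set h1 : XX d → ℝ := fun x => h x - h2 x with hh1
  have c2 : CCf h2 := hh.clp ht2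
  have c1 : CCf h1 := hh.sub c2
  have hT : ∀ x, TT η i j h x = TT η i j h1 x + TT η i j h2 x := by
    intro x
    unfold TT
    rw [← integral_add (TT_int1 hη i j c1.integrable x) (TT_int1 hη i j c2.integrable x)]
    refine integral_congr_ae (Eventually.of_forall fun z => ?_)
    simp only [hh1]; ring
  have hI := integral_nonneg (μ := volume) (f := fun x => |h1 x|) fun x => abs_nonneg _
  have v1 : volume {x | t / 2 < |TT η i j h1 x|} ≤ ∫⁻ x, ENNReal.ofReal (CW d * (t / 2)⁻¹ * |h1 x|) := by
    refine (weak11 hη i j c1 (by positivity)).trans (le_of_eq ?_)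
    rw [ENNReal.ofReal_mul (by positivity), c1.l1, ← lintegral_const_mul _ (by have := c1.1.measurable; fun_prop)]
    refine lintegral_congr fun x => ?_
    rw [← ENNReal.ofReal_mul (by positivity)]
  have tm := (TT_meas hη i j c2.integrable.1).measurable
  have v2 : volume {x | t / 2 < |TT η i j h2 x|} ≤ ∫⁻ x, ENNReal.ofReal (64 * ((t / 2) ^ 2)⁻¹ * h2 x ^ 2) := by
    have v3 : ENNReal.ofReal ((t / 2) ^ 2) * volume {x | t / 2 < |TT η i j h2 x|} ≤ 64 * ∫⁻ x, ‖h2 x‖ₑ ^ (2:ℝ) := by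
      refine le_trans ?_ (TT_L2 hη i j (c2.memLp 2))
      refine le_trans ?_ (mul_meas_ge_le_lintegral (μ := volume) (tm.enorm.pow_const 2) (ENNReal.ofReal ((t / 2) ^ 2)))
      gcongr with x
      intro hx
      simp only [← ofReal_norm_eq_enorm]
      rw [ENNReal.ofReal_rpow_of_nonneg (norm_nonneg _) (by norm_num)]
      apply ENNReal.ofReal_le_ofReal
      rw [Real.rpow_two]
      exact pow_le_pow_left₀ (by positivity) hx.le 2
    have hne : ENNReal.ofReal ((t / 2) ^ 2) ≠ 0 := by simp; positivity
    rw [mul_comm, ← ENNReal.le_div_iff_mul_le (Or.inl hne) (Or.inl ENNReal.ofReal_ne_top)] at v3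
    refine v3.trans (le_of_eq ?_)
    rw [ENNReal.div_eq_inv_mul, ← mul_assoc, ← lintegral_const_mul _ (by have := c2.1.measurable; fun_prop)]
    refine lintegral_congr fun x => ?_
    rw [← ofReal_norm_eq_enorm, ENNReal.ofReal_rpow_of_nonneg (norm_nonneg _) (by norm_num), ← ENNReal.ofReal_inv_of_pos (by positivity),
      show (64:ℝ≥0∞) = ENNReal.ofReal 64 by simp, ← ENNReal.ofReal_mul (by positivity), ← ENNReal.ofReal_mul (by positivity)]
    congr 1
    rw [Real.rpow_two, Real.norm_eq_abs, sq_abs]; ring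
  calc _ ≤ volume ({x | t / 2 < |TT η i j h1 x|} ∪ {x | t / 2 < |TT η i j h2 x|}) := by
        refine measure_mono fun x hx => ?_
        have hx : t < |TT η i j h x| := hx
        rw [hT] at hx
        have := abs_add_le (TT η i j h1 x) (TT η i j h2 x)
        by_contra hn
        simp only [mem_union, mem_setOf_eq, not_or, not_lt] at hn
        linarith [hn.1, hn.2]
    _ ≤ _ := measure_union_le _ _
    _ ≤ _ := add_le_add v1 v2
    _ = ∫⁻ x, (ENNReal.ofReal (CW d * (t / 2)⁻¹ * |h1 x|) + ENNReal.ofReal (64 * ((t / 2) ^ 2)⁻¹ * h2 x ^ 2)) := by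
        rw [lintegral_add_right]
        have := c2.1.measurable; fun_prop
    _ ≤ _ := by
        refine lintegral_mono fun x => ?_
        rw [← ENNReal.ofReal_add (by positivity) (by positivity), mz]
        obtain ⟨a1, a2⟩ := clp_abs ht2 (h x)
        split_ifs with hx
        · apply ENNReal.ofReal_le_ofReal
          have a3 : |h1 x| ≤ |h x| := clp_sub ht2 (h x)
          have a4 : h2 x ^ 2 ≤ t / 2 * |h x| := by
            rw [← sq_abs, pow_two]
            exact mul_le_mul a1 a2 (abs_nonneg _) ht2
          calc _ ≤ CW d * (t / 2)⁻¹ * |h x| + 64 * ((t / 2) ^ 2)⁻¹ * (t / 2 * |h x|) := by gcongr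
            _ = _ := by field_simp; ring
        · apply ENNReal.ofReal_le_ofReal
          push Not at hx
          have e : clp (t / 2) (h x) = h x := clp_eq (by linarith)
          have : h1 x = 0 := by simp [hh1, hh2, e]
          have e2 : h2 x = h x := e
          rw [this, e2, abs_zero, sq_abs]
          apply le_of_eq; field_simp; norm_num; ring

/-- Marcinkiewicz constant -/
def CM (d : ℕ) (q : ℝ) : ℝ := q * ((2 * CW d + 128) * 2 ^ (q - 1) / (q - 1) + 256 * 2 ^ (q - 2) / (2 - q))

theorem CM_nn (d : ℕ) {q : ℝ} (hq1 : 1 < q) (hq2 : q < 2) : 0 ≤ CM d q := by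
  have := CW_pos d
  have h1 : 0 < q - 1 := by linarith
  have h2 : 0 < 2 - q := by linarith
  unfold CM; positivity

theorem TT_Lq {η : ℝ} (hη : 0 < η) (i j : Fin d) {h : XX d → ℝ} (hh : CCf h) {q : ℝ} (hq1 : 1 < q) (hq2 : q < 2) :
    ∫⁻ x, ‖TT η i j h x‖ₑ ^ q ≤ ENNReal.ofReal (CM d q) * ∫⁻ x, ‖h x‖ₑ ^ q := by
  have hC := CW_pos d
  have tm := (TT_meas hη i j hh.integrable.1).measurable
  have en : ∀ y : ℝ, ‖y‖ₑ ^ q = ENNReal.ofReal (|y| ^ q) := by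
    intro y
    rw [← ofReal_norm_eq_enorm, ENNReal.ofReal_rpow_of_nonneg (norm_nonneg _) (by linarith), Real.norm_eq_abs]
  simp_rw [en]
  have mm : Measurable fun z : ℝ × XX d => mz (2 * CW d + 128) z.1 |h z.2| * ENNReal.ofReal (z.1 ^ (q - 1)) := by
    refine Measurable.mul ?_ (by fun_prop)
    exact (mz_meas (2 * CW d + 128)).comp (measurable_fst.prodMk (hh.1.measurable.comp measurable_snd).abs)
  have mm2 : ∀ t, Measurable fun x : XX d => mz (2 * CW d + 128) t |h x| := fun t =>
    (mz_meas (2 * CW d + 128)).comp (measurable_const.prodMk hh.1.measurable.abs)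
  have := lintegral_rpow_eq_lintegral_meas_lt_mul (volume : Measure (XX d)) (f := fun x => |TT η i j h x|) (Eventually.of_forall fun x => abs_nonneg _)
    tm.abs.aemeasurable (p := q) (by linarith)
  rw [this, CM, ENNReal.ofReal_mul (by linarith), mul_assoc]
  gcongr
  calc _ ≤ ∫⁻ t in Ioi (0:ℝ), ∫⁻ x, mz (2 * CW d + 128) t |h x| * ENNReal.ofReal (t ^ (q - 1)) := by
        refine setLIntegral_mono' measurableSet_Ioi fun t ht => ?_
        rw [lintegral_mul_const _ (mm2 t)]
        gcongr
        exact distr hη i j hh ht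
    _ = ∫⁻ x, ∫⁻ t in Ioi (0:ℝ), mz (2 * CW d + 128) t |h x| * ENNReal.ofReal (t ^ (q - 1)) := lintegral_lintegral_swap mm.aemeasurable
    _ ≤ ∫⁻ x, ENNReal.ofReal ((2 * CW d + 128) * 2 ^ (q - 1) / (q - 1) + 256 * 2 ^ (q - 2) / (2 - q)) * ENNReal.ofReal (|h x| ^ q) :=
        lintegral_mono fun x => mz_int (by positivity) hq1 hq2 (abs_nonneg _)
    _ = _ := lintegral_const_mul _ (by have := hh.1.measurable; fun_prop)

end MR

end

section

namespace MR
open ProbabilityTheory Matrix Filter Topology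

variable {d : ℕ}

theorem eLp_eq {α : Type*} [MeasurableSpace α] {μ : Measure α} {E : Type*} [NormedAddCommGroup E] {r : ℝ} (hr : 0 < r) (h : α → E) :
    eLpNorm h (ENNReal.ofReal r) μ = (∫⁻ z, ‖h z‖ₑ ^ r ∂μ) ^ (1 / r) := by
  rw [eLpNorm_eq_lintegral_rpow_enorm_toReal (by simpa using hr) (by simp), ENNReal.toReal_ofReal hr.le]

theorem CCf.neg {h : XX d → ℝ} (hh : CCf h) : CCf (fun z => h (-z)) :=
  ⟨hh.1.comp continuous_neg, hh.2.comp_homeomorph (Homeomorph.neg (XX d))⟩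

theorem adj {η : ℝ} (hη : 0 < η) (i j : Fin d) {f k : XX d → ℝ} (hf : CCf f) (hk : CCf k) :
    ∫ x, TT η i j f x * k x = ∫ z, f z * TT η i j (fun y => k (-y)) (-z) := by
  have G : Integrable (fun q : XX d × XX d => KK η i j (q.1 - q.2) * (k q.1 * f q.2)) (volume.prod volume) := by
    refine (hk.integrable.mul_prod hf.integrable).bdd_mul ?_ (Eventually.of_forall fun z => KK_bdd hη i j _)
    exact ((KK_meas hη i j).comp (measurable_fst.sub measurable_snd)).aestronglyMeasurable
  calc ∫ x, TT η i j f x * k x = ∫ x, ∫ z, KK η i j (x - z) * (k x * f z) := by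
        congr 1 with x
        rw [TT, ← integral_mul_const]
        congr 1 with z; ring
    _ = ∫ z, ∫ x, KK η i j (x - z) * (k x * f z) := integral_integral_swap G
    _ = _ := by
        congr 1 with z
        rw [TT, ← integral_const_mul, ← integral_neg_eq_self]
        congr 1 with x
        have : -x - z = -z - x := by abel
        rw [this]; ring

theorem dual1 {η : ℝ} (hη : 0 < η) (i j : Fin d) {f k : XX d → ℝ} (hf : CCf f) (hk : CCf k) {p q : ℝ} (hpq : p.HolderConjugate q) (hp : 2 < p) :
    ‖∫ x, TT η i j f x * k x‖ₑ ≤ ENNReal.ofReal (CM d q) ^ (1 / q) * eLpNorm f (ENNReal.ofReal p) volume * eLpNorm k (ENNReal.ofReal q) volume := by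
  have hq1 : 1 < q := hpq.symm.lt
  have hq2 : q < 2 := by
    have := hpq.sub_one_mul_conj
    nlinarith
  rw [adj hη i j hf hk, eLp_eq hpq.pos, eLp_eq hpq.symm.pos]
  refine (enorm_integral_le_lintegral_enorm _).trans ?_
  simp only [enorm_mul]
  have m1 : AEMeasurable (fun z => ‖f z‖ₑ) volume := hf.1.measurable.enorm.aemeasurable
  have m2 : AEMeasurable (fun z => ‖TT η i j (fun y => k (-y)) (-z)‖ₑ) volume :=
    (((TT_meas hη i j hk.neg.integrable.1).measurable).comp measurable_neg).enorm.aemeasurable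
  refine (ENNReal.lintegral_mul_le_Lp_mul_Lq volume hpq m1 m2).trans ?_
  rw [mul_comm (_ ^ (1/q)), mul_assoc]
  refine mul_le_mul_right ?_ _
  rw [← ENNReal.mul_rpow_of_nonneg _ _ (by have := hpq.symm.pos; positivity)]
  refine ENNReal.rpow_le_rpow ?_ (by have := hpq.symm.pos; positivity)
  have e1 : ∫⁻ z, ‖TT η i j (fun y => k (-y)) (-z)‖ₑ ^ q = ∫⁻ z, ‖TT η i j (fun y => k (-y)) z‖ₑ ^ q :=
    lintegral_neg_eq_self (fun z => ‖TT η i j (fun y => k (-y)) z‖ₑ ^ q)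
  have e2 : ∫⁻ z, ‖k z‖ₑ ^ q = ∫⁻ z, ‖k (-z)‖ₑ ^ q := (lintegral_neg_eq_self (fun z => ‖k z‖ₑ ^ q)).symm
  rw [e1, e2]
  exact TT_Lq hη i j hk.neg hq1 hq2

theorem TT_memLp {η : ℝ} (hη : 0 < η) (i j : Fin d) {f : XX d → ℝ} (hf : CCf f) {p : ℝ} (hp : 2 < p) :
    MemLp (TT η i j f) (ENNReal.ofReal p) volume := by
  have hm := (TT_meas hη i j hf.integrable.1)
  set M : ℝ := η⁻¹ * MK η d * ∫ z, |f z| with hM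
  have hi : ∀ x, ‖TT η i j f x‖ ≤ M := by
    intro x
    rw [hM, TT, ← integral_const_mul]
    refine norm_integral_le_of_norm_le (hf.integrable.abs.const_mul _) (Eventually.of_forall fun z => ?_)
    rw [norm_mul]
    exact mul_le_mul_of_nonneg_right (KK_bdd hη i j _) (abs_nonneg _)
  refine ⟨hm.aestronglyMeasurable, ?_⟩
  rw [eLp_eq (by linarith)]
  refine ENNReal.rpow_lt_top_of_nonneg (by have : 0 < p := by linarith
                                           positivity) ?_
  have h2 : ∫⁻ z, ‖TT η i j f z‖ₑ ^ (2:ℝ) < ∞ := by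
    refine (TT_L2 hη i j (hf.memLp 2)).trans_lt ?_
    refine ENNReal.mul_lt_top (by norm_num) ?_
    have e := (hf.memLp 2).2
    have := eLp_eq (μ := volume) (by norm_num : (0:ℝ) < 2) f
    rw [show ENNReal.ofReal 2 = 2 by simp] at this
    rw [this] at e
    by_contra hh
    push Not at hh
    rw [top_le_iff.1 hh] at e
    simp at e
  have h3 : ∫⁻ z, ‖TT η i j f z‖ₑ ^ p ≤ ENNReal.ofReal M ^ (p - 2) * ∫⁻ z, ‖TT η i j f z‖ₑ ^ (2:ℝ) := by
    rw [← lintegral_const_mul _ (hm.measurable.enorm.pow_const _)]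
    refine lintegral_mono fun z => ?_
    have e : ‖TT η i j f z‖ₑ ^ p = ‖TT η i j f z‖ₑ ^ (p - 2) * ‖TT η i j f z‖ₑ ^ (2:ℝ) := by
      rw [← ENNReal.rpow_add_of_nonneg _ _ (by linarith) (by norm_num)]; congr 1; ring
    simp only [e]
    refine mul_le_mul' (ENNReal.rpow_le_rpow ?_ (by linarith)) le_rfl
    rw [← ofReal_norm_eq_enorm]
    exact ENNReal.ofReal_le_ofReal (hi z)
  refine (h3.trans_lt (ENNReal.mul_lt_top (ENNReal.rpow_lt_top_of_nonneg (by linarith) (by simp)) h2)).ne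

/-- constant of the `L_p` bound -/
def CH (d : ℕ) (p : ℝ) : ℝ≥0∞ := if p = 2 then 64 else ENNReal.ofReal (CM d (p / (p - 1))) ^ (p - 1)

theorem CH_top (d : ℕ) {p : ℝ} (hp : 2 ≤ p) : CH d p ≠ ∞ := by
  unfold CH; split_ifs
  · norm_num
  · exact ENNReal.rpow_ne_top_of_nonneg (by linarith) (by simp)

theorem TT_Lp {η : ℝ} (hη : 0 < η) (i j : Fin d) {f : XX d → ℝ} (hf : CCf f) {p : ℝ} (hp : 2 ≤ p) :
    ∫⁻ z, ‖TT η i j f z‖ₑ ^ p ≤ CH d p * ∫⁻ z, ‖f z‖ₑ ^ p := by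
  rcases hp.eq_or_lt with rfl | hp
  · rw [CH, if_pos rfl]; exact TT_L2 hη i j (hf.memLp 2)
  rw [CH, if_neg hp.ne']
  set q := p / (p - 1) with hq
  have hpq : p.HolderConjugate q := (Real.holderConjugate_iff_eq_conjExponent (by linarith)).2 hq
  have hp0 := hpq.pos
  have hq0 := hpq.symm.pos
  set w := TT η i j f with hw
  have hwm := TT_meas hη i j hf.integrable.1
  have hwp := TT_memLp hη i j hf hp
  set A := ∫⁻ z, ‖w z‖ₑ ^ p with hA
  have eA : eLpNorm w (ENNReal.ofReal p) volume = A ^ (1 / p) := eLp_eq hp0 w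
  have hAt : A ≠ ∞ := by
    intro hh
    have := hwp.2
    rw [eA, hh, ENNReal.top_rpow_of_pos (by positivity)] at this
    simp at this
  set k0 : XX d → ℝ := fun z => |w z| ^ (p - 2) * w z with hk0
  have k0m : AEStronglyMeasurable k0 volume := by
    have := hwm.measurable
    have : Measurable k0 := by
      have e : Measurable fun z => |w z| := this.abs
      exact (e.pow_const _).mul this
    exact this.aestronglyMeasurable
  have k0n : ∀ z, ‖k0 z‖ₑ = ‖w z‖ₑ ^ (p - 1) := by
    intro z
    rw [← enorm_norm (w z), ← enorm_norm (k0 z), Real.enorm_eq_ofReal (norm_nonneg _), Real.enorm_eq_ofReal (norm_nonneg _), ENNReal.ofReal_rpow_of_nonneg (norm_nonneg _) (by linarith)]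
    congr 1
    rw [hk0, norm_mul, Real.norm_eq_abs, Real.norm_eq_abs, abs_of_nonneg (by positivity)]
    nth_rewrite 2 [← Real.rpow_one |w z|]
    rw [← Real.rpow_add' (abs_nonneg _) (by linarith)]
    congr 1; ring
  have ek : eLpNorm k0 (ENNReal.ofReal q) volume = A ^ (1 / q) := by
    rw [eLp_eq hq0]
    congr 1
    refine lintegral_congr fun z => ?_
    rw [k0n, ← ENNReal.rpow_mul, hpq.sub_one_mul_conj]
  have k0L : MemLp k0 (ENNReal.ofReal q) volume := ⟨k0m, by rw [ek]; exact ENNReal.rpow_lt_top_of_nonneg (by positivity) hAt⟩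
  set C := ENNReal.ofReal (CM d q) ^ (1 / q) with hC
  have hCt : C ≠ ∞ := ENNReal.rpow_ne_top_of_nonneg (by positivity) (by simp)
  set F := eLpNorm f (ENNReal.ofReal p) volume with hF
  have hFt : F ≠ ∞ := (hf.memLp _).2.ne
  have wk : ∀ z, w z * k0 z = ‖w z‖ ^ p := by
    intro z
    rw [hk0]; simp only
    rw [Real.norm_eq_abs, show w z * (|w z| ^ (p-2) * w z) = |w z| ^ (p-2) * |w z| ^ 2 by rw [sq_abs]; ring, ← Real.rpow_natCast |w z| 2,
      ← Real.rpow_add' (abs_nonneg _) (by push_cast; linarith)]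
    congr 1; push_cast; ring
  have hAe : A = ‖∫ z, w z * k0 z‖ₑ := by
    simp only [wk]
    rw [Real.enorm_eq_ofReal (integral_nonneg fun z => by positivity), integral_eq_lintegral_of_nonneg_ae (Eventually.of_forall fun z => by positivity)
      (by have := hwm.measurable; exact (this.norm.pow_const p).aestronglyMeasurable)]
    have e : ∀ z, ENNReal.ofReal (‖w z‖ ^ p) = ‖w z‖ₑ ^ p := fun z => by
      rw [← ENNReal.ofReal_rpow_of_nonneg (norm_nonneg _) hp0.le, ofReal_norm_eq_enorm]
    simp only [e]
    rw [ENNReal.ofReal_toReal hAt]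
  have main : ∀ ε : ℝ≥0∞, ε ≠ 0 → A ≤ C * F * (A ^ (1 / q) + ε) + A ^ (1 / p) * ε := by
    intro ε hε
    obtain ⟨k, k1, k2, k3, k4⟩ := k0L.exists_hasCompactSupport_eLpNorm_sub_le (by simp) hε
    have hk : CCf k := ⟨k3, k1⟩
    have hkn : eLpNorm k (ENNReal.ofReal q) volume ≤ A ^ (1 / q) + ε := by
      have : k = k0 - (k0 - k) := by abel
      rw [this]
      refine (eLpNorm_sub_le k0m (k0m.sub k4.1) (by simpa using hpq.symm.lt.le)).trans ?_
      rw [ek]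
      gcongr
    haveI : (ENNReal.ofReal p).HolderTriple (ENNReal.ofReal q) 1 := by
      haveI := hpq.ennrealOfReal
      infer_instance
    have i1 : Integrable (fun z => w z * k z) := (hwp.integrable_mul k4)
    have i2 : Integrable (fun z => w z * (k0 z - k z)) := (hwp.integrable_mul (k0L.sub k4))
    have s : ∫ z, w z * k0 z = (∫ z, w z * k z) + ∫ z, w z * (k0 z - k z) := by
      rw [← integral_add i1 i2]
      congr 1 with z; ring
    have b2 : ‖∫ z, w z * (k0 z - k z)‖ₑ ≤ A ^ (1 / p) * ε := by
      refine (enorm_integral_le_lintegral_enorm _).trans ?_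
      simp only [enorm_mul]
      refine (ENNReal.lintegral_mul_le_Lp_mul_Lq volume hpq hwm.measurable.enorm.aemeasurable (k0m.sub k4.1).enorm).trans ?_
      refine mul_le_mul' le_rfl ?_
      have := eLp_eq (μ := volume) hq0 (k0 - k)
      exact this.symm.le.trans k2
    refine hAe.le.trans ?_
    rw [s]
    refine (enorm_add_le _ _).trans (add_le_add ((dual1 hη i j hf hk hpq hp).trans ?_) b2)
    gcongr
  have lim : A ≤ C * F * A ^ (1 / q) := by
    have ht : Tendsto (fun ε : ℝ≥0∞ => C * F * (A ^ (1 / q) + ε) + A ^ (1 / p) * ε) (𝓝[≠] 0) (𝓝 (C * F * (A ^ (1 / q) + 0) + A ^ (1 / p) * 0)) := by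
      refine Tendsto.mono_left ?_ nhdsWithin_le_nhds
      refine Tendsto.add (ENNReal.Tendsto.const_mul (tendsto_const_nhds.add tendsto_id) (Or.inr (by finiteness)))
        (ENNReal.Tendsto.const_mul tendsto_id (Or.inr ?_))
      exact ENNReal.rpow_ne_top_of_nonneg (by positivity) hAt
    have := ge_of_tendsto ht (eventually_mem_nhdsWithin.mono fun ε hε => main ε hε)
    simpa using this
  rcases eq_or_ne A 0 with h0 | h0
  · rw [h0]; exact bot_le
  have hp1 : A ^ (1 / p) ≤ C * F := by
    have e : A = A ^ (1 / p) * A ^ (1 / q) := by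
      rw [← ENNReal.rpow_add _ _ h0 hAt]
      have := hpq.inv_add_inv_eq_one
      rw [one_div, one_div, this, ENNReal.rpow_one]
    have hne : A ^ (1 / q) ≠ 0 := by
      simp [ENNReal.rpow_eq_zero_iff, h0, hAt]
    have hnt : A ^ (1 / q) ≠ ∞ := ENNReal.rpow_ne_top_of_nonneg (by positivity) hAt
    refine (ENNReal.mul_le_mul_iff_left hne hnt).1 ?_
    rw [← e]; exact lim
  calc A = (A ^ (1 / p)) ^ p := by rw [← ENNReal.rpow_mul, one_div, inv_mul_cancel₀ hp0.ne', ENNReal.rpow_one]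
    _ ≤ (C * F) ^ p := ENNReal.rpow_le_rpow hp1 hp0.le
    _ = _ := by
      rw [ENNReal.mul_rpow_of_nonneg _ _ hp0.le, hC, hF, eLp_eq hp0, ← ENNReal.rpow_mul, ← ENNReal.rpow_mul, one_div p, inv_mul_cancel₀ hp0.ne', ENNReal.rpow_one]
      congr 2
      rw [hq]; field_simp

end MR

end

section

namespace MR
open ProbabilityTheory Matrix Filter Topology

variable {d : ℕ} {P : ℝ≥0∞} [Fact (1 ≤ P)] [Fact (P ≠ ∞)]

theorem eLpP {α : Type*} [MeasurableSpace α] {μ : Measure α} {E : Type*} [NormedAddCommGroup E] {Q : ℝ≥0∞} {r : ℝ} (hr : 0 < r) (hQ : Q = ENNReal.ofReal r) (h : α → E) :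
    eLpNorm h Q μ = (∫⁻ z, ‖h z‖ₑ ^ r ∂μ) ^ (1 / r) := by
  rw [hQ, eLp_eq hr]

theorem HW_meas {η : ℝ} (hη : 0 < η) (i j : Fin d) {F : ℝ → LP P d} (hF : AEStronglyMeasurable F volume) :
    AEStronglyMeasurable (HW η i j F) volume := by
  have h1 : AEStronglyMeasurable (fun z : ℝ × ℝ => Kop (max η (z.1 - z.2 + η)) i j (F z.2)) (volume.prod volume) :=
    (Kop_cont2 hη i j).comp_aestronglyMeasurable (g := fun z : ℝ × LP P d => Kop (max η z.1) i j z.2)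
      (f := fun z : ℝ × ℝ => (z.1 - z.2 + η, F z.2))
      ((by fun_prop : Continuous fun z : ℝ × ℝ => z.1 - z.2 + η).aestronglyMeasurable.prodMk hF.comp_snd)
  have hS : MeasurableSet {z : ℝ × ℝ | z.2 ≤ z.1} := measurableSet_le measurable_snd measurable_fst
  have h2 := (h1.indicator hS).integral_prod_right'
  refine h2.congr (Eventually.of_forall fun t => ?_)
  simp only
  rw [HW, ← integral_indicator measurableSet_Iic]
  congr 1

theorem sl_add {h k : XX d → ℝ} (hh : CCf h) (hk : CCf k) : sl P h + sl P k = sl P (h + k) := by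
  have hhk : CCf (h + k) := ⟨hh.1.add hk.1, hh.2.add hk.2⟩
  funext s
  simp only [Pi.add_apply]
  rw [hh.sl_eq, hk.sl_eq, hhk.sl_eq, ← MemLp.toLp_add]
  rfl

theorem sl_dense {p : ℝ} (hp : 2 ≤ p) (hP : P = ENNReal.ofReal p) {F : ℝ → LP P d} (hF : MemLp F P volume) {ε : ℝ≥0∞} (hε : ε ≠ 0) :
    ∃ h : XX d → ℝ, CCf h ∧ eLpNorm (F - sl P h) P volume ≤ ε := by
  have hPt : P ≠ ∞ := Fact.out
  have hP1 : 1 ≤ P := Fact.out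
  have := hF.induction_dense hPt (fun g => ∃ h : XX d → ℝ, CCf h ∧ g = sl P h) ?_ ?_ ?_ hε
  · obtain ⟨g, hg, h, hh, rfl⟩ := this
    exact ⟨h, hh, hg⟩
  · intro c s hs hvs ε hε
    have hε2 : ε / 2 ≠ 0 := by simp [hε]
    set V : ℝ≥0∞ := volume s ^ P.toReal⁻¹ with hV
    have hVt : V ≠ ∞ := ENNReal.rpow_ne_top_of_nonneg (by positivity) hvs.ne
    obtain ⟨e1, he1, he1'⟩ := ENNReal.exists_nnreal_pos_mul_lt hVt hε2
    obtain ⟨g, g1, g2, g3, g4⟩ := (Lp.memLp c).exists_hasCompactSupport_eLpNorm_sub_le hPt (ε := e1) (by simpa using he1.ne')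
    set gL : LP P d := g4.toLp g with hgL
    have hgc : ‖c - gL‖ₑ ≤ e1 := by
      have : c - gL = ((Lp.memLp c).sub g4).toLp := by
        rw [MemLp.toLp_sub (Lp.memLp c) g4, Lp.toLp_coeFn]
      rw [this, Lp.enorm_toLp]
      exact g2
    obtain ⟨e2, he2, he2'⟩ := ENNReal.exists_nnreal_pos_mul_lt (a := ‖gL‖ₑ) (by simp) hε2
    have hind : MemLp (s.indicator fun _ => (1:ℝ)) P volume := memLp_indicator_const _ hs _ (Or.inr hvs.ne)
    obtain ⟨χ, c1, c2, c3, c4⟩ := hind.exists_hasCompactSupport_eLpNorm_sub_le hPt (ε := e2) (by simpa using he2.ne')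
    have hcc : CCf (fun z : XX d => χ z.1 * g z.2) := by
      refine ⟨by fun_prop, HasCompactSupport.intro (c1.isCompact.prod g1.isCompact) ?_⟩
      intro z hz
      by_contra hne
      exact hz ⟨subset_tsupport _ (left_ne_zero_of_mul hne), subset_tsupport _ (right_ne_zero_of_mul hne)⟩
    refine ⟨_, ?_, _, hcc, rfl⟩
    have esl : sl P (fun z : XX d => χ z.1 * g z.2) = fun r => χ r • gL := by
      funext r
      rw [hcc.sl_eq, hgL, ← MemLp.toLp_const_smul]
      rfl
    have e : (sl P (fun z : XX d => χ z.1 * g z.2) - s.indicator fun _ => c)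
        = (fun r => ((χ - s.indicator fun _ => (1:ℝ)) r) • gL) + s.indicator fun _ => (gL - c) := by
      rw [esl]
      funext r
      by_cases hr : r ∈ s <;> simp [hr, sub_smul]
    have m1 : AEStronglyMeasurable (fun r => ((χ - s.indicator fun _ => (1:ℝ)) r) • gL) volume :=
      (c4.sub hind).1.smul_const gL
    have m2 : AEStronglyMeasurable (s.indicator fun _ => (gL - c)) volume := aestronglyMeasurable_const.indicator hs
    rw [e]
    refine (eLpNorm_add_le m1 m2 hP1).trans ?_
    rw [← ENNReal.add_halves ε]
    refine add_le_add ?_ ?_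
    · have : eLpNorm (fun r => ((χ - s.indicator fun _ => (1:ℝ)) r) • gL) P volume = ‖gL‖ₑ * eLpNorm (χ - s.indicator fun _ => (1:ℝ)) P volume := by
        have := eLpNorm_const_smul ‖gL‖ (χ - s.indicator fun _ => (1:ℝ)) P volume
        rw [enorm_norm] at this
        rw [← this]
        refine eLpNorm_congr_norm_ae (Eventually.of_forall fun r => ?_)
        simp [norm_smul, mul_comm]
      rw [this, mul_comm, ← eLpNorm_neg, neg_sub]
      exact (mul_le_mul' c2 le_rfl).trans he2'.le
    · refine (eLpNorm_indicator_const_le _ _).trans ?_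
      rw [one_div, ← enorm_neg, neg_sub]
      exact (mul_le_mul' hgc le_rfl).trans he1'.le
  · rintro f g ⟨h, hh, rfl⟩ ⟨k, hk, rfl⟩
    exact ⟨h + k, ⟨hh.1.add hk.1, hh.2.add hk.2⟩, sl_add hh hk⟩
  · rintro f ⟨h, hh, rfl⟩
    exact hh.sl_cont.aestronglyMeasurable

theorem HW_diff {p q : ℝ} (hpq : p.HolderConjugate q) (hP : P = ENNReal.ofReal p) {η : ℝ} (hη : 0 < η) (i j : Fin d) (t : ℝ) :
    ∃ D : ℝ≥0∞, D ≠ ∞ ∧ ∀ F G : ℝ → LP P d, Integrable F → Integrable G → 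
      edist (HW η i j F t) (HW η i j G t) ≤ D * eLpNorm (F - G) P volume := by
  have hq0 := hpq.symm.pos
  have hcB := cB_pos d
  set ψ : ℝ → ℝ≥0∞ := fun s => ENNReal.ofReal (cB d / max η (t - s + η)) with hψ
  have ψm : Measurable ψ := by
    have : Continuous fun s => cB d / max η (t - s + η) := by
      refine continuous_const.div (by fun_prop) fun s => ?_
      exact (hη.trans_le (le_max_left _ _)).ne'
    exact this.measurable.ennreal_ofReal
  refine ⟨(∫⁻ s in Iic t, ψ s ^ q) ^ (1 / q), ?_, ?_⟩
  · refine ENNReal.rpow_ne_top_of_nonneg (by positivity) ?_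
    set M := cB d * max 1 η⁻¹ with hM
    have hIntg : Integrable (fun s : ℝ => (1 + ‖s - t‖) ^ (-q)) :=
      (integrable_one_add_norm (E := ℝ) (μ := volume) (r := q) (by simpa using hpq.symm.lt)).comp_sub_right t
    have hIntg2 := hIntg.const_mul (M ^ q)
    have hb : ∫⁻ s in Iic t, ψ s ^ q ≤ ∫⁻ s, ‖M ^ q * (1 + ‖s - t‖) ^ (-q)‖ₑ := by
      refine le_trans ?_ (setLIntegral_le_lintegral (Iic t) _)
      refine setLIntegral_mono_ae' measurableSet_Iic (Eventually.of_forall fun s hs => ?_)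
      have hs' : s ≤ t := hs
      rw [hψ]; simp only
      have hm : max η (t - s + η) = t - s + η := max_eq_right (by linarith)
      have hpos : 0 < t - s + η := by linarith
      rw [hm, ENNReal.ofReal_rpow_of_nonneg (by positivity) hq0.le, Real.enorm_eq_ofReal (by positivity)]
      refine ENNReal.ofReal_le_ofReal ?_
      rw [Real.rpow_neg (by positivity), ← div_eq_mul_inv, ← Real.div_rpow (by positivity) (by positivity)]
      refine Real.rpow_le_rpow (by positivity) ?_ hq0.le
      rw [hM, div_le_div_iff₀ hpos (by positivity), mul_assoc]
      refine mul_le_mul_of_nonneg_left ?_ hcB.le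
      rw [Real.norm_eq_abs, abs_of_nonpos (by linarith)]
      have a1 : (1:ℝ) ≤ max 1 η⁻¹ := le_max_left _ _
      have a2 : η⁻¹ ≤ max 1 η⁻¹ := le_max_right _ _
      have a3 : 1 ≤ max 1 η⁻¹ * η := by
        calc 1 = η⁻¹ * η := by field_simp
          _ ≤ _ := by gcongr
      nlinarith
    exact (hb.trans_lt hIntg2.2).ne
  · intro F G hF hG
    rw [edist_eq_enorm_sub, HW, HW, ← integral_sub (HW_int hη i j hF t).integrableOn (HW_int hη i j hG t).integrableOn]
    refine (enorm_integral_le_lintegral_enorm _).trans ?_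
    have h1 : ∫⁻ s in Iic t, ‖Kop (max η (t - s + η)) i j (F s) - Kop (max η (t - s + η)) i j (G s)‖ₑ ≤ ∫⁻ s in Iic t, ψ s * ‖F s - G s‖ₑ := by
      refine lintegral_mono fun s => ?_
      simp only [← map_sub]
      have := Kop_norm (hη.trans_le (le_max_left η (t - s + η))) i j (F s - G s)
      rw [← ofReal_norm_eq_enorm, ← ofReal_norm_eq_enorm, hψ]
      simp only
      rw [← ENNReal.ofReal_mul (by positivity)]
      exact ENNReal.ofReal_le_ofReal this
    refine h1.trans ?_
    have h2 := ENNReal.lintegral_mul_le_Lp_mul_Lq (volume.restrict (Iic t)) hpq.symm ψm.aemeasurable ((hF.1.sub hG.1).restrict (s := Iic t)).enorm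
    refine h2.trans (mul_le_mul' le_rfl ?_)
    rw [eLpP hpq.pos hP]
    refine ENNReal.rpow_le_rpow ?_ (by have := hpq.pos; positivity)
    exact setLIntegral_le_lintegral _ _

/-- `L_p` maximal regularity bound for the heat equation, uniform in `η` -/
theorem thmH {p : ℝ} (hp : 2 ≤ p) (hP : P = ENNReal.ofReal p) {η : ℝ} (hη : 0 < η) (i j : Fin d) {F : ℝ → LP P d}
    (hF : Integrable F) (hFp : MemLp F P volume) :
    ∫⁻ t, ‖HW η i j F t‖ₑ ^ p ≤ CH d p * ∫⁻ t, ‖F t‖ₑ ^ p := by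
  have hp0 : 0 < p := by linarith
  have hpq : p.HolderConjugate (p / (p - 1)) := (Real.holderConjugate_iff_eq_conjExponent (by linarith)).2 rfl
  have hap : ∀ n : ℕ, ∃ h : XX d → ℝ, CCf h ∧ eLpNorm (F - sl P h) P volume ≤ (n + 1 : ℝ≥0∞)⁻¹ := fun n => sl_dense hp hP hFp (by simp)
  choose h hh hn using hap
  have lim0 : Tendsto (fun n : ℕ => ((n:ℝ≥0∞) + 1)⁻¹) atTop (𝓝 0) := by
    have := (tendsto_add_atTop_iff_nat 1).2 ENNReal.tendsto_inv_nat_nhds_zero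
    simpa using this
  have pt : ∀ t, Tendsto (fun n => HW η i j (sl P (h n)) t) atTop (𝓝 (HW η i j F t)) := by
    intro t
    obtain ⟨D, hD, hb⟩ := HW_diff (P := P) hpq hP hη i j t
    rw [tendsto_iff_edist_tendsto_0]
    have : Tendsto (fun n : ℕ => D * ((n:ℝ≥0∞) + 1)⁻¹) atTop (𝓝 0) := by
      simpa using ENNReal.Tendsto.const_mul lim0 (Or.inr hD)
    refine tendsto_of_tendsto_of_tendsto_of_le_of_le tendsto_const_nhds this (fun _ => bot_le) fun n => ?_
    simp only
    rw [edist_comm]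
    exact (hb _ _ hF (hh n).sl_int).trans (mul_le_mul' le_rfl (hn n))
  set A := eLpNorm F P volume with hA
  have hAt : A ≠ ∞ := hFp.2.ne
  have hb : ∀ n, ∫⁻ t, ‖HW η i j (sl P (h n)) t‖ₑ ^ p ≤ CH d p * (A + ((n:ℝ≥0∞) + 1)⁻¹) ^ p := by
    intro n
    rw [bridge_T (by linarith) hP hη i j (hh n)]
    refine (TT_Lp hη i j (hh n) hp).trans (mul_le_mul' le_rfl ?_)
    rw [← bridge_f (by linarith) hP (hh n)]
    have e : ∫⁻ t, ‖sl P (h n) t‖ₑ ^ p = eLpNorm (sl P (h n)) P volume ^ p := by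
      rw [eLpP hp0 hP, ← ENNReal.rpow_mul, one_div, inv_mul_cancel₀ hp0.ne', ENNReal.rpow_one]
    rw [e]
    refine ENNReal.rpow_le_rpow ?_ hp0.le
    have e2 : sl P (h n) = F - (F - sl P (h n)) := by abel
    rw [e2]
    exact (eLpNorm_sub_le hFp.1 (hFp.1.sub (hh n).sl_cont.aestronglyMeasurable) Fact.out).trans (add_le_add le_rfl (hn n))
  have eA : CH d p * ∫⁻ t, ‖F t‖ₑ ^ p = CH d p * (A + 0) ^ p := by
    rw [add_zero, hA]
    congr 1
    rw [eLpP hp0 hP, ← ENNReal.rpow_mul, one_div, inv_mul_cancel₀ hp0.ne', ENNReal.rpow_one]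
  rw [eA]
  have lim : Tendsto (fun n : ℕ => CH d p * (A + ((n:ℝ≥0∞) + 1)⁻¹) ^ p) atTop (𝓝 (CH d p * (A + 0) ^ p)) :=
    ENNReal.Tendsto.const_mul ((tendsto_const_nhds.add lim0).ennrpow_const p) (Or.inr (CH_top d hp))
  calc ∫⁻ t, ‖HW η i j F t‖ₑ ^ p = ∫⁻ t, liminf (fun n => ‖HW η i j (sl P (h n)) t‖ₑ ^ p) atTop := by
        refine lintegral_congr fun t => ?_
        exact (((pt t).enorm).ennrpow_const p).liminf_eq.symm
    _ ≤ liminf (fun n => ∫⁻ t, ‖HW η i j (sl P (h n)) t‖ₑ ^ p) atTop :=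
        lintegral_liminf_le' fun n => (HW_meas hη i j (hh n).sl_cont.aestronglyMeasurable).enorm.pow_const p
    _ ≤ liminf (fun n : ℕ => CH d p * (A + ((n:ℝ≥0∞) + 1)⁻¹) ^ p) atTop := liminf_le_liminf (Eventually.of_forall hb)
    _ = _ := lim.liminf_eq

end MR

end

section

namespace MR
open ProbabilityTheory Matrix Filter Topology

variable {d : ℕ} {P : ℝ≥0∞} [Fact (1 ≤ P)] [Fact (P ≠ ∞)]

/-- the singular integral with an additional Gaussian evolution -/
def VV (η : ℝ) (i j : Fin d) (β : ℝ → Matrix (Fin d) (Fin d) ℝ) (F : ℝ → LP P d) (t : ℝ) : LP P d :=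
  ∫ s in Iic t, Kop (max η (t - s + η)) i j (Gam (β t - β s) (F s))

/-- the properties propagated by the transference argument -/
structure Good (P : ℝ≥0∞) [Fact (1 ≤ P)] [Fact (P ≠ ∞)] (C : ℝ≥0∞) (p η : ℝ) (i j : Fin d) (β : ℝ → Matrix (Fin d) (Fin d) ℝ) : Prop where
  mono : ∀ s t, s ≤ t → (β t - β s).PosSemidef
  meas1 : ∀ F : ℝ → LP P d, AEStronglyMeasurable F volume → ∀ t,
    AEStronglyMeasurable (fun s => Kop (max η (t - s + η)) i j (Gam (β t - β s) (F s))) (volume.restrict (Iic t))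
  meas2 : ∀ F : ℝ → LP P d, Integrable F → AEStronglyMeasurable (VV η i j β F) volume
  bd : ∀ F : ℝ → LP P d, Integrable F → MemLp F P volume → ∫⁻ t, ‖VV η i j β F t‖ₑ ^ p ≤ C * ∫⁻ t, ‖F t‖ₑ ^ p

theorem VV_bound {η : ℝ} (hη : 0 < η) (i j : Fin d) (v : ℝ) (C : Matrix (Fin d) (Fin d) ℝ) (g : LP P d) :
    ‖Kop (max η v) i j (Gam C g)‖ ≤ cB d / η * ‖g‖ := by
  have := cB_pos d
  refine (Kop_norm (hη.trans_le (le_max_left _ _)) i j _).trans ?_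
  refine mul_le_mul ?_ (Gam_norm_le _ _) (norm_nonneg _) (by positivity)
  gcongr
  exact le_max_left _ _

variable {C : ℝ≥0∞} {p η : ℝ} {i j : Fin d} {β : ℝ → Matrix (Fin d) (Fin d) ℝ}

theorem Good.int (hg : Good P C p η i j β) (hη : 0 < η) {F : ℝ → LP P d} (hF : Integrable F) (t : ℝ) :
    IntegrableOn (fun s => Kop (max η (t - s + η)) i j (Gam (β t - β s) (F s))) (Iic t) :=
  Integrable.mono' ((hF.norm.const_mul (cB d / η)).integrableOn) (hg.meas1 F hF.1 t) (Eventually.of_forall fun s => VV_bound hη i j _ _ _)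

theorem Good.VV_add (hg : Good P C p η i j β) (hη : 0 < η) {F G : ℝ → LP P d} (hF : Integrable F) (hG : Integrable G) (t : ℝ) :
    VV η i j β (F + G) t = VV η i j β F t + VV η i j β G t := by
  rw [VV, VV, VV, ← integral_add (hg.int hη hF t) (hg.int hη hG t)]
  simp

theorem Good.VV_clm (hg : Good P C p η i j β) (hη : 0 < η) {F : ℝ → LP P d} (hF : Integrable F) (t : ℝ) (L : LP P d →L[ℝ] LP P d)
    (hL : ∀ v C g, Kop v i j (Gam C (L g)) = L (Kop v i j (Gam C g))) :
    VV η i j β (fun s => L (F s)) t = L (VV η i j β F t) := by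
  rw [VV, VV, ← ContinuousLinearMap.integral_comp_comm _ (hg.int hη hF t)]
  simp only [hL]

theorem jensen {α : Type*} [MeasurableSpace α] {μ : Measure α} [IsProbabilityMeasure μ] (hp : 1 ≤ p) {h : α → LP P d}
    (hh : AEStronglyMeasurable h μ) : ‖∫ y, h y ∂μ‖ₑ ^ p ≤ ∫⁻ y, ‖h y‖ₑ ^ p ∂μ := by
  have hp0 : 0 < p := by linarith
  have h1 : ‖∫ y, h y ∂μ‖ₑ ≤ (∫⁻ y, ‖h y‖ₑ ^ p ∂μ) ^ (1 / p) := by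
    rw [← eLp_eq hp0]
    refine (enorm_integral_le_lintegral_enorm _).trans ?_
    rw [← eLpNorm_one_eq_lintegral_enorm]
    exact eLpNorm_le_eLpNorm_of_exponent_le (by simpa using hp) hh
  calc _ ≤ ((∫⁻ y, ‖h y‖ₑ ^ p ∂μ) ^ (1 / p)) ^ p := ENNReal.rpow_le_rpow h1 hp0.le
    _ = _ := by rw [← ENNReal.rpow_mul, one_div, inv_mul_cancel₀ hp0.ne', ENNReal.rpow_one]

theorem Good_zero (hp : 2 ≤ p) (hP : P = ENNReal.ofReal p) (hη : 0 < η) : Good P (CH d p) p η i j 0 where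
  mono s t _ := by simp [Matrix.PosSemidef.zero]
  meas1 F hF t := by
    simp only [Pi.zero_apply, sub_self, Gam_zero]
    exact ((Kop_cont2 hη i j).comp_aestronglyMeasurable (g := fun z : ℝ × LP P d => Kop (max η z.1) i j z.2) (f := fun s : ℝ => (t - s + η, F s))
      ((by fun_prop : Continuous fun s : ℝ => t - s + η).aestronglyMeasurable.prodMk hF)).restrict
  meas2 F hF := by
    have e : VV η i j 0 F = HW η i j F := by
      funext t; simp [VV, HW, Gam_zero]
    rw [e]; exact HW_meas hη i j hF.1
  bd F hF hFp := by
    have e : VV η i j 0 F = HW η i j F := by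
      funext t; simp [VV, HW, Gam_zero]
    rw [e]; exact thmH hp hP hη i j hF hFp

theorem Good_step (hp : 2 ≤ p) (hP : P = ENNReal.ofReal p) (hη : 0 < η) (hg : Good P C p η i j β) (t0 : ℝ) {D : Matrix (Fin d) (Fin d) ℝ} (hD : D.PosSemidef) :
    Good P C p η i j (fun t => β t + if t0 ≤ t then D else 0) := by
  set β' : ℝ → Matrix (Fin d) (Fin d) ℝ := fun t => β t + if t0 ≤ t then D else 0 with hβ'
  have d1 : ∀ s t, s ≤ t → t < t0 → β' t - β' s = β t - β s := by
    intro s t hst ht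
    simp [hβ', not_le.2 ht, not_le.2 (hst.trans_lt ht)]
  have d2 : ∀ s t, t0 ≤ s → s ≤ t → β' t - β' s = β t - β s := by
    intro s t hs hst
    simp [hβ', hs, hs.trans hst]
  have d3 : ∀ s t, s < t0 → t0 ≤ t → β' t - β' s = (β t - β s) + D := by
    intro s t hs ht
    simp [hβ', not_le.2 hs, ht]; abel
  -- the modified force
  let sh : (ℝ → LP P d) → ℝ → LP P d := fun F s => if s < t0 then Gam D (F s) else F s
  have shm : ∀ F : ℝ → LP P d, AEStronglyMeasurable F volume → AEStronglyMeasurable (sh F) volume := by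
    intro F hF
    exact AEStronglyMeasurable.piecewise (s := Iio t0) measurableSet_Iio ((Gam D).continuous.comp_aestronglyMeasurable hF).restrict hF.restrict
  have shi : ∀ F : ℝ → LP P d, Integrable F → Integrable (sh F) := by
    intro F hF
    refine hF.norm.mono' (shm F hF.1) (Eventually.of_forall fun s => ?_)
    simp only [sh]; split_ifs
    · exact Gam_norm_le _ _
    · exact le_rfl
  have k1 : ∀ F : ℝ → LP P d, ∀ s t, s ≤ t → t < t0 → Gam (β' t - β' s) (F s) = Gam (β t - β s) (F s) := by
    intro F s t hst ht; rw [d1 s t hst ht]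
  have k2 : ∀ F : ℝ → LP P d, ∀ s t, s ≤ t → t0 ≤ t → Gam (β' t - β' s) (F s) = Gam (β t - β s) (sh F s) := by
    intro F s t hst ht
    simp only [sh]; split_ifs with hs
    · rw [d3 s t hs ht, Gam_add (hg.mono s t hst) hD]
    · rw [d2 s t (not_lt.1 hs) hst]
  have V1 : ∀ F : ℝ → LP P d, ∀ t, t < t0 → VV η i j β' F t = VV η i j β F t := by
    intro F t ht
    refine setIntegral_congr_fun measurableSet_Iic fun s hs => ?_
    simp only [k1 F s t hs ht]
  have V2 : ∀ F : ℝ → LP P d, ∀ t, t0 ≤ t → VV η i j β' F t = VV η i j β (sh F) t := by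
    intro F t ht
    refine setIntegral_congr_fun measurableSet_Iic fun s hs => ?_
    simp only [k2 F s t hs ht]
  refine ⟨?_, ?_, ?_, ?_⟩
  · intro s t hst
    rcases lt_or_ge t t0 with ht | ht
    · rw [d1 s t hst ht]; exact hg.mono s t hst
    · rcases lt_or_ge s t0 with hs | hs
      · rw [d3 s t hs ht]; exact (hg.mono s t hst).add hD
      · rw [d2 s t hs hst]; exact hg.mono s t hst
  · intro F hF t
    rcases lt_or_ge t t0 with ht | ht
    · refine (hg.meas1 F hF t).congr ?_
      filter_upwards [ae_restrict_mem measurableSet_Iic] with s hs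
      rw [k1 F s t hs ht]
    · refine (hg.meas1 (sh F) (shm F hF) t).congr ?_
      filter_upwards [ae_restrict_mem measurableSet_Iic] with s hs
      rw [k2 F s t hs ht]
  · intro F hF
    refine (AEStronglyMeasurable.piecewise (s := Iio t0) measurableSet_Iio (hg.meas2 F hF).restrict (hg.meas2 (sh F) (shi F hF)).restrict).congr
      (Eventually.of_forall fun t => ?_)
    by_cases ht : t < t0
    · rw [Set.piecewise_eq_of_mem _ _ _ (by exact ht), V1 F t ht]
    · rw [Set.piecewise_eq_of_notMem _ _ _ (by exact ht), V2 F t (not_lt.1 ht)]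
  · intro F hF hFp
    set F1 : ℝ → LP P d := (Iio t0).indicator F with hF1
    set F2 : ℝ → LP P d := (Ici t0).indicator F with hF2
    have i1 : Integrable F1 := hF.indicator measurableSet_Iio
    have i2 : Integrable F2 := hF.indicator measurableSet_Ici
    set A := VV η i j β F1 with hA
    set B := VV η i j β F2 with hB
    have Am := hg.meas2 F1 i1
    have Bm := hg.meas2 F2 i2
    have e12 : F = F1 + F2 := by
      funext s
      by_cases hs : s < t0
      · simp [hF1, hF2, hs]
      · simp [hF1, hF2, hs, not_lt.1 hs]
    have esh : sh F = (fun s => Gam D (F1 s)) + F2 := by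
      funext s
      by_cases hs : s < t0
      · simp [sh, hF1, hF2, hs]
      · simp [sh, hF1, hF2, hs, not_lt.1 hs]
    have B0 : ∀ t, t < t0 → B t = 0 := by
      intro t ht
      rw [hB, VV]
      refine setIntegral_eq_zero_of_forall_eq_zero fun s hs => ?_
      have : F2 s = 0 := by
        rw [hF2]; exact indicator_of_notMem (by simp; exact lt_of_le_of_lt hs ht) _
      rw [this]; simp
    -- pointwise bound
    have pt : ∀ t, ‖VV η i j β' F t‖ₑ ^ p ≤ ∫⁻ y, ‖A t + tr (-y) (B t)‖ₑ ^ p ∂(gam D) := by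
      intro t
      haveI := gam_prob D
      rcases lt_or_ge t t0 with ht | ht
      · have : VV η i j β' F t = A t := by
          rw [V1 F t ht]; conv_lhs => rw [e12]
          rw [hg.VV_add hη i1 i2]
          change A t + B t = A t
          rw [B0 t ht, add_zero]
        rw [this, B0 t ht]
        simp
      · have : VV η i j β' F t = ∫ y, (tr y (A t) + B t) ∂(gam D) := by
          rw [V2 F t ht, esh, hg.VV_add hη ((Gam D).integrable_comp i1) i2,
            hg.VV_clm hη i1 t (Gam D) (fun v C g => by rw [Gam_comm, Kop_Gam_comm]),
            integral_add (tr_int _ _) (integrable_const _), ← Gam_apply]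
          simp [hA, hB]
        rw [this]
        refine (jensen (by linarith) ?_).trans (le_of_eq ?_)
        · exact ((tr_cont _).add continuous_const).aestronglyMeasurable
        · refine lintegral_congr fun y => ?_
          have : tr y (A t) + B t = tr y (A t + tr (-y) (B t)) := by
            rw [map_add, tr_tr]; simp [tr_zero]
          rw [this]
          congr 1
          exact (tr y).enorm_map _
    have FY : ∀ y : Fin d → ℝ, ∫⁻ t, ‖A t + tr (-y) (B t)‖ₑ ^ p ≤ C * ∫⁻ t, ‖F t‖ₑ ^ p := by
      intro y
      let L : LP P d →L[ℝ] LP P d := (tr (-y) : LP P d →ₗᵢ[ℝ] LP P d).toContinuousLinearMap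
      have i3 : Integrable (fun s => L (F2 s)) := L.integrable_comp i2
      have e : ∀ t, A t + tr (-y) (B t) = VV η i j β (F1 + fun s => L (F2 s)) t := by
        intro t
        rw [hg.VV_add hη i1 i3, hg.VV_clm hη i2 t L (fun v C g => by
          simp only [L, LinearIsometry.coe_toContinuousLinearMap]; rw [← tr_Gam, Kop_tr])]
        rfl
      have en : ∀ s, ‖(F1 + fun s => L (F2 s)) s‖ₑ = ‖F s‖ₑ := by
        intro s
        by_cases hs : s < t0
        · simp [hF1, hF2, hs]
        · simp only [hF1, hF2, Pi.add_apply]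
          rw [indicator_of_notMem (by exact hs), indicator_of_mem (by exact not_lt.1 hs), zero_add]
          exact (tr (-y) : LP P d →ₗᵢ[ℝ] LP P d).enorm_map _
      have mm : MemLp (F1 + fun s => L (F2 s)) P volume :=
        hFp.congr_norm (i1.add i3).1 (Eventually.of_forall fun s => by
          have := en s
          rw [← ofReal_norm_eq_enorm, ← ofReal_norm_eq_enorm, ENNReal.ofReal_eq_ofReal_iff (norm_nonneg _) (norm_nonneg _)] at this
          exact this.symm)
      have := hg.bd _ (i1.add i3) mm
      simp only [en] at this
      simp only [e]
      exact this
    calc ∫⁻ t, ‖VV η i j β' F t‖ₑ ^ p ≤ ∫⁻ t, ∫⁻ y, ‖A t + tr (-y) (B t)‖ₑ ^ p ∂(gam D) := lintegral_mono pt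
      _ = ∫⁻ y, (∫⁻ t, ‖A t + tr (-y) (B t)‖ₑ ^ p) ∂(gam D) := by
          haveI := gam_prob D
          refine lintegral_lintegral_swap ?_
          have : AEStronglyMeasurable (fun z : ℝ × (Fin d → ℝ) => A z.1 + tr (-z.2) (B z.1)) (volume.prod (gam D)) := by
            refine Am.comp_fst.add ?_
            exact tr_cont2.comp_aestronglyMeasurable (g := fun z : (Fin d → ℝ) × LP P d => tr z.1 z.2) (f := fun z : ℝ × (Fin d → ℝ) => (-z.2, B z.1))
              ((by fun_prop : Continuous fun z : ℝ × (Fin d → ℝ) => -z.2).aestronglyMeasurable.prodMk Bm.comp_fst)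
          exact this.enorm.pow_const p
      _ ≤ ∫⁻ y, (C * ∫⁻ t, ‖F t‖ₑ ^ p) ∂(gam D) := lintegral_mono FY
      _ = _ := by
          haveI := gam_prob D
          simp

theorem Good_lim (hη : 0 < η) {βn : ℕ → ℝ → Matrix (Fin d) (Fin d) ℝ} (hg : ∀ n, Good P C p η i j (βn n))
    (hl : ∀ s t, s ≤ t → ∀ g : LP P d, Tendsto (fun n => Gam (βn n t - βn n s) g) atTop (𝓝 (Gam (β t - β s) g)))
    {F : ℝ → LP P d} (hF : Integrable F) (hFp : MemLp F P volume) : ∫⁻ t, ‖VV η i j β F t‖ₑ ^ p ≤ C * ∫⁻ t, ‖F t‖ₑ ^ p := by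
  have pt : ∀ t, Tendsto (fun n => VV η i j (βn n) F t) atTop (𝓝 (VV η i j β F t)) := by
    intro t
    refine tendsto_integral_of_dominated_convergence (fun s => cB d / η * ‖F s‖) (fun n => ((hg n).int hη hF t).1)
      ((hF.norm.const_mul (cB d / η)).integrableOn) (fun n => Eventually.of_forall fun s => VV_bound hη i j _ _ _) ?_
    filter_upwards [ae_restrict_mem measurableSet_Iic] with s hs
    exact ((Kop (max η (t - s + η)) i j).continuous.tendsto _).comp (hl s t hs (F s))
  calc ∫⁻ t, ‖VV η i j β F t‖ₑ ^ p = ∫⁻ t, liminf (fun n => ‖VV η i j (βn n) F t‖ₑ ^ p) atTop := by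
        refine lintegral_congr fun t => ?_
        exact (((pt t).enorm).ennrpow_const p).liminf_eq.symm
    _ ≤ liminf (fun n => ∫⁻ t, ‖VV η i j (βn n) F t‖ₑ ^ p) atTop :=
        lintegral_liminf_le' fun n => ((hg n).meas2 F hF).enorm.pow_const p
    _ ≤ liminf (fun n : ℕ => C * ∫⁻ t, ‖F t‖ₑ ^ p) atTop := liminf_le_liminf (Eventually.of_forall fun n => (hg n).bd F hF hFp)
    _ = _ := by simp

/-- grid points -/
def gp (N k : ℕ) : ℝ := -(N : ℝ) - 1 + k / (N + 1)

/-- step approximation -/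
def stp (β : ℝ → Matrix (Fin d) (Fin d) ℝ) (N n : ℕ) (t : ℝ) : Matrix (Fin d) (Fin d) ℝ :=
  ∑ k ∈ Finset.range n, if gp N (k + 1) ≤ t then β (gp N (k + 1)) - β (gp N k) else 0

theorem gp_mono (N k : ℕ) : gp N k ≤ gp N (k + 1) := by
  unfold gp; push_cast; gcongr; linarith

theorem stp_good (hp : 2 ≤ p) (hP : P = ENNReal.ofReal p) (hη : 0 < η) (hm : ∀ s t, s ≤ t → (β t - β s).PosSemidef) (N n : ℕ) :
    Good P (CH d p) p η i j (stp β N n) := by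
  induction n with
  | zero =>
    have : stp β N 0 = 0 := by funext t; simp [stp]
    rw [this]; exact Good_zero hp hP hη
  | succ n ih =>
    have := Good_step hp hP hη ih (gp N (n + 1)) (hm _ _ (gp_mono N n))
    have e : stp β N (n + 1) = fun t => stp β N n t + if gp N (n + 1) ≤ t then β (gp N (n + 1)) - β (gp N n) else 0 := by
      funext t; simp [stp, Finset.sum_range_succ]
    rw [e]; exact this

theorem stp_eq (N n : ℕ) (t : ℝ) : stp β N n t = β (gp N (min ⌊(t + N + 1) * (N + 1)⌋₊ n)) - β (gp N 0) := by
  have hN : (0:ℝ) < N + 1 := by positivity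
  have key : ∀ k : ℕ, gp N (k + 1) ≤ t ↔ k < ⌊(t + N + 1) * (N + 1)⌋₊ := by
    intro k
    rw [← Nat.succ_le_iff, Nat.le_floor_iff' (Nat.succ_ne_zero k), gp]
    push_cast
    rw [← div_le_iff₀ hN]
    constructor <;> intro h <;> linarith
  induction n with
  | zero => simp [stp]
  | succ n ih =>
    have e : stp β N (n + 1) t = stp β N n t + if gp N (n + 1) ≤ t then β (gp N (n + 1)) - β (gp N n) else 0 := by
      simp [stp, Finset.sum_range_succ]
    rw [e, ih]
    split_ifs with h
    · rw [key] at h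
      rw [min_eq_right h.le, min_eq_right (Nat.succ_le_iff.2 h)]; abel
    · rw [key, not_lt] at h
      rw [min_eq_left h, min_eq_left (by omega), add_zero]

/-- the grid point below `t` -/
def gb (N : ℕ) (t : ℝ) : ℝ := gp N ⌊(t + N + 1) * (N + 1)⌋₊

theorem gb_le {N : ℕ} {t : ℝ} (h : -(N:ℝ) - 1 ≤ t) : gb N t ≤ t ∧ t - 1 / (N + 1) ≤ gb N t := by
  have hN : (0:ℝ) < N + 1 := by positivity
  have h0 : 0 ≤ (t + N + 1) * (N + 1) := mul_nonneg (by linarith) hN.le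
  have h1 := Nat.floor_le h0
  have h2 := (Nat.lt_floor_add_one ((t + N + 1) * (N + 1))).le
  unfold gb gp
  set m := ⌊(t + N + 1) * (N + 1)⌋₊
  rw [← div_le_iff₀ hN] at h1
  rw [← le_div_iff₀ hN, add_div] at h2
  constructor <;> linarith

theorem gb_tendsto (t : ℝ) : Tendsto (fun N => gb N t) atTop (𝓝 t) := by
  have h1 : Tendsto (fun N : ℕ => t - 1 / ((N:ℝ) + 1)) atTop (𝓝 t) := by
    simpa using tendsto_const_nhds.sub tendsto_one_div_add_atTop_nhds_zero_nat (f := fun _ : ℕ => t)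
  have h2 : ∀ᶠ N : ℕ in atTop, -(N:ℝ) - 1 ≤ t := by
    filter_upwards [eventually_ge_atTop ⌈-t⌉₊] with N hN
    have := (Nat.le_ceil (-t)).trans (Nat.cast_le.2 hN)
    linarith
  exact tendsto_of_tendsto_of_tendsto_of_le_of_le' h1 tendsto_const_nhds (h2.mono fun N h => (gb_le h).2) (h2.mono fun N h => (gb_le h).1)

theorem transfer (hp : 2 ≤ p) (hP : P = ENNReal.ofReal p) (hη : 0 < η) (hm : ∀ s t, s ≤ t → (β t - β s).PosSemidef)
    (hc : Continuous fun t => (β t).trace) {F : ℝ → LP P d} (hF : Integrable F) (hFp : MemLp F P volume) :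
    ∫⁻ t, ‖VV η i j β F t‖ₑ ^ p ≤ CH d p * ∫⁻ t, ‖F t‖ₑ ^ p := by
  refine Good_lim hη (βn := fun N => stp β N (2 * (N + 1) ^ 2)) (fun N => stp_good hp hP hη hm _ _) ?_ hF hFp
  intro s t hst g
  have E : ∀ t : ℝ, Tendsto (fun N => Gam (β t - β (min (gb N t) t)) g) atTop (𝓝 g) := by
    intro t
    refine Gam_tendsto (fun N => hm _ _ (min_le_right _ _)) ?_ g
    have : Tendsto (fun N => min (gb N t) t) atTop (𝓝 t) := by
      simpa using (gb_tendsto t).min (tendsto_const_nhds (x := t))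
    have h2 := (hc.tendsto t).comp this
    have h3 := (tendsto_const_nhds (x := (β t).trace)).sub h2
    simpa [Matrix.trace_sub] using h3
  have ev : ∀ t : ℝ, ∀ᶠ N : ℕ in atTop, -(N:ℝ) - 1 ≤ t ∧ t ≤ N + 1 := by
    intro t
    filter_upwards [eventually_ge_atTop ⌈|t|⌉₊] with N hN
    have := (Nat.le_ceil (|t|)).trans (Nat.cast_le.2 hN)
    have := abs_le.1 this
    constructor <;> linarith
  have es : ∀ (t : ℝ) (N : ℕ), t ≤ N + 1 → stp β N (2 * (N + 1) ^ 2) t = β (gb N t) - β (gp N 0) := by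
    intro t N ht
    rw [stp_eq, min_eq_left, gb]
    apply Nat.floor_le_of_le
    push_cast
    have hN : (0:ℝ) < N + 1 := by positivity
    nlinarith
  have gbm : ∀ N : ℕ, gb N s ≤ gb N t := by
    intro N
    unfold gb gp
    gcongr
  rw [tendsto_iff_dist_tendsto_zero]
  have bd : Tendsto (fun N => ‖Gam (β t - β (min (gb N t) t)) g - g‖ + ‖Gam (β s - β (min (gb N s) s)) g - g‖) atTop (𝓝 0) := by
    have a := tendsto_iff_norm_sub_tendsto_zero.1 (E t)
    have b := tendsto_iff_norm_sub_tendsto_zero.1 (E s)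
    simpa using a.add b
  refine squeeze_zero' (Eventually.of_forall fun _ => dist_nonneg) ?_ bd
  filter_upwards [ev t, ev s] with N ht hs
  rw [dist_eq_norm, es t N ht.2, es s N hs.2, sub_sub_sub_cancel_right]
  refine Gam_diff (hm _ _ (gbm N)) (hm s t hst) (hm _ _ (min_le_right _ _)) (hm _ _ (min_le_right _ _)) ?_ g
  rw [min_eq_left (gb_le ht.1).1, min_eq_left (gb_le hs.1).1]
  abel

end MR

end

section

namespace MR
open ProbabilityTheory Matrix Filter Topology

variable {d : ℕ} {P : ℝ≥0∞} [Fact (1 ≤ P)] [Fact (P ≠ ∞)]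

/-- admissible densities for the time change -/
structure TC (T : ℝ) (ρ : ℝ → ℝ) : Prop where
  T0 : 0 ≤ T
  meas : Measurable ρ
  pos : ∀ t, 0 < ρ t
  out : ∀ t, t ∉ Ioc 0 T → ρ t = 1
  int : IntegrableOn ρ (Ioc 0 T)

variable {T : ℝ} {ρ : ℝ → ℝ}

theorem TC.ii (h : TC T ρ) (s t : ℝ) : IntervalIntegrable ρ volume s t := by
  have e : ρ = (Ioc 0 T).indicator ρ + (Ioc 0 T)ᶜ.indicator (fun _ => (1:ℝ)) := by
    funext r
    by_cases hr : r ∈ Ioc 0 T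
    · simp only [Pi.add_apply]; rw [indicator_of_mem hr, indicator_of_notMem (by simpa using hr), add_zero]
    · simp only [Pi.add_apply]; rw [indicator_of_notMem hr, indicator_of_mem (by exact hr), zero_add, h.out r hr]
  rw [e]
  refine IntervalIntegrable.add ?_ ?_
  · exact ((integrable_indicator_iff measurableSet_Ioc).2 h.int).intervalIntegrable
  · rw [intervalIntegrable_iff]
    refine Measure.integrableOn_of_bounded (M := 1) (by simp) ((measurable_const.indicator measurableSet_Ioc.compl).aestronglyMeasurable) ?_
    refine Eventually.of_forall fun r => ?_
    by_cases hr : r ∈ (Ioc 0 T)ᶜ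
    · rw [indicator_of_mem hr]; simp
    · rw [indicator_of_notMem hr]; simp

/-- the new time -/
def th (ρ : ℝ → ℝ) (t : ℝ) : ℝ := ∫ r in (0:ℝ)..t, ρ r

theorem TC.th_sub (h : TC T ρ) (s t : ℝ) : th ρ t - th ρ s = ∫ r in s..t, ρ r := by
  unfold th
  rw [intervalIntegral.integral_interval_sub_left] <;> exact h.ii _ _

theorem TC.th_mono (h : TC T ρ) : StrictMono (th ρ) := by
  intro s t hst
  rw [← sub_pos, h.th_sub]
  exact intervalIntegral.intervalIntegral_pos_of_pos (h.ii s t) h.pos hst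

theorem TC.th_cont (h : TC T ρ) : Continuous (th ρ) := intervalIntegral.continuous_primitive h.ii 0

theorem TC.th_surj (h : TC T ρ) : Function.Surjective (th ρ) := by
  have c1 : ∀ t, T ≤ t → th ρ t - th ρ T = t - T := by
    intro t ht
    rw [h.th_sub, intervalIntegral.integral_of_le ht, setIntegral_congr_fun (g := fun _ => (1:ℝ)) measurableSet_Ioc]
    · rw [← intervalIntegral.integral_of_le ht]; simp
    · intro r hr
      exact h.out r (fun hh => absurd hr.1 (not_lt.2 hh.2))
  have c2 : ∀ t, t ≤ 0 → th ρ t = t := by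
    intro t ht
    have : th ρ 0 = 0 := by simp [th]
    have e : th ρ 0 - th ρ t = 0 - t := by
      rw [h.th_sub, intervalIntegral.integral_of_le ht, setIntegral_congr_fun (g := fun _ => (1:ℝ)) measurableSet_Ioc]
      · rw [← intervalIntegral.integral_of_le ht]; simp
      · intro r hr
        exact h.out r (fun hh => absurd hh.1 (not_lt.2 hr.2))
    linarith
  refine h.th_cont.surjective ?_ ?_
  · have : Tendsto (fun t => th ρ T + (t - T)) atTop atTop :=
      tendsto_atTop_add_const_left _ _ (tendsto_atTop_add_const_right _ _ tendsto_id)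
    refine this.congr' ?_
    filter_upwards [eventually_ge_atTop T] with t ht
    have := c1 t ht; linarith
  · refine tendsto_id.congr' ?_
    filter_upwards [eventually_le_atBot 0] with t ht
    exact (c2 t ht).symm

/-- the time change as an order isomorphism -/
def TC.iso (h : TC T ρ) : ℝ ≃o ℝ := h.th_mono.orderIsoOfSurjective _ h.th_surj

theorem TC.iso_apply (h : TC T ρ) (t : ℝ) : h.iso t = th ρ t := rfl

/-- measurable version -/
def TC.me (h : TC T ρ) : ℝ ≃ᵐ ℝ := h.iso.toHomeomorph.toMeasurableEquiv

theorem TC.me_apply (h : TC T ρ) (t : ℝ) : h.me t = th ρ t := rfl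

theorem TC.symm_th (h : TC T ρ) (t : ℝ) : h.iso.symm (th ρ t) = t := h.iso.symm_apply_apply t

/-- weighted measure -/
def mw (ρ : ℝ → ℝ) : Measure ℝ := volume.withDensity fun t => ENNReal.ofReal (ρ t)

theorem TC.mp (h : TC T ρ) : MeasurePreserving h.me (mw ρ) volume := by
  refine ⟨h.me.measurable, ?_⟩
  symm
  refine Real.measure_ext_Ioo_rat fun a b => ?_
  rw [Measure.map_apply h.me.measurable measurableSet_Ioo]
  have e : h.me ⁻¹' Ioo (a:ℝ) b = Ioo (h.iso.symm a) (h.iso.symm b) := by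
    ext t
    change (a:ℝ) < h.iso t ∧ h.iso t < b ↔ _
    rw [mem_Ioo, OrderIso.symm_apply_lt, OrderIso.lt_symm_apply]
  rw [e, mw, withDensity_apply _ measurableSet_Ioo]
  rcases le_or_gt (a:ℝ) b with hab | hab
  · have hab' : h.iso.symm a ≤ h.iso.symm b := h.iso.symm.monotone hab
    rw [← ofReal_integral_eq_lintegral_ofReal]
    · rw [← integral_Ioc_eq_integral_Ioo, ← intervalIntegral.integral_of_le hab', ← h.th_sub, ← h.iso_apply, ← h.iso_apply]
      simp
    · exact ((h.ii _ _).1).mono_set Ioo_subset_Ioc_self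
    · exact Eventually.of_forall fun r => (h.pos r).le
  · rw [Ioo_eq_empty (not_lt.2 hab.le), Ioo_eq_empty (not_lt.2 (h.iso.symm.monotone hab.le))]; simp

theorem TC.lint (h : TC T ρ) (g : ℝ → ℝ≥0∞) : ∫⁻ σ, g σ = ∫⁻ t, g (th ρ t) * ENNReal.ofReal (ρ t) := by
  rw [← h.mp.lintegral_comp_emb h.me.measurableEmbedding, mw, lintegral_withDensity_eq_lintegral_mul_non_measurable _ h.meas.ennreal_ofReal (by simp)]
  refine lintegral_congr fun t => ?_
  simp only [Pi.mul_apply]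
  rw [mul_comm]; rfl

theorem TC.integ (h : TC T ρ) (g : ℝ → LP P d) : ∫ σ, g σ = ∫ t, ρ t • g (th ρ t) := by
  rw [← h.mp.integral_comp', mw, integral_withDensity_eq_integral_toReal_smul h.meas.ennreal_ofReal (by simp)]
  congr 1 with t
  rw [ENNReal.toReal_ofReal (h.pos t).le]; rfl

variable {a b : ℝ → Fin d → Fin d → ℝ} {p η : ℝ} {i j : Fin d}

/-- the time changed force -/
def GG (h : TC T ρ) (f : ℝ → LP P d) (σ : ℝ) : LP P d := (ρ (h.iso.symm σ))⁻¹ • f (h.iso.symm σ)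

theorem GG_th (h : TC T ρ) (f : ℝ → LP P d) (t : ℝ) : GG h f (th ρ t) = (ρ t)⁻¹ • f t := by
  rw [GG, h.symm_th]

theorem GG_meas (h : TC T ρ) {f : ℝ → LP P d} (hf : AEStronglyMeasurable f volume) : AEStronglyMeasurable (GG h f) volume := by
  have ac : Measure.QuasiMeasurePreserving h.me.symm volume volume := by
    have h1 := h.mp.symm.quasiMeasurePreserving
    refine ⟨h1.measurable, h1.absolutelyContinuous.trans ?_⟩
    exact withDensity_absolutelyContinuous _ _
  have h2 : AEStronglyMeasurable (fun t => (ρ t)⁻¹ • f t) volume := (h.meas.inv.aestronglyMeasurable).smul hf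
  exact h2.comp_quasiMeasurePreserving ac

theorem GG_int (h : TC T ρ) {f : ℝ → LP P d} (hf : Integrable f) : Integrable (GG h f) := by
  refine ⟨GG_meas h hf.1, ?_⟩
  rw [HasFiniteIntegral, h.lint]
  have : ∫⁻ t, ‖GG h f (th ρ t)‖ₑ * ENNReal.ofReal (ρ t) = ∫⁻ t, ‖f t‖ₑ := by
    refine lintegral_congr fun t => ?_
    have := h.pos t
    rw [GG_th, ← ofReal_norm_eq_enorm, ← ofReal_norm_eq_enorm, ← ENNReal.ofReal_mul (norm_nonneg _), norm_smul, norm_inv, Real.norm_of_nonneg this.le]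
    congr 1; field_simp
  rw [this]; exact hf.2

theorem GG_lp (h : TC T ρ) (hp : 1 ≤ p) (f : ℝ → LP P d) : ∫⁻ σ, ‖GG h f σ‖ₑ ^ p = ∫⁻ t, ‖f t‖ₑ ^ p * ENNReal.ofReal (ρ t ^ (1 - p)) := by
  rw [h.lint]
  refine lintegral_congr fun t => ?_
  have := h.pos t
  rw [GG_th, ← ofReal_norm_eq_enorm, ← ofReal_norm_eq_enorm, norm_smul, norm_inv, Real.norm_of_nonneg this.le,
    ENNReal.ofReal_rpow_of_nonneg (by positivity) (by linarith), ENNReal.ofReal_rpow_of_nonneg (by positivity) (by linarith),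
    ← ENNReal.ofReal_mul (by positivity), ← ENNReal.ofReal_mul (by positivity)]
  congr 1
  rw [Real.mul_rpow (by positivity) (by positivity), Real.rpow_sub this, Real.rpow_one, Real.inv_rpow this.le]
  field_simp

/-- time changed covariance -/
def bb (h : TC T ρ) (b : ℝ → Fin d → Fin d → ℝ) (σ : ℝ) : Matrix (Fin d) (Fin d) ℝ := CC b 0 (h.iso.symm σ)

theorem bb_sub (h : TC T ρ) (hb : Coef b) (σ τ : ℝ) : bb h b τ - bb h b σ = CC b (h.iso.symm σ) (h.iso.symm τ) := by
  rw [bb, bb, sub_eq_iff_eq_add, add_comm, hb.CC_add]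

theorem bb_cont (h : TC T ρ) (hb : Coef b) : Continuous fun σ => (bb h b σ).trace := by
  have : Continuous fun t => (CC b 0 t).trace := by
    unfold trace
    refine continuous_finsetSum _ fun k _ => ?_
    simp only [diag, CC, of_apply]
    exact intervalIntegral.continuous_primitive (fun s t => hb.ii k k s t) 0
  exact this.comp h.iso.symm.continuous

theorem CC_split (h : TC T ρ) (ha : Coef a) (hb : Coef b)
    (hab : ∀ᵐ r, r ∈ Ioc 0 T → ∀ i j, a r i j = b r i j + if i = j then ρ r / 2 else 0) {s t : ℝ} (hs : 0 < s) (hst : s ≤ t) (htT : t ≤ T) :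
    CC a s t = (th ρ t - th ρ s) • (1 : Matrix (Fin d) (Fin d) ℝ) + CC b s t := by
  ext k l
  rw [h.th_sub, Matrix.add_apply, Matrix.smul_apply]
  simp only [CC, of_apply, smul_eq_mul]
  rw [← intervalIntegral.integral_mul_const, ← intervalIntegral.integral_add ((h.ii s t).mul_const _) (hb.ii k l s t)]
  refine intervalIntegral.integral_congr_ae ?_
  filter_upwards [hab] with r hr hr'
  rw [uIoc_of_le hst] at hr'
  rw [hr ⟨hs.trans hr'.1, hr'.2.trans htT⟩ k l, Matrix.one_apply]
  split_ifs <;> ring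

theorem Kop_uu (h : TC T ρ) (ha : Coef a) (hb : Coef b)
    (hab : ∀ᵐ r, r ∈ Ioc 0 T → ∀ i j, a r i j = b r i j + if i = j then ρ r / 2 else 0)
    {f : ℝ → LP P d} (hf : Integrable f) (hf0 : ∀ s, s ∉ Ioc 0 T → f s = 0) (hη : 0 < η) {t : ℝ} (ht : t ∈ Ioc 0 T) :
    Kop η i j (uu a f t) = VV η i j (bb h b) (GG h f) (th ρ t) := by
  rw [uu, ← ContinuousLinearMap.integral_comp_comm _ (ha.UU_int hf t).integrableOn, VV, ← integral_indicator measurableSet_Iic,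
    ← integral_indicator measurableSet_Iic]
  refine Eq.trans ?_ (h.integ _).symm
  refine integral_congr_ae (Eventually.of_forall fun s => ?_)
  simp only
  by_cases hst : s ≤ t
  · rw [indicator_of_mem (by exact hst), indicator_of_mem (by exact h.th_mono.monotone hst), GG_th, bb_sub h hb, h.symm_th, h.symm_th]
    by_cases hs : s ∈ Ioc 0 T
    · have hth : 0 ≤ th ρ t - th ρ s := sub_nonneg.2 (h.th_mono.monotone hst)
      rw [map_smul, map_smul, smul_smul, mul_inv_cancel₀ (h.pos s).ne', one_smul, UU, min_eq_left hst, CC_split h ha hb hab hs.1 hst ht.2,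
        Gam_add (smul_one_psd hth) (hb.CC_psd hst), Kop_add hη hth, max_eq_right (by linarith), add_comm η]
    · rw [hf0 s hs]; simp
  · rw [indicator_of_notMem (by exact hst), indicator_of_notMem (by simpa using h.th_mono (not_le.1 hst)), smul_zero]

theorem tc_bound (h : TC T ρ) (hp : 2 ≤ p) (hP : P = ENNReal.ofReal p) (ha : Coef a) (hb : Coef b)
    (hab : ∀ᵐ r, r ∈ Ioc 0 T → ∀ i j, a r i j = b r i j + if i = j then ρ r / 2 else 0)
    {f : ℝ → LP P d} (hf : Integrable f) (hf0 : ∀ s, s ∉ Ioc 0 T → f s = 0) (hη : 0 < η)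
    (hfp : ∫⁻ s, ‖f s‖ₑ ^ p * ENNReal.ofReal (ρ s ^ (1 - p)) ≠ ∞) (i j : Fin d) :
    ∫⁻ t in Ioc 0 T, ‖Kop η i j (uu a f t)‖ₑ ^ p * ENNReal.ofReal (ρ t) ≤ CH d p * ∫⁻ s, ‖f s‖ₑ ^ p * ENNReal.ofReal (ρ s ^ (1 - p)) := by
  have hp0 : 0 < p := by linarith
  have hmem : MemLp (GG h f) P volume := by
    refine ⟨GG_meas h hf.1, ?_⟩
    rw [eLpP hp0 hP, GG_lp h (by linarith)]
    exact ENNReal.rpow_lt_top_of_nonneg (by positivity) hfp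
  have hm : ∀ σ τ, σ ≤ τ → (bb h b τ - bb h b σ).PosSemidef := by
    intro σ τ hστ
    rw [bb_sub h hb]
    exact hb.CC_psd (h.iso.symm.monotone hστ)
  have key := transfer (i := i) (j := j) hp hP hη hm (bb_cont h hb) (GG_int h hf) hmem
  rw [GG_lp h (by linarith), h.lint] at key
  refine le_trans ?_ key
  refine le_trans (le_of_eq ?_) (setLIntegral_le_lintegral (Ioc 0 T) _)
  refine setLIntegral_congr_fun measurableSet_Ioc fun t ht => ?_
  rw [Kop_uu h ha hb hab hf hf0 hη ht]

end MR

end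

section

namespace MR
open ProbabilityTheory Matrix Filter Topology

variable {d : ℕ} {P : ℝ≥0∞} [Fact (1 ≤ P)] [Fact (P ≠ ∞)]
variable {T : ℝ} {ρ : ℝ → ℝ} {a b : ℝ → Fin d → Fin d → ℝ} {p η : ℝ} {i j : Fin d}

/-- force increment under heat smoothing -/
def dG (r : ℝ) (f : ℝ → LP P d) (s : ℝ) : LP P d := Gam (r • (1 : Matrix (Fin d) (Fin d) ℝ)) (f s) - f s

theorem dG_int (r : ℝ) {f : ℝ → LP P d} (hf : Integrable f) : Integrable (dG r f) :=
  ((Gam (r • (1 : Matrix (Fin d) (Fin d) ℝ))).integrable_comp hf).sub hf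

theorem dG_norm (r : ℝ) (f : ℝ → LP P d) (s : ℝ) : ‖dG r f s‖ₑ ≤ 2 * ‖f s‖ₑ := by
  rw [← ofReal_norm_eq_enorm, ← ofReal_norm_eq_enorm, show (2:ℝ≥0∞) = ENNReal.ofReal 2 by simp, ← ENNReal.ofReal_mul (by norm_num)]
  refine ENNReal.ofReal_le_ofReal ?_
  refine (norm_sub_le _ _).trans ?_
  have := Gam_norm_le (r • (1 : Matrix (Fin d) (Fin d) ℝ)) (f s)
  linarith

theorem uu_dG (ha : Coef a) {f : ℝ → LP P d} (hf : Integrable f) (r t : ℝ) :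
    uu a (dG r f) t = Gam (r • (1 : Matrix (Fin d) (Fin d) ℝ)) (uu a f t) - uu a f t := by
  unfold uu
  rw [← ContinuousLinearMap.integral_comp_comm _ (ha.UU_int hf t).integrableOn,
    ← integral_sub (((Gam (r • (1 : Matrix (Fin d) (Fin d) ℝ))).integrable_comp (ha.UU_int hf t)).integrableOn) (ha.UU_int hf t).integrableOn]
  refine integral_congr_ae (Eventually.of_forall fun s => ?_)
  simp only [dG, map_sub, UU]
  rw [Gam_comm]

theorem Kop_diff (ha : Coef a) {f : ℝ → LP P d} (hf : Integrable f) {η' : ℝ} (h : 0 < η') (hh : η' ≤ η) (t : ℝ) :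
    Kop η i j (uu a f t) - Kop η' i j (uu a f t) = Kop η' i j (uu a (dG (η - η') f) t) := by
  rw [uu_dG ha hf, map_sub, Kop_add h (by linarith)]
  congr 3; ring

/-- size of the increment -/
def EE (p : ℝ) (ρ : ℝ → ℝ) (f : ℝ → LP P d) (r : ℝ) : ℝ≥0∞ := ∫⁻ s, ‖dG r f s‖ₑ ^ p * ENNReal.ofReal (ρ s ^ (1 - p))

theorem EE_fin (hp : 2 ≤ p) {f : ℝ → LP P d} (hfp : ∫⁻ s, ‖f s‖ₑ ^ p * ENNReal.ofReal (ρ s ^ (1 - p)) ≠ ∞) :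
    ∫⁻ s, (2 * ‖f s‖ₑ) ^ p * ENNReal.ofReal (ρ s ^ (1 - p)) ≠ ∞ := by
  have : ∀ s, (2 * ‖f s‖ₑ) ^ p * ENNReal.ofReal (ρ s ^ (1 - p)) = 2 ^ p * (‖f s‖ₑ ^ p * ENNReal.ofReal (ρ s ^ (1 - p))) := by
    intro s
    rw [ENNReal.mul_rpow_of_nonneg _ _ (by linarith), mul_assoc]
  simp only [this]
  rw [lintegral_const_mul' _ _ (ENNReal.rpow_ne_top_of_nonneg (by linarith) (by simp))]
  exact ENNReal.mul_ne_top (ENNReal.rpow_ne_top_of_nonneg (by linarith) (by simp)) hfp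

theorem EE_le (hp : 2 ≤ p) (f : ℝ → LP P d) (r : ℝ) :
    EE p ρ f r ≤ ∫⁻ s, (2 * ‖f s‖ₑ) ^ p * ENNReal.ofReal (ρ s ^ (1 - p)) := by
  refine lintegral_mono fun s => ?_
  have := dG_norm r f s
  gcongr

theorem EE_tendsto (hρ : Measurable ρ) (hp : 2 ≤ p) {f : ℝ → LP P d} (hf : Integrable f)
    (hfp : ∫⁻ s, ‖f s‖ₑ ^ p * ENNReal.ofReal (ρ s ^ (1 - p)) ≠ ∞) :
    Tendsto (EE p ρ f) (𝓝[≥] 0) (𝓝 0) := by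
  have hp0 : 0 < p := by linarith
  have e0 : (0:ℝ≥0∞) = ∫⁻ s : ℝ, 0 := by simp
  rw [e0]
  refine tendsto_lintegral_filter_of_dominated_convergence' (fun s => (2 * ‖f s‖ₑ) ^ p * ENNReal.ofReal (ρ s ^ (1 - p))) ?_ ?_ (EE_fin hp hfp) ?_
  · refine Eventually.of_forall fun r => ?_
    exact ((dG_int r hf).1.enorm.pow_const p).mul (hρ.pow_const _).ennreal_ofReal.aemeasurable
  · refine Eventually.of_forall fun r => Eventually.of_forall fun s => ?_
    have := dG_norm r f s
    gcongr
  · refine Eventually.of_forall fun s => ?_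
    have h1 : Tendsto (fun r : ℝ => Gam (max r 0 • (1 : Matrix (Fin d) (Fin d) ℝ)) (f s)) (𝓝[≥] 0) (𝓝 (f s)) := by
      refine Gam_tendsto (fun r => smul_one_psd (le_max_right _ _)) ?_ _
      have : Continuous fun r : ℝ => (max r 0 • (1 : Matrix (Fin d) (Fin d) ℝ)).trace := by
        simp only [trace_smul, smul_eq_mul]; fun_prop
      have h2 := this.tendsto 0
      simp at h2
      simpa using h2.mono_left nhdsWithin_le_nhds
    have h2 : Tendsto (fun r : ℝ => ‖dG r f s‖ₑ) (𝓝[≥] 0) (𝓝 0) := by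
      have h3 := (h1.sub_const (f s)).enorm
      rw [sub_self, enorm_zero] at h3
      refine h3.congr' ?_
      filter_upwards [self_mem_nhdsWithin] with r hr
      rw [max_eq_left hr, dG]
    have h4 := (ENNReal.continuous_rpow_const (y := p)).tendsto 0 |>.comp h2
    rw [ENNReal.zero_rpow_of_pos hp0] at h4
    have := ENNReal.Tendsto.mul_const h4 (b := ENNReal.ofReal (ρ s ^ (1 - p))) (Or.inr (by simp))
    rwa [zero_mul] at this

/-- weighted time measure -/
def mT (T : ℝ) (ρ : ℝ → ℝ) : Measure ℝ := (volume.restrict (Ioc 0 T)).withDensity fun t => ENNReal.ofReal (ρ t)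

theorem mT_lint (hρ : Measurable ρ) (g : ℝ → ℝ≥0∞) : ∫⁻ t, g t ∂(mT T ρ) = ∫⁻ t in Ioc 0 T, g t * ENNReal.ofReal (ρ t) := by
  rw [mT, lintegral_withDensity_eq_lintegral_mul_non_measurable _ hρ.ennreal_ofReal (by simp)]
  refine lintegral_congr fun t => ?_
  simp only [Pi.mul_apply]
  rw [mul_comm]

theorem diff_bound (h : TC T ρ) (hp : 2 ≤ p) (hP : P = ENNReal.ofReal p) (ha : Coef a) (hb : Coef b)
    (hab : ∀ᵐ r, r ∈ Ioc 0 T → ∀ i j, a r i j = b r i j + if i = j then ρ r / 2 else 0)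
    {f : ℝ → LP P d} (hf : Integrable f) (hf0 : ∀ s, s ∉ Ioc 0 T → f s = 0) {η' : ℝ} (h0 : 0 < η') (hh : η' ≤ η)
    (hfp : ∫⁻ s, ‖f s‖ₑ ^ p * ENNReal.ofReal (ρ s ^ (1 - p)) ≠ ∞) (i j : Fin d) :
    eLpNorm (fun t => Kop η i j (uu a f t) - Kop η' i j (uu a f t)) P (mT T ρ) ≤ (CH d p * EE p ρ f (η - η')) ^ (1 / p) := by
  have hp0 : 0 < p := by linarith
  rw [eLpP hp0 hP, mT_lint h.meas]
  refine ENNReal.rpow_le_rpow ?_ (by positivity)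
  simp only [Kop_diff ha hf h0 hh]
  refine tc_bound h hp hP ha hb hab (dG_int _ hf) ?_ h0 ?_ i j
  · intro s hs; simp [dG, hf0 s hs]
  · exact ne_top_of_le_ne_top (EE_fin hp hfp) (EE_le hp f _)

theorem lim_bound (h : TC T ρ) (hp : 2 ≤ p) (hP : P = ENNReal.ofReal p) (ha : Coef a) (hb : Coef b)
    (hab : ∀ᵐ r, r ∈ Ioc 0 T → ∀ i j, a r i j = b r i j + if i = j then ρ r / 2 else 0)
    {f : ℝ → LP P d} (hf : Integrable f) (hf0 : ∀ s, s ∉ Ioc 0 T → f s = 0)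
    (hfp : ∫⁻ s, ‖f s‖ₑ ^ p * ENNReal.ofReal (ρ s ^ (1 - p)) ≠ ∞) (i j : Fin d) :
    ∃ w : ℝ → LP P d, AEStronglyMeasurable w (volume.restrict (Ioc 0 T)) ∧
      (∀ᵐ t ∂(volume.restrict (Ioc 0 T)), ∀ φ, Test φ → prL (pd i (pd j φ)) (uu a f t) = prL φ (w t)) ∧
      ∫⁻ t in Ioc 0 T, ‖w t‖ₑ ^ p * ENNReal.ofReal (ρ t) ≤ CH d p * ∫⁻ s, ‖f s‖ₑ ^ p * ENNReal.ofReal (ρ s ^ (1 - p)) := by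
  have hp0 : 0 < p := by linarith
  have hP1 : 1 ≤ P := Fact.out
  -- rate
  have hF : Tendsto (fun r => (CH d p * EE p ρ f r) ^ (1 / p)) (𝓝[≥] 0) (𝓝 0) := by
    have h1 := ENNReal.Tendsto.const_mul (EE_tendsto h.meas hp hf hfp) (a := CH d p) (Or.inr (CH_top d hp))
    rw [mul_zero] at h1
    have h4 := (ENNReal.continuous_rpow_const (y := 1 / p)).tendsto 0 |>.comp h1
    rwa [ENNReal.zero_rpow_of_pos (by positivity)] at h4
  let B : ℕ → ℝ≥0∞ := fun n => 2⁻¹ ^ n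
  have hB : ∑' n, B n ≠ ∞ := by simp [B, ENNReal.tsum_geometric]
  let e : ℕ → ℝ := fun k => 1 / ((k:ℝ) + 1)
  have e0 : ∀ k, 0 < e k := fun k => Nat.one_div_pos_of_nat
  have eanti : Antitone e := fun m n hmn => Nat.one_div_le_one_div hmn
  have elim : Tendsto e atTop (𝓝 0) := tendsto_one_div_add_atTop_nhds_zero_nat
  have hev : ∀ n, ∀ᶠ k in atTop, ∀ r, 0 ≤ r → r ≤ e k → (CH d p * EE p ρ f r) ^ (1 / p) < B n := by
    intro n
    have h1 := hF.eventually (gt_mem_nhds (show (0:ℝ≥0∞) < B n from ENNReal.pow_pos (by simp) n))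
    obtain ⟨R, hR, hR'⟩ := mem_nhdsGE_iff_exists_Icc_subset.1 h1
    filter_upwards [elim.eventually (gt_mem_nhds (show (0:ℝ) < R from hR))] with k hk r h0 hr
    exact hR' ⟨h0, hr.trans hk.le⟩
  obtain ⟨κ, hκ, hκB⟩ := extraction_forall_of_eventually hev
  let W : ℕ → ℝ → LP P d := fun n t => Kop (e (κ n)) i j (uu a f t)
  have Wc : ∀ n, Continuous (W n) := fun n => (Kop (e (κ n)) i j).continuous.comp (ha.uu_cont hf)
  have cau1 : ∀ N n m, N ≤ n → n ≤ m → eLpNorm (W n - W m) P (mT T ρ) < B N := by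
    intro N n m hn hm
    have h1 := eanti (hκ.monotone hm)
    have h2 := eanti (hκ.monotone hn)
    refine (diff_bound h hp hP ha hb hab hf hf0 (e0 (κ m)) h1 hfp i j).trans_lt (hκB N _ (by linarith) ?_)
    have := e0 (κ m); linarith
  have cau : ∀ N n m, N ≤ n → N ≤ m → eLpNorm (W n - W m) P (mT T ρ) < B N := by
    intro N n m hn hm
    rcases le_total n m with hnm | hnm
    · exact cau1 N n m hn hnm
    · rw [eLpNorm_sub_comm]; exact cau1 N m n hm hnm
  have conv := Lp.ae_tendsto_of_cauchy_eLpNorm (fun n => (Wc n).aestronglyMeasurable) hP1 hB cau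
  have conv' : ∀ᵐ t ∂(volume.restrict (Ioc 0 T)), ∃ l, Tendsto (fun n => W n t) atTop (𝓝 l) := by
    rw [mT, ae_withDensity_iff h.meas.ennreal_ofReal] at conv
    filter_upwards [conv] with t ht
    exact ht (by simpa using h.pos t)
  classical
  let w : ℝ → LP P d := fun t => if hh : ∃ l, Tendsto (fun n => W n t) atTop (𝓝 l) then hh.choose else 0
  have hw : ∀ᵐ t ∂(volume.restrict (Ioc 0 T)), Tendsto (fun n => W n t) atTop (𝓝 (w t)) := by
    filter_upwards [conv'] with t ht
    simp only [w, dif_pos ht]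
    exact ht.choose_spec
  refine ⟨w, aestronglyMeasurable_of_tendsto_ae atTop (fun n => (Wc n).aestronglyMeasurable) hw, ?_, ?_⟩
  · filter_upwards [hw] with t ht φ hφ
    have h1 : Tendsto (fun n => prL φ (W n t)) atTop (𝓝 (prL φ (w t))) := ((prL φ).continuous.tendsto _).comp ht
    have h2 : Tendsto (fun n => Gam (e (κ n) • (1 : Matrix (Fin d) (Fin d) ℝ)) (uu a f t)) atTop (𝓝 (uu a f t)) := by
      refine Gam_tendsto (fun n => smul_one_psd (e0 _).le) ?_ _
      simp only [trace_smul, smul_eq_mul]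
      simpa using (elim.comp hκ.tendsto_atTop).mul_const (trace (1 : Matrix (Fin d) (Fin d) ℝ))
    have h3 := ((prL (P := P) (pd i (pd j φ))).continuous.tendsto _).comp h2
    refine tendsto_nhds_unique h3 (h1.congr fun n => ?_)
    exact pr_Kop hφ (e0 _) i j _
  · calc ∫⁻ t in Ioc 0 T, ‖w t‖ₑ ^ p * ENNReal.ofReal (ρ t)
        ≤ ∫⁻ t in Ioc 0 T, liminf (fun n => ‖W n t‖ₑ ^ p * ENNReal.ofReal (ρ t)) atTop := by
          refine lintegral_mono_ae ?_
          filter_upwards [hw] with t ht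
          have h4 := (ENNReal.continuous_rpow_const (y := p)).tendsto _ |>.comp ht.enorm
          exact (ENNReal.Tendsto.mul_const h4 (b := ENNReal.ofReal (ρ t)) (Or.inr (by simp))).liminf_eq.ge
      _ ≤ liminf (fun n => ∫⁻ t in Ioc 0 T, ‖W n t‖ₑ ^ p * ENNReal.ofReal (ρ t)) atTop := by
          refine lintegral_liminf_le fun n => ?_
          exact ((Wc n).enorm.measurable.pow_const p).mul h.meas.ennreal_ofReal
      _ ≤ _ := by
          refine liminf_le_of_le (by isBoundedDefault) fun c hc => ?_
          obtain ⟨n, hn⟩ := hc.exists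
          exact hn.trans (tc_bound h hp hP ha hb hab hf hf0 (e0 _) hfp i j)

end MR

end

section

namespace MR
open ProbabilityTheory Matrix Filter Topology

variable {d : ℕ} {P : ℝ≥0∞} [Fact (1 ≤ P)] [Fact (P ≠ ∞)]
variable {T : ℝ} {a : ℝ → Fin d → Fin d → ℝ} {δ : ℝ → ℝ} {p : ℝ}

/-- truncated coefficients -/
def A0 (T : ℝ) (a : ℝ → Fin d → Fin d → ℝ) (t : ℝ) (i j : Fin d) : ℝ := (Ioc 0 T).indicator (fun t => a t i j) t

theorem A0_in {t : ℝ} (ht : t ∈ Ioc 0 T) (i j : Fin d) : A0 T a t i j = a t i j := indicator_of_mem ht _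
theorem A0_out {t : ℝ} (ht : t ∉ Ioc 0 T) (i j : Fin d) : A0 T a t i j = 0 := indicator_of_notMem ht _

theorem le_aMax (a : ℝ → Fin d → Fin d → ℝ) (t : ℝ) (i j : Fin d) : |a t i j| ≤ aMax a t := by
  refine (le_ciSup (f := fun j => |a t i j|) (Set.finite_range _).bddAbove j).trans ?_
  exact le_ciSup (f := fun i => ⨆ j, |a t i j|) (Set.finite_range _).bddAbove i

theorem A0_coef (hm : ∀ i j, Measurable fun t => a t i j) (hs : ∀ t ∈ Ioc (0:ℝ) T, ∀ i j, a t i j = a t j i)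
    (hpos : ∀ t ∈ Ioc (0:ℝ) T, ∀ ξ : Fin d → ℝ, 0 ≤ ∑ i, ∑ j, a t i j * ξ i * ξ j)
    (hi : IntegrableOn (aMax a) (Ioc (0:ℝ) T)) : Coef (A0 T a) where
  int i j := by
    refine (integrable_indicator_iff measurableSet_Ioc).2 ?_
    exact Integrable.mono' hi (hm i j).aestronglyMeasurable (Eventually.of_forall fun t => le_aMax a t i j)
  sym t i j := by
    by_cases ht : t ∈ Ioc 0 T
    · rw [A0_in ht, A0_in ht, hs t ht]
    · rw [A0_out ht, A0_out ht]
  psd t ξ := by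
    by_cases ht : t ∈ Ioc 0 T
    · simp only [A0_in ht]; exact hpos t ht ξ
    · simp [A0_out ht]

/-- hypothesis that `δ` is the least eigenvalue -/
def Least (T : ℝ) (a : ℝ → Fin d → Fin d → ℝ) (δ : ℝ → ℝ) : Prop := ∀ t ∈ Ioc (0:ℝ) T,
  (∀ ξ : Fin d → ℝ, δ t * (∑ k, ξ k ^ 2) ≤ ∑ i, ∑ j, a t i j * ξ i * ξ j) ∧
  (∃ ξ : Fin d → ℝ, (∑ k, ξ k ^ 2) = 1 ∧ (∑ i, ∑ j, a t i j * ξ i * ξ j) = δ t)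

/-- truncated least eigenvalue -/
def DD (T : ℝ) (δ : ℝ → ℝ) : ℝ → ℝ := (Ioc 0 T).indicator δ

theorem DD_in {t : ℝ} (ht : t ∈ Ioc 0 T) : DD T δ t = δ t := indicator_of_mem ht _
theorem DD_out {t : ℝ} (ht : t ∉ Ioc 0 T) : DD T δ t = 0 := indicator_of_notMem ht _

theorem lt_iff (h : Least T a δ) {t : ℝ} (ht : t ∈ Ioc 0 T) (c : ℝ) :
    δ t < c ↔ ∃ k : ℕ, ∑ i, ∑ j, a t i j * TopologicalSpace.denseSeq (Fin d → ℝ) k i * TopologicalSpace.denseSeq (Fin d → ℝ) k j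
      < c * ∑ l, TopologicalSpace.denseSeq (Fin d → ℝ) k l ^ 2 := by
  constructor
  · intro hc
    obtain ⟨ξ, h1, h2⟩ := (h t ht).2
    have ho : IsOpen {ξ : Fin d → ℝ | ∑ i, ∑ j, a t i j * ξ i * ξ j < c * ∑ l, ξ l ^ 2} :=
      isOpen_lt (by fun_prop) (by fun_prop)
    obtain ⟨k, hk⟩ := (TopologicalSpace.denseRange_denseSeq (Fin d → ℝ)).exists_mem_open ho ⟨ξ, by
      simp only [mem_setOf_eq, h1, h2]; linarith⟩
    exact ⟨k, hk⟩
  · rintro ⟨k, hk⟩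
    by_contra! hc
    have h1 := (h t ht).1 (TopologicalSpace.denseSeq (Fin d → ℝ) k)
    have h2 : 0 ≤ ∑ l, TopologicalSpace.denseSeq (Fin d → ℝ) k l ^ 2 := by positivity
    nlinarith

theorem DD_meas (hm : ∀ i j, Measurable fun t => a t i j) (h : Least T a δ) : Measurable (DD T δ) := by
  refine measurable_of_Iio fun c => ?_
  have e : DD T δ ⁻¹' Iio c = (Ioc 0 T ∩ ⋃ k : ℕ, {t | ∑ i, ∑ j, a t i j * TopologicalSpace.denseSeq (Fin d → ℝ) k i * TopologicalSpace.denseSeq (Fin d → ℝ) k j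
      < c * ∑ l, TopologicalSpace.denseSeq (Fin d → ℝ) k l ^ 2}) ∪ ((Ioc 0 T)ᶜ ∩ {_t | 0 < c}) := by
    ext t
    by_cases ht : t ∈ Ioc 0 T
    · simp only [mem_preimage, mem_Iio, DD_in ht, mem_union, mem_inter_iff, ht, true_and, mem_compl_iff, not_true, false_and, or_false, mem_iUnion,
        mem_setOf_eq]
      exact lt_iff h ht c
    · simp only [mem_preimage, mem_Iio, DD_out ht, mem_union, mem_inter_iff, ht, false_and, false_or, mem_compl_iff, not_false_eq_true, true_and, mem_setOf_eq]
  rw [e]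
  refine (measurableSet_Ioc.inter (MeasurableSet.iUnion fun k => measurableSet_lt ?_ measurable_const)).union
    (measurableSet_Ioc.compl.inter (MeasurableSet.const _))
  refine Finset.measurable_sum _ fun i _ => Finset.measurable_sum _ fun j _ => ?_
  exact ((hm i j).mul_const _).mul_const _

theorem DD_nn (hpos : ∀ t ∈ Ioc (0:ℝ) T, ∀ ξ : Fin d → ℝ, 0 ≤ ∑ i, ∑ j, a t i j * ξ i * ξ j) (h : Least T a δ) (t : ℝ) : 0 ≤ DD T δ t := by
  by_cases ht : t ∈ Ioc 0 T
  · rw [DD_in ht]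
    obtain ⟨ξ, h1, h2⟩ := (h t ht).2
    rw [← h2]; exact hpos t ht ξ
  · rw [DD_out ht]

theorem DD_le (h : Least T a δ) (i : Fin d) (t : ℝ) : DD T δ t ≤ A0 T a t i i := by
  by_cases ht : t ∈ Ioc 0 T
  · rw [DD_in ht, A0_in ht]
    have := (h t ht).1 (Pi.single i 1)
    simpa [Pi.single_apply] using this
  · rw [DD_out ht, A0_out ht]

theorem DD_int (hd : 0 < d) (hm : ∀ i j, Measurable fun t => a t i j)
    (hpos : ∀ t ∈ Ioc (0:ℝ) T, ∀ ξ : Fin d → ℝ, 0 ≤ ∑ i, ∑ j, a t i j * ξ i * ξ j) (h : Least T a δ) (hA : Coef (A0 T a)) :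
    Integrable (DD T δ) := by
  refine Integrable.mono' (hA.int ⟨0, hd⟩ ⟨0, hd⟩) (DD_meas hm h).aestronglyMeasurable (Eventually.of_forall fun t => ?_)
  rw [Real.norm_of_nonneg (DD_nn hpos h t)]
  exact DD_le h _ t

/-- time density -/
def rh (T : ℝ) (δ : ℝ → ℝ) (t : ℝ) : ℝ := if 0 < DD T δ t then 2 * DD T δ t else 1

theorem rh_TC (hT : 0 < T) (hm : Measurable (DD T δ)) (hi : Integrable (DD T δ)) : TC T (rh T δ) where
  T0 := hT.le
  meas := Measurable.ite (measurableSet_lt measurable_const hm) (hm.const_mul 2) measurable_const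
  pos t := by unfold rh; split_ifs <;> linarith
  out t ht := by unfold rh; rw [DD_out ht]; simp
  int := by
    have h1 : IntegrableOn (fun t => 2 * |DD T δ t| + 1) (Ioc 0 T) := ((hi.abs.const_mul 2).integrableOn).add (by simp)
    refine Integrable.mono' h1 (Measurable.ite (measurableSet_lt measurable_const hm) (hm.const_mul 2) measurable_const).aestronglyMeasurable
      (Eventually.of_forall fun t => ?_)
    unfold rh
    have := abs_nonneg (DD T δ t)
    split_ifs with hh
    · rw [Real.norm_of_nonneg (by linarith)]; have := le_abs_self (DD T δ t); linarith
    · rw [norm_one]; linarith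

/-- degenerate part of the coefficients -/
def B0 (T : ℝ) (a : ℝ → Fin d → Fin d → ℝ) (δ : ℝ → ℝ) (t : ℝ) (i j : Fin d) : ℝ :=
  {t | 0 < DD T δ t}.indicator (fun t => A0 T a t i j - if i = j then DD T δ t else 0) t

theorem B0_coef (hA : Coef (A0 T a)) (hm : Measurable (DD T δ)) (hi : Integrable (DD T δ)) (h : Least T a δ) : Coef (B0 T a δ) where
  int i j := by
    refine Integrable.indicator ?_ (measurableSet_lt measurable_const hm)
    refine (hA.int i j).sub ?_
    split_ifs
    · exact hi
    · exact integrable_zero _ _ _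
  sym t i j := by
    unfold B0
    by_cases ht : 0 < DD T δ t
    · rw [indicator_of_mem (by exact ht), indicator_of_mem (by exact ht), hA.sym]; simp only [eq_comm]
    · rw [indicator_of_notMem (by exact ht), indicator_of_notMem (by exact ht)]
  psd t ξ := by
    unfold B0
    by_cases ht : 0 < DD T δ t
    · have ht' : t ∈ Ioc 0 T := by by_contra hh; rw [DD_out hh] at ht; exact lt_irrefl _ ht
      simp only [indicator_of_mem (show t ∈ {t | 0 < DD T δ t} from ht), A0_in ht', DD_in ht']
      have h1 := (h t ht').1 ξ
      have h2 : ∑ i, ∑ j, (if i = j then δ t else 0) * ξ i * ξ j = δ t * ∑ k, ξ k ^ 2 := by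
        rw [Finset.mul_sum]
        refine Finset.sum_congr rfl fun i _ => ?_
        simp only [ite_mul, zero_mul, Finset.sum_ite_eq, Finset.mem_univ, if_true]
        ring
      simp only [sub_mul, Finset.sum_sub_distrib]
      rw [h2]; linarith
    · simp [indicator_of_notMem (show t ∉ {t | 0 < DD T δ t} from ht)]

theorem hab0 (h0 : ∀ᵐ t ∂(volume.restrict (Ioc (0:ℝ) T)), 0 < δ t) :
    ∀ᵐ r, r ∈ Ioc 0 T → ∀ i j, A0 T a r i j = B0 T a δ r i j + if i = j then rh T δ r / 2 else 0 := by
  rw [ae_restrict_iff' measurableSet_Ioc] at h0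
  filter_upwards [h0] with r hr hr' i j
  have hD : 0 < DD T δ r := by rw [DD_in hr']; exact hr hr'
  rw [B0, indicator_of_mem (by exact hD), rh, if_pos hD]
  split_ifs <;> ring

/-- truncated force -/
def F0 (T : ℝ) (f : ℝ → LP P d) : ℝ → LP P d := (Ioc 0 T).indicator f

theorem F0_int (hp : 2 ≤ p) {f : ℝ → LP P d} (hf : AEStronglyMeasurable f (volume.restrict (Ioc (0:ℝ) T)))
    (hi : IntegrableOn (fun t => ‖f t‖ ^ p) (Ioc (0:ℝ) T)) : Integrable (F0 T f) := by
  refine (integrable_indicator_iff measurableSet_Ioc).2 ?_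
  have h1 : IntegrableOn (fun t => ‖f t‖ ^ p + 1) (Ioc 0 T) := hi.add (by simp)
  refine Integrable.mono' h1 hf (Eventually.of_forall fun t => ?_)
  rcases le_total ‖f t‖ 1 with h | h
  · have : 0 ≤ ‖f t‖ ^ p := by positivity
    linarith
  · have := Real.self_le_rpow_of_one_le h (show 1 ≤ p by linarith)
    linarith

theorem F0_w (hp : 2 ≤ p) {f : ℝ → LP P d} (h0 : ∀ᵐ t ∂(volume.restrict (Ioc (0:ℝ) T)), 0 < δ t)
    (hi : IntegrableOn (fun t => ‖f t‖ ^ p * δ t ^ (1 - p)) (Ioc (0:ℝ) T)) :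
    ∫⁻ s, ‖F0 T f s‖ₑ ^ p * ENNReal.ofReal (rh T δ s ^ (1 - p)) ≤ ENNReal.ofReal (∫ t in Ioc (0:ℝ) T, ‖f t‖ ^ p * δ t ^ (1 - p)) := by
  have hp0 : 0 < p := by linarith
  rw [ofReal_integral_eq_lintegral_ofReal hi (by filter_upwards [h0] with t ht; simp only [Pi.zero_apply]; positivity)]
  rw [← lintegral_indicator measurableSet_Ioc]
  rw [ae_restrict_iff' measurableSet_Ioc] at h0
  refine lintegral_mono_ae ?_
  filter_upwards [h0] with t ht
  by_cases ht' : t ∈ Ioc 0 T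
  · have h1 := ht ht'
    have hD : 0 < DD T δ t := by rw [DD_in ht']; exact h1
    rw [indicator_of_mem ht', F0, indicator_of_mem ht', rh, if_pos hD, DD_in ht', ENNReal.ofReal_mul (by positivity), ← ofReal_norm_eq_enorm,
      ENNReal.ofReal_rpow_of_nonneg (norm_nonneg _) hp0.le]
    refine mul_le_mul' le_rfl (ENNReal.ofReal_le_ofReal ?_)
    exact Real.rpow_le_rpow_of_nonpos h1 (by linarith) (by linarith)
  · rw [F0, indicator_of_notMem ht']
    simp [hp0]

end MR

end

section

namespace MR
open ProbabilityTheory Matrix Filter Topology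

variable {d : ℕ} {P : ℝ≥0∞} [Fact (1 ≤ P)] [Fact (P ≠ ∞)]
variable {T : ℝ} {a : ℝ → Fin d → Fin d → ℝ} {δ : ℝ → ℝ} {p : ℝ}

theorem weak_iff (f v : ℝ → LP P d) : IsWeakSolution P T a 0 f v ↔
    ∀ φ, Test φ → ∀ t ∈ Icc (0:ℝ) T, prL φ (v t) = ∫ r in (0:ℝ)..t, (WW (A0 T a) φ r (v r) + prL φ (F0 T f r)) := by
  have key : ∀ φ, Test φ → ∀ t ∈ Icc (0:ℝ) T, (∫ r in (0:ℝ)..t, (WW (A0 T a) φ r (v r) + prL φ (F0 T f r))) =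
      (∫ x, (0 : LP P d) x * φ x) + ∫ s in Ioc (0:ℝ) t,
          ((∑ i, ∑ j, a s i j * ∫ x, v s x * pd i (pd j φ) x) + ∫ x, f s x * φ x) := by
    intro φ hφ t ht
    rw [← prT hφ, map_zero, zero_add, intervalIntegral.integral_of_le ht.1]
    refine setIntegral_congr_fun measurableSet_Ioc fun s hs => ?_
    have hs' : s ∈ Ioc 0 T := ⟨hs.1, hs.2.trans ht.2⟩
    simp only [WW, A0_in hs', F0, indicator_of_mem hs', prT hφ]
    congr 1
    refine Finset.sum_congr rfl fun i _ => Finset.sum_congr rfl fun j _ => ?_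
    rw [prT ((hφ.pd j).pd i)]
  constructor
  · intro H φ hφ t ht
    rw [key φ hφ t ht, prT hφ]
    exact H φ hφ.1 hφ.2 t ht
  · intro H φ h1 h2 t ht
    rw [← key φ ⟨h1, h2⟩ t ht, ← prT ⟨h1, h2⟩]
    exact H φ ⟨h1, h2⟩ t ht

theorem F0_ii {f : ℝ → LP P d} (hf : Integrable (F0 T f)) (φ : (Fin d → ℝ) → ℝ) (s t : ℝ) :
    IntervalIntegrable (fun r => prL φ (F0 T f r)) volume s t := ((prL φ).integrable_comp hf).intervalIntegrable

theorem weak_uu (hA : Coef (A0 T a)) {f : ℝ → LP P d} (hf : Integrable (F0 T f)) :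
    IsWeakSolution P T a 0 f (uu (A0 T a) (F0 T f)) := by
  rw [weak_iff]
  intro φ hφ t ht
  rw [hA.uu_weak hf hφ, intervalIntegral.integral_add (hA.WW_int φ ht.1 (hA.uu_cont hf).continuousOn) (F0_ii hf φ 0 t), add_comm,
    intervalIntegral.integral_of_le ht.1, intervalIntegral.integral_of_le ht.1]
  have hout : ∀ r ∈ Iic t \ Ioc 0 t, r ∉ Ioc 0 T := fun r hr hh => hr.2 ⟨hh.1, hr.1⟩
  congr 1
  · refine setIntegral_eq_of_subset_of_forall_diff_eq_zero measurableSet_Iic (fun r hr => hr.2) fun r hr => ?_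
    simp [WW, A0_out (hout r hr)]
  · refine setIntegral_eq_of_subset_of_forall_diff_eq_zero measurableSet_Iic (fun r hr => hr.2) fun r hr => ?_
    rw [F0, indicator_of_notMem (hout r hr), map_zero]

theorem weak_unique (hA : Coef (A0 T a)) {f u v : ℝ → LP P d} (hf : Integrable (F0 T f)) (hu : ContinuousOn u (Icc 0 T))
    (hv : ContinuousOn v (Icc 0 T)) (hu' : IsWeakSolution P T a 0 f u) (hv' : IsWeakSolution P T a 0 f v) {t : ℝ} (ht : t ∈ Icc 0 T) :
    v t = u t := by
  rw [weak_iff] at hu' hv'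
  have sub : ∀ s ∈ Icc 0 t, Icc 0 s ⊆ Icc 0 T := fun s hs => Icc_subset_Icc le_rfl (hs.2.trans ht.2)
  have := hA.unique (z := fun s => v s - u s) ht.1 ((hv.sub hu).mono (sub t ⟨ht.1, le_rfl⟩)) fun φ hφ s hs => by
    have i1 := (hA.WW_int φ hs.1 (hu.mono (sub s hs))).add (F0_ii hf φ 0 s)
    have i2 := (hA.WW_int φ hs.1 (hv.mono (sub s hs))).add (F0_ii hf φ 0 s)
    rw [map_sub, hu' φ hφ s ⟨hs.1, hs.2.trans ht.2⟩, hv' φ hφ s ⟨hs.1, hs.2.trans ht.2⟩, ← intervalIntegral.integral_sub i2 i1]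
    refine intervalIntegral.integral_congr fun r _ => ?_
    simp only [WW, map_sub, mul_sub, Finset.sum_sub_distrib]
    ring
  exact sub_eq_zero.1 this

theorem sup_bound (hT : 0 < T) (hp : 2 ≤ p) {f : ℝ → LP P d} (hm : AEStronglyMeasurable f (volume.restrict (Ioc (0:ℝ) T)))
    (hi : IntegrableOn (fun t => ‖f t‖ ^ p) (Ioc (0:ℝ) T)) (t : ℝ) :
    ‖uu (A0 T a) (F0 T f) t‖ ^ p ≤ T ^ (p - 1) * ∫ s in Ioc (0:ℝ) T, ‖f s‖ ^ p := by
  have hp0 : 0 < p := by linarith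
  have hf := F0_int hp hm hi
  have h1 : ‖uu (A0 T a) (F0 T f) t‖ ≤ ∫ s in Ioc (0:ℝ) T, ‖f s‖ := by
    refine (uu_norm _ hf t).trans ?_
    refine (setIntegral_le_integral hf.norm (Eventually.of_forall fun s => norm_nonneg _)).trans (le_of_eq ?_)
    rw [← integral_indicator measurableSet_Ioc]
    refine integral_congr_ae (Eventually.of_forall fun s => ?_)
    simp only [F0, norm_indicator_eq_indicator_norm]
  have h2 : ∫⁻ s in Ioc (0:ℝ) T, ‖f s‖ₑ ≤ (∫⁻ s in Ioc (0:ℝ) T, ‖f s‖ₑ ^ p) ^ (1 / p) * ENNReal.ofReal T ^ (1 - 1 / p) := by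
    have := eLpNorm_le_eLpNorm_mul_rpow_measure_univ (μ := volume.restrict (Ioc (0:ℝ) T)) (p := 1) (q := ENNReal.ofReal p)
      (by rw [← ENNReal.ofReal_one]; exact ENNReal.ofReal_le_ofReal (by linarith)) hm
    rw [eLpNorm_one_eq_lintegral_enorm, eLp_eq hp0, ENNReal.toReal_ofReal hp0.le] at this
    simpa using this
  have hI : 0 ≤ ∫ s in Ioc (0:ℝ) T, ‖f s‖ ^ p := integral_nonneg fun s => by positivity
  have e1 : ∫⁻ s in Ioc (0:ℝ) T, ‖f s‖ₑ ^ p = ENNReal.ofReal (∫ s in Ioc (0:ℝ) T, ‖f s‖ ^ p) := by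
    rw [ofReal_integral_eq_lintegral_ofReal hi (Eventually.of_forall fun s => by positivity)]
    refine lintegral_congr fun s => ?_
    rw [← ofReal_norm_eq_enorm, ENNReal.ofReal_rpow_of_nonneg (norm_nonneg _) hp0.le]
  have h3 : ∫ s in Ioc (0:ℝ) T, ‖f s‖ ≤ (∫ s in Ioc (0:ℝ) T, ‖f s‖ ^ p) ^ (1 / p) * T ^ (1 - 1 / p) := by
    rw [← ENNReal.ofReal_le_ofReal_iff (by positivity)]
    refine (ofReal_int_le _).trans ?_
    simp only [ofReal_norm_eq_enorm]
    refine h2.trans (le_of_eq ?_)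
    rw [e1, ENNReal.ofReal_rpow_of_nonneg hI (by positivity), ENNReal.ofReal_rpow_of_pos hT, ← ENNReal.ofReal_mul (by positivity)]
  calc ‖uu (A0 T a) (F0 T f) t‖ ^ p ≤ ((∫ s in Ioc (0:ℝ) T, ‖f s‖ ^ p) ^ (1 / p) * T ^ (1 - 1 / p)) ^ p :=
        Real.rpow_le_rpow (norm_nonneg _) (h1.trans h3) hp0.le
    _ = _ := by
        rw [Real.mul_rpow (by positivity) (by positivity), ← Real.rpow_mul hI, ← Real.rpow_mul hT.le, one_div_mul_cancel hp0.ne', Real.rpow_one, mul_comm]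
        congr 2; field_simp

theorem w_bound (hp : 2 ≤ p) {w : ℝ → Fin d → Fin d → LP P d} {J : ℝ} (hJ : 0 ≤ J) (hD : Measurable (DD T δ))
    (hwm : ∀ i j, AEStronglyMeasurable (fun t => w t i j) (volume.restrict (Ioc (0:ℝ) T)))
    (hw : ∀ i j, ∫⁻ t in Ioc 0 T, ‖w t i j‖ₑ ^ p * ENNReal.ofReal (rh T δ t) ≤ CH d p * ENNReal.ofReal J)
    (hr : Measurable (rh T δ))
    (h0 : ∀ᵐ t ∂(volume.restrict (Ioc (0:ℝ) T)), 0 < δ t) :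
    (∫ t in Ioc (0:ℝ) T, (∑ i, ∑ j, ‖w t i j‖ ^ p) * δ t) ≤ ((d:ℝ) * (d * (CH d p).toReal)) * J := by
  have hp0 : 0 < p := by linarith
  rw [← ENNReal.ofReal_le_ofReal_iff (by positivity)]
  refine (ofReal_int_le _).trans ?_
  calc ∫⁻ t in Ioc (0:ℝ) T, ENNReal.ofReal ((∑ i, ∑ j, ‖w t i j‖ ^ p) * δ t)
      ≤ ∫⁻ t in Ioc (0:ℝ) T, ∑ i, ∑ j, ‖w t i j‖ₑ ^ p * ENNReal.ofReal (rh T δ t) := by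
        refine lintegral_mono_ae ?_
        filter_upwards [h0, ae_restrict_mem measurableSet_Ioc] with t ht ht'
        rw [Finset.sum_mul, ENNReal.ofReal_sum_of_nonneg (fun i _ => by positivity)]
        refine Finset.sum_le_sum fun i _ => ?_
        rw [Finset.sum_mul, ENNReal.ofReal_sum_of_nonneg (fun i _ => by positivity)]
        refine Finset.sum_le_sum fun j _ => ?_
        rw [ENNReal.ofReal_mul (by positivity), ← ofReal_norm_eq_enorm, ENNReal.ofReal_rpow_of_nonneg (norm_nonneg _) hp0.le]
        refine mul_le_mul' le_rfl (ENNReal.ofReal_le_ofReal ?_)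
        rw [rh, DD_in ht', if_pos ht]; linarith
    _ = ∑ i, ∑ j, ∫⁻ t in Ioc (0:ℝ) T, ‖w t i j‖ₑ ^ p * ENNReal.ofReal (rh T δ t) := by
        have hmm : ∀ i j, AEMeasurable (fun t => ‖w t i j‖ₑ ^ p * ENNReal.ofReal (rh T δ t)) (volume.restrict (Ioc (0:ℝ) T)) :=
          fun i j => ((hwm i j).enorm.pow_const p).mul hr.ennreal_ofReal.aemeasurable
        rw [lintegral_finsetSum' _ fun i _ => Finset.aemeasurable_fun_sum _ fun j _ => hmm i j]
        exact Finset.sum_congr rfl fun i _ => lintegral_finsetSum' _ fun j _ => hmm i j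
    _ ≤ ∑ i : Fin d, ∑ j : Fin d, CH d p * ENNReal.ofReal J := Finset.sum_le_sum fun i _ => Finset.sum_le_sum fun j _ => hw i j
    _ = _ := by
        rw [ENNReal.ofReal_mul (by positivity), ENNReal.ofReal_mul (by positivity), ENNReal.ofReal_mul (by positivity), ENNReal.ofReal_toReal (CH_top d hp)]
        simp [mul_assoc]

end MR

end

/-- Deterministic specialization of the paper's main theorem: for degenerate, possibly
unbounded coefficients there is a unique continuous `L_p`-valued weak solution with zero
initial data; it satisfies `sup_t ‖u(t)‖_{L_p}^p ≤ N₁(p,T) ∫_0^T ‖f‖_{L_p}^p dt` and the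
sharp weighted estimate
`∫_0^T Σ ‖u_{x^ix^j}(t)‖_{L_p}^p δ(t) dt ≤ N₂(d,p) ∫_0^T ‖f(t)‖_{L_p}^p δ(t)^{1-p} dt`. -/
theorem main_deterministic (p : ℝ) (hp : 2 ≤ p) [Fact (1 ≤ ENNReal.ofReal p)] :
    ∃ N₁ : ℝ → ℝ, ∃ N₂ : ℕ → ℝ,
      ∀ (T : ℝ), 0 < T →
      ∀ (d : ℕ), 0 < d →
      ∀ (a : ℝ → Fin d → Fin d → ℝ),
        (∀ i j, Measurable fun t => a t i j) →
        (∀ t ∈ Ioc (0:ℝ) T, ∀ i j, a t i j = a t j i) →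
        (∀ t ∈ Ioc (0:ℝ) T, ∀ ξ : Fin d → ℝ,
          0 ≤ ∑ i, ∑ j, a t i j * ξ i * ξ j) →
        IntegrableOn (aMax a) (Ioc (0:ℝ) T) →
      ∀ (δ : ℝ → ℝ),
        -- `δ t` is the smallest eigenvalue of the symmetric matrix `A(t)`:
        (∀ t ∈ Ioc (0:ℝ) T,
          (∀ ξ : Fin d → ℝ, δ t * (∑ k, ξ k ^ 2) ≤ ∑ i, ∑ j, a t i j * ξ i * ξ j) ∧
          (∃ ξ : Fin d → ℝ, (∑ k, ξ k ^ 2) = 1 ∧ (∑ i, ∑ j, a t i j * ξ i * ξ j) = δ t)) →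
        (∀ᵐ t ∂(volume.restrict (Ioc (0:ℝ) T)), 0 < δ t) →
      ∀ (f : ℝ → Lp ℝ (ENNReal.ofReal p) (volume : Measure (Fin d → ℝ))),
        AEStronglyMeasurable f (volume.restrict (Ioc (0:ℝ) T)) →
        IntegrableOn (fun t => ‖f t‖ ^ p) (Ioc (0:ℝ) T) →
        IntegrableOn (fun t => ‖f t‖ ^ p * δ t ^ (1 - p)) (Ioc (0:ℝ) T) →
        ∃ u : ℝ → Lp ℝ (ENNReal.ofReal p) (volume : Measure (Fin d → ℝ)),
          ContinuousOn u (Icc (0:ℝ) T) ∧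
          IsWeakSolution (ENNReal.ofReal p) T a 0 f u ∧
          (∀ t ∈ Icc (0:ℝ) T,
            ‖u t‖ ^ p ≤ N₁ T * ∫ s in Ioc (0:ℝ) T, ‖f s‖ ^ p) ∧
          (∃ w : ℝ → Fin d → Fin d → Lp ℝ (ENNReal.ofReal p) (volume : Measure (Fin d → ℝ)),
            (∀ᵐ t ∂(volume.restrict (Ioc (0:ℝ) T)), ∀ i j : Fin d,
              ∀ φ : (Fin d → ℝ) → ℝ, ContDiff ℝ (⊤ : ℕ∞) φ → HasCompactSupport φ →
                (∫ x, u t x * pd i (pd j φ) x) = ∫ x, w t i j x * φ x) ∧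
            (∫ t in Ioc (0:ℝ) T, (∑ i, ∑ j, ‖w t i j‖ ^ p) * δ t) ≤
              N₂ d * ∫ t in Ioc (0:ℝ) T, ‖f t‖ ^ p * δ t ^ (1 - p)) ∧
          (∀ v : ℝ → Lp ℝ (ENNReal.ofReal p) (volume : Measure (Fin d → ℝ)),
            ContinuousOn v (Icc (0:ℝ) T) →
            IsWeakSolution (ENNReal.ofReal p) T a 0 f v →
            ∀ t ∈ Icc (0:ℝ) T, v t = u t) := by
  haveI : Fact (ENNReal.ofReal p ≠ ∞) := ⟨ENNReal.ofReal_ne_top⟩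
  refine ⟨fun T => T ^ (p - 1), fun d => (d:ℝ) * (d * (MR.CH d p).toReal), ?_⟩
  intro T hT d hd a hm hs hpos hi δ hδ h0 f hfm hfi hfw
  have hA := MR.A0_coef hm hs hpos hi
  have hL : MR.Least T a δ := hδ
  have hDm := MR.DD_meas hm hL
  have hDi := MR.DD_int hd hm hpos hL hA
  have hTC := MR.rh_TC hT hDm hDi
  have hB := MR.B0_coef hA hDm hDi hL
  have hF := MR.F0_int hp hfm hfi
  have hW := MR.F0_w hp h0 hfw
  have hJ : 0 ≤ ∫ t in Ioc (0:ℝ) T, ‖f t‖ ^ p * δ t ^ (1 - p) := by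
    refine integral_nonneg_of_ae ?_
    filter_upwards [h0] with t ht
    simp only [Pi.zero_apply]; positivity
  have hlim := fun i j => MR.lim_bound hTC hp rfl hA hB (MR.hab0 h0) hF (fun s hs => indicator_of_notMem hs _)
    (ne_top_of_le_ne_top ENNReal.ofReal_ne_top hW) i j
  choose w hw1 hw2 hw3 using hlim
  have hc := hA.uu_cont hF
  refine ⟨MR.uu (MR.A0 T a) (MR.F0 T f), hc.continuousOn, MR.weak_uu hA hF, fun t _ => MR.sup_bound hT hp hfm hfi t,
    ⟨fun t i j => w i j t, ?_, ?_⟩, ?_⟩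
  · have : ∀ᵐ t ∂(volume.restrict (Ioc (0:ℝ) T)), ∀ i j : Fin d, ∀ φ, MR.Test φ →
        MR.prL (pd i (pd j φ)) (MR.uu (MR.A0 T a) (MR.F0 T f) t) = MR.prL φ (w i j t) :=
      ae_all_iff.2 fun i => ae_all_iff.2 fun j => hw2 i j
    filter_upwards [this] with t ht i j φ h1 h2
    have hφ : MR.Test φ := ⟨h1, h2⟩
    rw [← MR.prT ((hφ.pd j).pd i), ← MR.prT hφ]
    exact ht i j φ hφ
  · refine MR.w_bound hp hJ hDm hw1 (fun i j => (hw3 i j).trans ?_) hTC.meas h0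
    gcongr
  · intro v hv hv' t ht
    exact MR.weak_unique hA hF hc.continuousOn hv (MR.weak_uu hA hF) hv' ht

end
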